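/- Let S² denote the unit sphere in ℝ³ with its subspace metric, and let h : S² → S² be a continuous map. Then h is monotone if and only if there exists a sequence of homeomorphisms h_j : S² → S² (j = 1, 2, ...) converging to h uniformly on S². -/

import Mathlib

open Filter

namespace Youngs

open Set Topology

/-- The six edge directions of the triangular lattice on `ℤ × ℤ`, in cyclic order. -/
def dir : Fin 6 → ℤ × ℤ := ![(1, 0), (1, 1), (0, 1), (-1, 0), (-1, -1), (0, -1)]

/-- Adjacency in the triangular lattice. -/
def Adj (u v : ℤ × ℤ) : Prop := ∃ i, v = u + dir i

lemma dir_add_three (i : Fin 6) : dir (i + 3) = -dir i := by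
  fin_cases i <;> rfl

lemma dir_add_dir (i : Fin 6) : dir i + dir (i + 2) = dir (i + 1) := by
  fin_cases i <;> rfl

lemma dir_ne_zero (i : Fin 6) : dir i ≠ 0 := by
  fin_cases i <;> simp [dir]

lemma Adj.symm {u v : ℤ × ℤ} (h : Adj u v) : Adj v u := by
  obtain ⟨i, rfl⟩ := h
  exact ⟨i + 3, by rw [dir_add_three]; abel⟩

lemma Adj.ne {u v : ℤ × ℤ} (h : Adj u v) : u ≠ v := by
  obtain ⟨i, rfl⟩ := h
  simpa using dir_ne_zero i

lemma adj_dir (u : ℤ × ℤ) (i : Fin 6) : Adj u (u + dir i) := ⟨i, rfl⟩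

lemma adj_dir_succ (u : ℤ × ℤ) (i : Fin 6) : Adj (u + dir i) (u + dir (i + 1)) :=
  ⟨i + 2, by rw [← dir_add_dir i]; abel⟩

/-- The box of lattice points that may change sides. -/
noncomputable def box (k : ℤ) : Finset (ℤ × ℤ) := Finset.Icc 1 (2 * k) ×ˢ Finset.Icc (1 - k) k

/-- Lattice points that are always below. -/
def bot (k : ℤ) : Set (ℤ × ℤ) := {v | v ∉ box k ∧ v.2 ≤ 0}

/-- Lattice points that are always above. -/
def top (k : ℤ) : Set (ℤ × ℤ) := {v | v ∉ box k ∧ 1 ≤ v.2}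

lemma mem_box {k : ℤ} {v : ℤ × ℤ} :
    v ∈ box k ↔ (1 ≤ v.1 ∧ v.1 ≤ 2 * k) ∧ 1 - k ≤ v.2 ∧ v.2 ≤ k := by
  simp [box]

/-- `v` can be joined to a point of `B` by steps inside `T`. -/
def Reach (T B : Set (ℤ × ℤ)) (v : ℤ × ℤ) : Prop :=
  ∃ b ∈ B, Relation.ReflTransGen (fun u w => Adj u w ∧ w ∈ T) v b

lemma Reach.of_mem {T B : Set (ℤ × ℤ)} {v : ℤ × ℤ} (h : v ∈ B) : Reach T B v :=
  ⟨v, h, .refl⟩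

lemma Reach.head {T B : Set (ℤ × ℤ)} {u v : ℤ × ℤ} (h : Adj u v) (hv : v ∈ T)
    (hr : Reach T B v) : Reach T B u := by
  obtain ⟨b, hb, hvb⟩ := hr
  exact ⟨b, hb, .head ⟨h, hv⟩ hvb⟩

/-- Induction along a path leading to `B`. -/
lemma Reach.rec_on {T B : Set (ℤ × ℤ)} {P : ℤ × ℤ → Prop} (hB : ∀ b ∈ B, P b)
    (hs : ∀ u v, Adj u v → v ∈ T → Reach T B v → P v → P u) {v : ℤ × ℤ}
    (h : Reach T B v) : P v := by
  obtain ⟨b, hb, h'⟩ := h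
  induction h' using Relation.ReflTransGen.head_induction_on with
  | refl => exact hB b hb
  | head h1 h2 ih => exact hs _ _ h1.1 h1.2 ⟨b, hb, h2⟩ ih

lemma Reach.mono {T T' B : Set (ℤ × ℤ)} (h : T ⊆ T') {v : ℤ × ℤ} (hr : Reach T B v) :
    Reach T' B v :=
  hr.rec_on (fun _ => Reach.of_mem) fun _ _ ha hv _ ih => ih.head ha (h hv)

/-- A set of lattice points lying between `bot` and `top`, both it and its complement
being connected to the respective outer part. -/
structure Good (k : ℤ) (S : Set (ℤ × ℤ)) : Prop where
  bot_subset : bot k ⊆ S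
  top_disj : ∀ v ∈ top k, v ∉ S
  reach_bot : ∀ v ∈ S, Reach S (bot k) v
  reach_top : ∀ v ∉ S, Reach Sᶜ (top k) v

lemma mem_box_or (k : ℤ) (v : ℤ × ℤ) : v ∈ box k ∨ v ∈ bot k ∨ v ∈ top k := by
  by_cases h : v ∈ box k
  · exact .inl h
  · rcases le_or_gt v.2 0 with h' | h'
    · exact .inr (.inl ⟨h, h'⟩)
    · exact .inr (.inr ⟨h, h'⟩)

lemma Good.diff_subset_box {k : ℤ} {S S' : Set (ℤ × ℤ)} (hS : Good k S) (hS' : Good k S') :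
    S' \ S ⊆ box k := by
  intro v hv
  rcases mem_box_or k v with h | h | h
  · exact h
  · exact absurd (hS.bot_subset h) hv.2
  · exact absurd hv.1 (hS'.top_disj v h)

/-- Between two nested good sets one can add a single point and stay good. -/
lemma Good.exists_insert {k : ℤ} {S S' : Set (ℤ × ℤ)} (hS : Good k S) (hS' : Good k S')
    (hss : S ⊂ S') : ∃ e ∈ S' \ S, Good k (insert e S) := by
  classical
  set Cand : Set (ℤ × ℤ) := {e | e ∈ S' \ S ∧ ∃ u ∈ S, Adj e u} with hCand
  set Bad : ℤ × ℤ → Set (ℤ × ℤ) :=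
    fun e => {v | v ∉ S ∧ v ≠ e ∧ ¬ Reach (insert e S)ᶜ (top k) v} with hBad
  have hne : Cand.Nonempty := by
    obtain ⟨v, hv', hv⟩ := exists_of_ssubset hss
    have key : v ∈ S' → v ∉ S → Cand.Nonempty := by
      refine Reach.rec_on (P := fun v => v ∈ S' → v ∉ S → Cand.Nonempty)
        (fun b hb _ hb' => absurd (hS.bot_subset hb) hb') ?_ (hS'.reach_bot v hv')
      intro u w huw hw _ ih hu hu'
      by_cases hwS : w ∈ S
      · exact ⟨u, ⟨hu, hu'⟩, w, hwS, huw⟩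
      · exact ih hw hwS
    exact key hv' hv
  have hfin : Cand.Finite := ((box k).finite_toSet.subset
    fun e he => hS.diff_subset_box hS' he.1)
  have hbadS' : ∀ e ∈ Cand, Bad e ⊆ S' \ S := by
    intro e he v hv
    refine ⟨?_, hv.1⟩
    by_contra hvS'
    refine hv.2.2 ((hS'.reach_top v hvS').mono ?_)
    rw [compl_subset_compl]
    exact insert_subset he.1.1 hss.subset
  have hbadfin : ∀ e ∈ Cand, (Bad e).Finite := fun e he =>
    (box k).finite_toSet.subset ((hbadS' e he).trans (hS.diff_subset_box hS'))
  obtain ⟨e, he, hmin⟩ := exists_min_image Cand (fun e => (Bad e).ncard) hfin hne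
  have heB : e ∈ box k := hS.diff_subset_box hS' he.1
  refine ⟨e, he.1, ?_⟩
  have hclosed : ∀ v ∈ Bad e, ∀ u, Adj v u → u ∉ S → u ≠ e → u ∈ Bad e := by
    intro v hv u hvu hu hue
    exact ⟨hu, hue, fun hr => hv.2.2 (hr.head hvu (by simp [hu, hue]))⟩
  have hempty : Bad e = ∅ := by
    by_contra hne'
    have hne' : (Bad e).Nonempty := nonempty_iff_ne_empty.2 hne'
    have h1 : ∃ e' ∈ Bad e, ∃ u ∈ S, Adj e' u := by
      by_contra hcon
      push Not at hcon
      obtain ⟨c, hc, hmax⟩ := exists_max_image (Bad e) Prod.fst (hbadfin e he) hne'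
      have h : ∀ i : Fin 6, (dir i).1 = 1 → c + dir i = e := by
        intro i hi
        by_contra hce
        have := hmax _ (hclosed c hc _ (adj_dir c i) (fun hs => hcon c hc _ hs (adj_dir c i)) hce)
        simp [hi] at this
      have h0 := h 0 rfl
      have h1 := h 1 rfl
      rw [← h0] at h1
      simp [dir] at h1
    obtain ⟨e', he', u, hu, he'u⟩ := h1
    have he'C : e' ∈ Cand := ⟨hbadS' e he he', u, hu, he'u⟩
    have htrans : ∀ v, v ∉ S → v ≠ e → Reach (insert e S)ᶜ (top k) v →
        Reach (insert e' S)ᶜ (top k) v := by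
      intro v _ _ hr
      refine Reach.rec_on (P := fun v => Reach (insert e' S)ᶜ (top k) v)
        (fun b => Reach.of_mem) ?_ hr
      intro u w huw hw hwr ih
      refine ih.head huw ?_
      have hw' : w ≠ e ∧ w ∉ S := by simpa using hw
      have : w ≠ e' := fun h => he'.2.2 (h ▸ hwr)
      simp [this, hw'.2]
    have hereach : Reach (insert e' S)ᶜ (top k) e := by
      have h2 : ∃ u, Adj e u ∧ u ∉ S ∧ Reach (insert e S)ᶜ (top k) u := by
        by_contra hcon
        push Not at hcon
        have : ¬ (e ∈ Bad e ∨ e = e) := by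
          refine Reach.rec_on (P := fun v => ¬ (v ∈ Bad e ∨ v = e)) ?_ ?_
            (hS.reach_top e he.1.2)
          · rintro b hb (hb' | rfl)
            · exact hb'.2.2 (Reach.of_mem hb)
            · exact hb.1 heB
          · rintro u w huw hw _ ih (hu | rfl)
            · apply ih
              by_cases hwe : w = e
              · exact .inr hwe
              · exact .inl (hclosed u hu w huw hw hwe)
            · exact ih (.inl ⟨hw, huw.ne.symm, hcon w huw hw⟩)
        exact this (.inr rfl)
      obtain ⟨u, heu, huS, hur⟩ := h2
      have hur' := htrans u huS heu.ne.symm hur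
      refine hur'.head heu ?_
      have : u ≠ e' := fun h => he'.2.2 (h ▸ hur)
      simp [this, huS]
    have hsub : Bad e' ⊂ Bad e := by
      refine ⟨fun v hv => ?_, fun h => (h he').2.1 rfl⟩
      have hve : v ≠ e := fun h => hv.2.2 (h ▸ hereach)
      exact ⟨hv.1, hve, fun hr => hv.2.2 (htrans v hv.1 hve hr)⟩
    exact absurd (ncard_lt_ncard hsub (hbadfin e he)) (not_lt.2 (hmin e' he'C))
  refine ⟨hS.bot_subset.trans (subset_insert _ _), ?_, ?_, ?_⟩
  · rintro v hv (rfl | h)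
    · exact hv.1 heB
    · exact hS.top_disj v hv h
  · rintro v (rfl | h)
    · obtain ⟨u, hu, hvu⟩ := he.2
      exact ((hS.reach_bot u hu).mono (subset_insert _ _)).head hvu (.inr hu)
    · exact (hS.reach_bot v h).mono (subset_insert _ _)
  · intro v hv
    by_contra hr
    have hv' : v ≠ e ∧ v ∉ S := by simpa using hv
    have : v ∈ Bad e := ⟨hv'.2, hv'.1, hr⟩
    simp [hempty] at this

/-- Induction between two nested good sets, adding one point at a time. -/
lemma Good.induction {k : ℤ} {S₀ S' : Set (ℤ × ℤ)} (hS₀ : Good k S₀) (hS' : Good k S')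
    (hss : S₀ ⊆ S') {P : Set (ℤ × ℤ) → Prop} (h0 : P S₀)
    (hstep : ∀ S e, Good k S → Good k (insert e S) → e ∉ S → P S → P (insert e S)) : P S' := by
  have hfin : (S' \ S₀).Finite := (box k).finite_toSet.subset (hS₀.diff_subset_box hS')
  induction hn : (S' \ S₀).ncard using Nat.strong_induction_on generalizing S₀ with
  | _ n ih =>
    by_cases h : S₀ = S'
    · exact h ▸ h0
    · obtain ⟨e, he, hge⟩ := hS₀.exists_insert hS' (hss.ssubset_of_ne h)
      have hsub : S' \ insert e S₀ ⊂ S' \ S₀ :=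
        ⟨sdiff_subset_sdiff_right (subset_insert _ _), fun h => (h he).2 (mem_insert _ _)⟩
      exact ih _ (hn ▸ ncard_lt_ncard hsub hfin) hge (insert_subset he.1 hss)
        (hstep S₀ e hS₀ hge he.2 h0) (hfin.subset hsub.subset) rfl

/-- Sets which are unions of downward column segments are good. -/
lemma good_of_columns {k : ℤ} {S : Set (ℤ × ℤ)} (h1 : bot k ⊆ S) (h2 : ∀ v ∈ top k, v ∉ S)
    (h3 : ∀ v ∈ S, v ∈ box k → v + dir 5 ∈ S) (h4 : ∀ v ∉ S, v ∈ box k → v + dir 2 ∉ S) :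
    Good k S := by
  refine ⟨h1, h2, ?_, ?_⟩
  · have key : ∀ m : ℕ, ∀ v ∈ S, v.2 + k ≤ m → Reach S (bot k) v := by
      intro m
      induction m with
      | zero =>
        intro v hv hm
        rcases mem_box_or k v with h | h | h
        · rw [mem_box] at h
          norm_num at hm
          omega
        · exact .of_mem h
        · exact absurd hv (h2 v h)
      | succ m ih =>
        intro v hv hm
        rcases mem_box_or k v with h | h | h
        · refine Reach.head (adj_dir v 5) (h3 v hv h) (ih _ (h3 v hv h) ?_)
          simp only [dir, Prod.snd_add]
          push_cast at hm
          simp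
          omega
        · exact .of_mem h
        · exact absurd hv (h2 v h)
    intro v hv
    exact key (v.2 + k).toNat v hv (Int.self_le_toNat _)
  · have key : ∀ m : ℕ, ∀ v ∉ S, k + 1 - v.2 ≤ m → Reach Sᶜ (top k) v := by
      intro m
      induction m with
      | zero =>
        intro v hv hm
        rcases mem_box_or k v with h | h | h
        · rw [mem_box] at h
          norm_num at hm
          omega
        · exact absurd (h1 h) hv
        · exact .of_mem h
      | succ m ih =>
        intro v hv hm
        rcases mem_box_or k v with h | h | h
        · refine Reach.head (adj_dir v 2) (h4 v hv h) (ih _ (h4 v hv h) ?_)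
          simp only [dir, Prod.snd_add]
          push_cast at hm
          simp
          omega
        · exact absurd (h1 h) hv
        · exact .of_mem h
    intro v hv
    exact key (k + 1 - v.2).toNat v hv (Int.self_le_toNat _)

lemma dir_two : dir 2 = (0, 1) := rfl

lemma dir_five : dir 5 = (0, -1) := rfl

lemma good_bot (k : ℤ) : Good k (bot k) := by
  refine good_of_columns subset_rfl (fun v hv hv' => ?_) (fun v hv hv' => absurd hv' hv.1) ?_
  · exact absurd hv.2 (by have := hv'.2; omega)
  · intro v hv hv' hc
    have := hc.1
    have h2 := hc.2
    rw [mem_box] at *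
    simp [dir_two] at *
    omega

lemma good_full (k : ℤ) : Good k (bot k ∪ box k) := by
  refine good_of_columns subset_union_left ?_ ?_ ?_
  · rintro v hv (hv' | hv')
    · exact absurd hv.2 (by have := hv'.2; omega)
    · exact hv.1 hv'
  · intro v hv hv'
    rcases mem_box_or k (v + dir 5) with h | h | h
    · exact .inr h
    · exact .inl h
    · have h1 := h.1
      have h2 := h.2
      rw [mem_box] at *
      simp [dir_five] at *
      omega
  · intro v hv hv'
    exact absurd (Or.inr hv') hv

lemma good_half {k : ℤ} : Good k {v | v.2 ≤ 0} := by
  refine good_of_columns (fun v hv => hv.2) (fun v hv hv' => ?_) (fun v hv hv' => ?_)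
    (fun v hv hv' hc => ?_)
  · have := hv.2
    simp at hv'
    omega
  · simp [dir_five] at *
    omega
  · simp [dir_two] at *
    omega

open Classical in
/-- The `0/1` indicator of a set of lattice points. -/
noncomputable def ind (S : Set (ℤ × ℤ)) (v : ℤ × ℤ) : ℤ := if v ∈ S then 1 else 0

/-- The contribution of a lattice point to the Euler characteristic. -/
noncomputable def eulerTerm (S : Set (ℤ × ℤ)) (v : ℤ × ℤ) : ℤ :=
  ind S v - ind S v * ind S (v + dir 0) - ind S v * ind S (v + dir 1)
    - ind S v * ind S (v + dir 2) + ind S v * ind S (v + dir 0) * ind S (v + dir 1)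
    + ind S v * ind S (v + dir 2) * ind S (v + dir 1)

/-- Euler characteristic of a set of lattice points inside a window around the box. -/
noncomputable def euler (k : ℤ) (S : Set (ℤ × ℤ)) : ℤ :=
  ∑ v ∈ Finset.Icc 0 (2 * k + 1) ×ˢ Finset.Icc (-k) (k + 1), eulerTerm S v

lemma ind_insert_of_ne {S : Set (ℤ × ℤ)} {e v : ℤ × ℤ} (h : v ≠ e) :
    ind (insert e S) v = ind S v := by
  classical
  have : v ∈ insert e S ↔ v ∈ S := by simp [h]
  simp only [ind, this]

lemma ind_insert_self {S : Set (ℤ × ℤ)} {e : ℤ × ℤ} : ind (insert e S) e = 1 := by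
  simp [ind]

lemma ind_of_notMem {S : Set (ℤ × ℤ)} {e : ℤ × ℤ} (h : e ∉ S) : ind S e = 0 := by
  simp [ind, h]

lemma ind_of_mem {S : Set (ℤ × ℤ)} {e : ℤ × ℤ} (h : e ∈ S) : ind S e = 1 := by
  simp [ind, h]

lemma euler_insert {k : ℤ} {S : Set (ℤ × ℤ)} {e : ℤ × ℤ} (he : e ∈ box k) (heS : e ∉ S) :
    euler k (insert e S) - euler k S =
      1 - ∑ i, ind S (e + dir i) + ∑ i, ind S (e + dir i) * ind S (e + dir (i + 1)) := by
  classical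
  rw [euler, euler, ← Finset.sum_sub_distrib]
  have hsub : ({e, e + (-1, 0), e + (-1, -1), e + (0, -1)} : Finset (ℤ × ℤ)) ⊆
      Finset.Icc 0 (2 * k + 1) ×ˢ Finset.Icc (-k) (k + 1) := by
    intro v hv
    rw [mem_box] at he
    simp only [Finset.mem_insert, Finset.mem_singleton] at hv
    simp only [Finset.mem_product, Finset.mem_Icc]
    rcases hv with rfl | rfl | rfl | rfl <;> (try simp only [Prod.fst_add, Prod.snd_add]) <;> omega
  rw [← Finset.sum_subset hsub]
  · have hd : ∀ a b : ℤ × ℤ, a + b = (a.1 + b.1, a.2 + b.2) := fun _ _ => rfl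
    obtain ⟨x, y⟩ := e
    have h0 := ind_of_notMem heS
    have h1 := ind_insert_self (S := S) (e := (x, y))
    rw [Finset.sum_insert (by simp), Finset.sum_insert (by simp), Finset.sum_insert (by simp),
      Finset.sum_singleton]
    simp only [eulerTerm, Fin.sum_univ_six, dir, hd]
    have hne : ∀ a b : ℤ, (a, b) ≠ (x, y) → ind (insert (x, y) S) (a, b) = ind S (a, b) :=
      fun a b h => ind_insert_of_ne h
    have e1 := hne (x + 1) y (by simp)
    have e2 := hne (x + 1) (y + 1) (by simp)
    have e3 := hne x (y + 1) (by simp)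
    have e4 := hne (x + -1) y (by simp)
    have e5 := hne (x + -1) (y + -1) (by simp)
    have e6 := hne x (y + -1) (by simp)
    have e7 := hne (x + 1) (y + -1) (by simp)
    have e8 := hne (x + -1) (y + 1) (by simp)
    simp only [Fin.isValue, Matrix.cons_val, add_zero, Fin.reduceAdd, neg_add_cancel_right,
      h0, h1, e1, e2, e3, e4, e5, e6, e7, e8]
    ring
  · intro v _ hv
    have key : ∀ i : Fin 3, v + dir ⟨i, by omega⟩ ≠ e := by
      rintro i rfl
      apply hv
      fin_cases i <;> simp [dir, Prod.ext_iff]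
    have h0 : v ≠ e := by
      rintro rfl
      simp at hv
    have h1 := key 0
    have h2 := key 1
    have h3 := key 2
    simp only [eulerTerm]
    rw [ind_insert_of_ne h0, ind_insert_of_ne (v := v + dir 0) h1,
      ind_insert_of_ne (v := v + dir 1) h2, ind_insert_of_ne (v := v + dir 2) h3]
    ring

/-- Cyclic `0/1` patterns of length six: a nonconstant one has at least one descent, and with
exactly one descent it is an interval. -/
lemma pattern_descents (s : Fin 6 → Bool) :
    (1 - ∑ i, (s i).toInt + ∑ i, (s i).toInt * (s (i + 1)).toInt ≤ 0 ∨
      (∀ i, s i = false) ∨ ∀ i, s i = true) ∧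
    (1 - ∑ i, (s i).toInt + ∑ i, (s i).toInt * (s (i + 1)).toInt = 0 →
      ∃ i₀ : Fin 6, ∃ l : Fin 6, l ≠ 0 ∧ ∀ j, (s (i₀ + j) = true ↔ j < l)) := by
  revert s
  decide

lemma ind_eq_toInt (S : Set (ℤ × ℤ)) (v : ℤ × ℤ) [Decidable (v ∈ S)] :
    ind S v = (decide (v ∈ S)).toInt := by
  by_cases h : v ∈ S <;> simp [ind, h]

lemma Good.mem_box_of_insert {k : ℤ} {S : Set (ℤ × ℤ)} {e : ℤ × ℤ} (hS : Good k S)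
    (hS' : Good k (insert e S)) (he : e ∉ S) : e ∈ box k :=
  hS.diff_subset_box hS' ⟨mem_insert _ _, he⟩

lemma Good.euler_insert_le {k : ℤ} {S : Set (ℤ × ℤ)} {e : ℤ × ℤ} (hS : Good k S)
    (hS' : Good k (insert e S)) (he : e ∉ S) : euler k (insert e S) ≤ euler k S := by
  classical
  have hbox := hS.mem_box_of_insert hS' he
  have h := euler_insert hbox he
  simp only [ind_eq_toInt] at h
  rcases (pattern_descents fun i => decide (e + dir i ∈ S)).1 with h1 | h1 | h1
  · omega
  · exfalso
    have hr := hS'.reach_bot e (mem_insert _ _)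
    obtain ⟨b, hb, hr⟩ := hr
    rcases hr.cases_head with rfl | ⟨c, ⟨⟨i, rfl⟩, hc⟩, -⟩
    · exact hb.1 hbox
    · have := h1 i
      have hne := (adj_dir e i).ne
      simp_all
  · exfalso
    have hr := hS.reach_top e he
    obtain ⟨b, hb, hr⟩ := hr
    rcases hr.cases_head with rfl | ⟨c, ⟨⟨i, rfl⟩, hc⟩, -⟩
    · exact hb.1 hbox
    · have := h1 i
      simp_all

lemma Good.euler_anti {k : ℤ} {S S' : Set (ℤ × ℤ)} (hS : Good k S) (hS' : Good k S')
    (h : S ⊆ S') : euler k S' ≤ euler k S :=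
  hS.induction hS' h (P := fun T => euler k T ≤ euler k S) le_rfl
    fun _ _ h1 h2 he ih => (h1.euler_insert_le h2 he).trans ih

/-- `w` comes after `v` in the row-major order. -/
def RowLT (v w : ℤ × ℤ) : Prop := v.2 < w.2 ∨ v.2 = w.2 ∧ v.1 < w.1

lemma euler_rows {k : ℤ} (hk : 1 ≤ k) (n : ℕ) : ∀ Y : Finset (ℤ × ℤ), Y.card = n → Y ⊆ box k →
    (∀ w ∈ Y, ∀ v ∈ box k, RowLT v w → v ∈ Y) → euler k (bot k ∪ Y) = euler k (bot k) := by
  classical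
  induction n with
  | zero =>
    intro Y hY _ _
    rw [Finset.card_eq_zero.1 hY]
    simp
  | succ n ih =>
    intro Y hY hbox hlow
    have hne : Y.Nonempty := Finset.card_pos.1 (by omega)
    obtain ⟨e₀, he₀, hmax₀⟩ := Finset.exists_max_image Y Prod.snd hne
    obtain ⟨e, he, hmax⟩ := Finset.exists_max_image {v ∈ Y | v.2 = e₀.2} Prod.fst
      ⟨e₀, by simp [he₀]⟩
    simp only [Finset.mem_filter] at he hmax
    have hlast : ∀ v ∈ Y, ¬ RowLT e v := by
      rintro v hv (h | ⟨h, h'⟩)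
      · have := hmax₀ v hv
        omega
      · have := hmax v ⟨hv, by omega⟩
        omega
    have heB := hbox he.1
    have hYe : Y = insert e (Y.erase e) := (Finset.insert_erase he.1).symm
    have hih := ih (Y.erase e) (by rw [Finset.card_erase_of_mem he.1, hY]; rfl)
      ((Finset.erase_subset _ _).trans hbox) (by
        intro w hw v hv hvw
        rw [Finset.mem_erase] at hw ⊢
        refine ⟨?_, hlow w hw.2 v hv hvw⟩
        rintro rfl
        exact hlast w hw.2 hvw)
    have hset : bot k ∪ (Y : Set (ℤ × ℤ)) = insert e (bot k ∪ (Y.erase e : Finset (ℤ × ℤ))) := by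
      rw [← union_insert, ← Finset.coe_insert, ← hYe]
    set S := bot k ∪ ((Y.erase e : Finset (ℤ × ℤ)) : Set (ℤ × ℤ)) with hS
    have heS : e ∉ S := by
      rintro (h | h)
      · exact h.1 heB
      · simp at h
    have hmem : ∀ v, v ∈ S ↔ (v ∈ box k ∧ RowLT v e) ∨ (v ∉ box k ∧ v.2 ≤ 0) := by
      intro v
      constructor
      · rintro (h | h)
        · exact .inr h
        · simp only [Finset.coe_erase, Set.mem_sdiff, Finset.mem_coe, mem_singleton_iff] at h
          refine .inl ⟨hbox h.1, ?_⟩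
          have h1 := hlast v h.1
          have h2 : ¬ (v.1 = e.1 ∧ v.2 = e.2) := fun h3 => h.2 (Prod.ext h3.1 h3.2)
          unfold RowLT at h1 ⊢
          omega
      · rintro (h | h)
        · refine .inr ?_
          simp only [Finset.coe_erase, Set.mem_sdiff, Finset.mem_coe, mem_singleton_iff]
          refine ⟨hlow e he.1 v h.1 h.2, ?_⟩
          rintro rfl
          have := h.2
          unfold RowLT at this
          omega
        · exact .inl h
    have hE := euler_insert heB heS
    rw [hset, ← hih]
    suffices 1 - ∑ i, ind S (e + dir i) + ∑ i, ind S (e + dir i) * ind S (e + dir (i + 1)) = 0 by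
      omega
    rw [mem_box] at heB
    simp only [mem_box, RowLT] at hmem
    have h5 : e + dir 5 ∈ S := by
      rw [hmem]; simp [dir]; omega
    have h2 : e + dir 2 ∉ S := by
      rw [hmem]; simp [dir]; omega
    have h10 : e + dir 1 ∈ S → e + dir 0 ∈ S := by
      rw [hmem, hmem]; simp [dir]; omega
    have h34 : e + dir 3 ∈ S → e + dir 4 ∈ S := by
      rw [hmem, hmem]; simp [dir]; omega
    simp only [Fin.sum_univ_six, Fin.reduceAdd, Fin.isValue, zero_add]
    rw [ind_of_mem h5, ind_of_notMem h2]
    by_cases h1 : e + dir 1 ∈ S <;> by_cases h3 : e + dir 3 ∈ S <;>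
      simp [h1, h3, h10, h34, ind_of_mem, ind_of_notMem] <;> ring

/-- At a single step between good sets, the neighbours of the added point that belong to the
set form a cyclic interval. -/
lemma Good.contiguous {k : ℤ} (hk : 1 ≤ k) {S : Set (ℤ × ℤ)} {e : ℤ × ℤ} (hS : Good k S)
    (hS' : Good k (insert e S)) (he : e ∉ S) :
    ∃ i₀ : Fin 6, ∃ l : Fin 6, l ≠ 0 ∧ ∀ j, (e + dir (i₀ + j) ∈ S ↔ j < l) := by
  classical
  have hbox := hS.mem_box_of_insert hS' he
  have h := euler_insert hbox he
  simp only [ind_eq_toInt] at h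
  have h1 := (good_bot k).euler_anti hS hS.bot_subset
  have hsub : insert e S ⊆ bot k ∪ box k := by
    intro v hv
    rcases mem_box_or k v with h | h | h
    · exact .inr h
    · exact .inl h
    · exact absurd hv (hS'.top_disj v h)
  have h2 := hS'.euler_anti (good_full k) hsub
  have h3 := euler_rows hk _ (box k) rfl subset_rfl (fun _ _ v hv _ => hv)
  have h4 := hS.euler_insert_le hS' he
  have h5 := (pattern_descents fun i => decide (e + dir i ∈ S)).2 (by omega)
  simpa using h5

lemma dir_inj (i j : Fin 6) : dir i = dir j ↔ i = j := by
  revert i j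
  decide

lemma cyclic_fill (A : Fin 6 → Bool) (p : Fin 7)
    (h : ∀ i, A i = true → (A (i + 1) = true ∨ (i + 1 : Fin 6).val = p.val) ∧
      (A (i - 1) = true ∨ (i - 1 : Fin 6).val = p.val)) (h' : ∃ i, A i = true) (q : Fin 6) :
    A q = true ∨ q.val = p.val := by
  revert A p q
  decide

/-- An induced lattice path crossing the box from `(1, 1)` to `(2k, 0)`. -/
structure InducedPath (k : ℤ) (e : ℕ → ℤ × ℤ) (L : ℕ) : Prop where
  mem_box : ∀ i ≤ L, e i ∈ box k
  adj : ∀ i < L, Adj (e i) (e (i + 1))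
  induced : ∀ i j, i + 2 ≤ j → j ≤ L → ¬ Adj (e i) (e j) ∧ e i ≠ e j
  zero : e 0 = (1, 1)
  last : e L = (2 * k, 0)

/-- The vertex set of a path. -/
def pathSet (e : ℕ → ℤ × ℤ) (L : ℕ) : Set (ℤ × ℤ) := {v | ∃ i ≤ L, v = e i}

/-- The points below the path together with the first `j` points of the path. -/
def below (k : ℤ) (e : ℕ → ℤ × ℤ) (L j : ℕ) : Set (ℤ × ℤ) :=
  bot k ∪ {v | v ∈ box k ∧ v ∉ pathSet e L ∧ ¬ Reach (box k \ pathSet e L ∪ top k) (top k) v} ∪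
    {v | ∃ i < j, v = e i}

lemma below_succ (k : ℤ) (e : ℕ → ℤ × ℤ) (L j : ℕ) :
    below k e L (j + 1) = insert (e j) (below k e L j) := by
  ext v
  have : (∃ i < j + 1, v = e i) ↔ v = e j ∨ ∃ i < j, v = e i := by
    constructor
    · rintro ⟨i, hi, rfl⟩
      rcases Nat.lt_succ_iff_lt_or_eq.1 hi with h | rfl
      · exact .inr ⟨i, h, rfl⟩
      · exact .inl rfl
    · rintro (rfl | ⟨i, hi, rfl⟩)
      · exact ⟨j, by omega, rfl⟩
      · exact ⟨i, by omega, rfl⟩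
  simp only [below, mem_union, mem_ofPred_eq, mem_insert_iff, this]
  tauto

lemma InducedPath.injective {k : ℤ} {e : ℕ → ℤ × ℤ} {L : ℕ} (h : InducedPath k e L) {i j : ℕ}
    (hij : i < j) (hj : j ≤ L) : e i ≠ e j := by
  rcases Nat.lt_or_ge (i + 1) j with h' | h'
  · exact (h.induced i j h' hj).2
  · obtain rfl : j = i + 1 := by omega
    exact (h.adj i hj).ne

lemma InducedPath.notMem_below {k : ℤ} {e : ℕ → ℤ × ℤ} {L : ℕ} (h : InducedPath k e L) {j i : ℕ}
    (hj : j ≤ i) (hi : i ≤ L) : e i ∉ below k e L j := by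
  rintro ((h1 | h1) | ⟨m, hm, h1⟩)
  · exact h1.1 (h.mem_box i hi)
  · exact h1.2.1 ⟨i, hi, rfl⟩
  · exact h.injective (show m < i by omega) hi h1.symm

/-- Every point below the path is connected to the bottom. -/
lemma InducedPath.reach_bot {k : ℤ} {e : ℕ → ℤ × ℤ} {L : ℕ} (h : InducedPath k e L)
    {v : ℤ × ℤ} (hv : v ∈ below k e L 0) : Reach (below k e L 0) (bot k) v := by
  classical
  by_contra hv'
  set K : Set (ℤ × ℤ) := {v | v ∈ below k e L 0 ∧ ¬ Reach (below k e L 0) (bot k) v} with hK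
  have hKprop : ∀ u ∈ K, u ∈ box k ∧ u ∉ pathSet e L ∧
      ¬ Reach (box k \ pathSet e L ∪ top k) (top k) u := by
    rintro u ⟨(h1 | h1) | ⟨i, hi, _⟩, h2⟩
    · exact absurd (Reach.of_mem h1) h2
    · exact h1
    · omega
  have hnb : ∀ u ∈ K, ∀ w, Adj u w → w ∈ K ∨ w ∈ pathSet e L := by
    intro u hu w huw
    obtain ⟨h1, h2, h3⟩ := hKprop u hu
    by_cases hw : w ∈ pathSet e L
    · exact .inr hw
    left
    rcases mem_box_or k w with hb | hb | hb
    · have hwM : w ∈ below k e L 0 := by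
        refine .inl (.inr ⟨hb, hw, fun hr => h3 (hr.head huw (.inl ⟨hb, hw⟩))⟩)
      exact ⟨hwM, fun hr => hu.2 (hr.head huw hwM)⟩
    · exact absurd ((Reach.of_mem hb).head huw (.inl (.inl hb))) hu.2
    · exact absurd ((Reach.of_mem hb).head huw (.inr hb)) h3
  have hKfin : K.Finite := (box k).finite_toSet.subset fun u hu => (hKprop u hu).1
  have hex : ∃ b, b ≤ L ∧ ∃ u ∈ K, Adj u (e b) := by
    obtain ⟨c, hc, hmax⟩ := exists_max_image K Prod.fst hKfin ⟨v, hv, hv'⟩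
    rcases hnb c hc _ (adj_dir c 0) with h1 | ⟨b, hb, h1⟩
    · have := hmax _ h1
      simp [dir] at this
    · exact ⟨b, hb, c, hc, h1 ▸ adj_dir c 0⟩
  obtain ⟨b, hb, hmaxb⟩ : ∃ b, (b ≤ L ∧ ∃ u ∈ K, Adj u (e b)) ∧
      ∀ b', (b' ≤ L ∧ ∃ u ∈ K, Adj u (e b')) → b' ≤ b := by
    have hfin : {b | b ≤ L ∧ ∃ u ∈ K, Adj u (e b)}.Finite :=
      (Set.finite_Iic L).subset fun b hb => hb.1
    obtain ⟨b, hb, hm⟩ := exists_max_image _ id hfin hex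
    exact ⟨b, hb, hm⟩
  obtain ⟨hbL, u, hu, hub⟩ := hb
  obtain ⟨p, hp⟩ : ∃ p : Fin 7, ∀ i : Fin 6, (1 ≤ b ∧ e b + dir i = e (b - 1)) ↔ i.val = p.val := by
    rcases Nat.eq_zero_or_pos b with rfl | hpos
    · exact ⟨6, fun i => by simp; omega⟩
    · have := (h.adj (b - 1) (by omega)).symm
      rw [Nat.sub_add_cancel hpos] at this
      obtain ⟨j, hj⟩ := this
      refine ⟨j.castSucc, fun i => ?_⟩
      have hinj : dir i = dir j ↔ i = j := dir_inj i j
      simp only [hj, add_right_inj, hinj, Fin.val_castSucc, Fin.ext_iff]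
      omega
  have hprop : ∀ i j : Fin 6, Adj (e b + dir i) (e b + dir j) → e b + dir i ∈ K →
      e b + dir j ∈ K ∨ j.val = p.val := by
    intro i j hij hi
    rcases hnb _ hi _ hij with h1 | ⟨b', hb', h1⟩
    · exact .inl h1
    · right
      rw [← hp]
      have hle := hmaxb b' ⟨hb', _, hi, h1 ▸ hij⟩
      have hadj : Adj (e b) (e b') := h1 ▸ adj_dir _ _
      have hne : b' ≠ b := by
        rintro rfl
        exact hadj.ne rfl
      have : ¬ (b' + 2 ≤ b) := fun hlt => (h.induced b' b hlt hbL).1 hadj.symm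
      obtain rfl : b' = b - 1 := by omega
      exact ⟨by omega, h1⟩
  have hall : ∀ q : Fin 6, e b + dir q ∈ K ∨ q.val = p.val := by
    intro q
    have := cyclic_fill (fun i => decide (e b + dir i ∈ K)) p (by
      intro i hi
      have hi' : e b + dir i ∈ K := by simpa using hi
      have h1 := hprop i (i + 1) (adj_dir_succ _ _) hi'
      have h2 := hprop i (i - 1) (by
        have := (adj_dir_succ (e b) (i - 1)).symm
        rwa [sub_add_cancel] at this) hi'
      simpa using ⟨h1, h2⟩) (by
      obtain ⟨i, hi⟩ := hub.symm
      exact ⟨i, by simpa [← hi] using hu⟩) q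
    simpa using this
  rcases Nat.lt_or_ge b L with hlt | hge
  · obtain ⟨q, hq⟩ := h.adj b hlt
    rcases hall q with h1 | h1
    · rw [← hq] at h1
      exact (hKprop _ h1).2.1 ⟨b + 1, hlt, rfl⟩
    · rw [← hp] at h1
      have := h.injective (show b - 1 < b + 1 by omega) hlt
      rw [hq, h1.2] at this
      exact this rfl
  · obtain rfl : b = L := by omega
    have hnotbox : e b + dir 0 ∉ box k := by
      rw [h.last, Youngs.mem_box]
      simp [dir]
    rcases hall 0 with h1 | h1
    · exact hnotbox (hKprop _ h1).1
    · rw [← hp] at h1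
      rw [h1.2] at hnotbox
      exact hnotbox (h.mem_box _ (by omega))

lemma InducedPath.good_below {k : ℤ} {e : ℕ → ℤ × ℤ} {L : ℕ} (h : InducedPath k e L)
    {j : ℕ} (hj : j ≤ L + 1) : Good k (below k e L j) := by
  have hmono : ∀ {i}, below k e L 0 ⊆ below k e L i := by
    rintro i v (h1 | ⟨m, hm, _⟩)
    · exact .inl h1
    · omega
  refine ⟨fun v hv => .inl (.inl hv), ?_, ?_, ?_⟩
  · rintro v hv ((h1 | h1) | ⟨i, hi, rfl⟩)
    · have := hv.2
      have := h1.2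
      omega
    · exact hv.1 h1.1
    · exact hv.1 (h.mem_box i (by omega))
  · rintro v (h1 | ⟨i, hi, rfl⟩)
    · exact (h.reach_bot (.inl h1)).mono hmono
    · induction i with
      | zero =>
        have hb : e 0 + dir 4 ∈ bot k := by
          rw [h.zero]
          simp [bot, Youngs.mem_box, dir]
        exact (Reach.of_mem hb).head (adj_dir _ 4) (.inl (.inl hb))
      | succ i ih => exact (ih (by omega)).head (h.adj i (by omega)).symm (.inr ⟨i, by omega, rfl⟩)
  · have hpath : ∀ m i, i + m = L → j ≤ i → Reach (below k e L j)ᶜ (top k) (e i) := by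
      intro m
      induction m with
      | zero =>
        rintro i rfl hji
        have hb : e i + dir 1 ∈ top k := by
          have := h.last
          simp only [add_zero] at this
          rw [this]
          simp [top, Youngs.mem_box, dir]
        refine (Reach.of_mem hb).head (adj_dir _ 1) ?_
        rintro ((h1 | h1) | ⟨m, hm, h1⟩)
        · have := hb.2
          have := h1.2
          omega
        · exact hb.1 h1.1
        · exact hb.1 (h1 ▸ h.mem_box m (by omega))
      | succ m ih =>
        intro i hi hji
        exact (ih (i + 1) (by omega) (by omega)).head (h.adj i (by omega))
          (h.notMem_below (by omega) (by omega))
    intro v hv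
    rcases mem_box_or k v with hb | hb | hb
    · by_cases hp : v ∈ pathSet e L
      · obtain ⟨i, hi, rfl⟩ := hp
        refine hpath (L - i) i (by omega) ?_
        by_contra hlt
        exact hv (.inr ⟨i, by omega, rfl⟩)
      · have hr : Reach (box k \ pathSet e L ∪ top k) (top k) v := by
          by_contra hr
          exact hv (.inl (.inr ⟨hb, hp, hr⟩))
        refine hr.rec_on (fun _ => Reach.of_mem) ?_
        rintro u w huw hw hwr ih
        refine ih.head huw ?_
        rintro ((h1 | h1) | ⟨m, hm, h1⟩)
        · rcases hw with hw | hw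
          · exact h1.1 hw.1
          · have := hw.2
            have := h1.2
            omega
        · exact h1.2.2 hwr
        · rcases hw with hw | hw
          · exact hw.2 ⟨m, by omega, h1⟩
          · exact hw.1 (h1 ▸ h.mem_box m (by omega))
    · exact absurd (.inl (.inl hb)) hv
    · exact .of_mem hb

/-- The hexagonal norm adapted to the triangular lattice. -/
noncomputable def hexN (p : ℝ × ℝ) : ℝ := max |p.1| (max |p.2| |p.1 - p.2|)

/-- The piecewise linear bump function of a lattice point. -/
noncomputable def hat (p : ℝ × ℝ) : ℝ := max 0 (1 - hexN p)

lemma hexN_le_iff {p : ℝ × ℝ} {r : ℝ} : hexN p ≤ r ↔ |p.1| ≤ r ∧ |p.2| ≤ r ∧ |p.1 - p.2| ≤ r := by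
  simp [hexN]

lemma continuous_hexN : Continuous hexN := by
  unfold hexN
  fun_prop

lemma continuous_hat : Continuous hat := continuous_const.max (continuous_const.sub continuous_hexN)

lemma hexN_smul {t : ℝ} (ht : 0 ≤ t) (p : ℝ × ℝ) : hexN (t • p) = t * hexN p := by
  simp only [hexN, Prod.smul_fst, Prod.smul_snd, smul_eq_mul, ← mul_sub, abs_mul, abs_of_nonneg ht]
  rw [mul_max_of_nonneg _ _ ht, mul_max_of_nonneg _ _ ht]

lemma norm_le_hexN (p : ℝ × ℝ) : ‖p‖ ≤ hexN p := by
  rw [Prod.norm_def]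
  simp only [hexN, Real.norm_eq_abs]
  exact max_le (le_max_left _ _) ((le_max_left _ _).trans (le_max_right _ _))

lemma hexN_nonneg (p : ℝ × ℝ) : 0 ≤ hexN p := (norm_nonneg _).trans (norm_le_hexN p)

lemma hexN_add_le (p q : ℝ × ℝ) : hexN (p + q) ≤ hexN p + hexN q := by
  rw [hexN_le_iff]
  have hp := hexN_le_iff.1 (le_refl (hexN p))
  have hq := hexN_le_iff.1 (le_refl (hexN q))
  refine ⟨(abs_add_le _ _).trans (by linarith), (abs_add_le _ _).trans (by linarith), ?_⟩
  have : (p + q).1 - (p + q).2 = (p.1 - p.2) + (q.1 - q.2) := by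
    simp; ring
  rw [this]
  exact (abs_add_le _ _).trans (by linarith)

lemma hexN_le_two_norm (p : ℝ × ℝ) : hexN p ≤ 2 * ‖p‖ := by
  have h1 : |p.1| ≤ ‖p‖ := norm_fst_le p
  have h2 : |p.2| ≤ ‖p‖ := norm_snd_le p
  have := norm_nonneg p
  rw [hexN_le_iff]
  exact ⟨by linarith, by linarith, (abs_sub _ _).trans (by linarith)⟩

lemma hexN_neg (p : ℝ × ℝ) : hexN (-p) = hexN p := by
  have : (-p).1 - (-p).2 = -(p.1 - p.2) := by simp; ring
  simp only [hexN]
  rw [this, abs_neg]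
  simp

lemma abs_hexN_sub_le (p q : ℝ × ℝ) : |hexN p - hexN q| ≤ 2 * ‖p - q‖ := by
  rw [abs_sub_le_iff]
  have h1 := hexN_add_le (p - q) q
  have h2 := hexN_add_le (q - p) p
  have h3 := hexN_le_two_norm (p - q)
  have h4 := hexN_le_two_norm (q - p)
  rw [norm_sub_rev] at h4
  simp only [sub_add_cancel] at h1 h2
  constructor <;> linarith

lemma eq_zero_of_hexN {p : ℝ × ℝ} (h : hexN p = 0) : p = 0 := by
  have := norm_le_hexN p
  rw [h] at this
  exact norm_le_zero_iff.1 this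

/-- The identity plus a contraction is a homeomorphism of a Banach space. -/
lemma exists_homeomorph_add {E : Type*} [NormedAddCommGroup E] [NormedSpace ℝ E] [CompleteSpace E]
    {f : E → E} {K : NNReal} (hK : K < 1) (hf : LipschitzWith K f) :
    ∃ Φ : E ≃ₜ E, ∀ p, Φ p = p + f p := by
  have h : ApproximatesLinearOn (fun p => p + f p) (ContinuousLinearEquiv.refl ℝ E : E →L[ℝ] E)
      univ K := by
    intro x _ y _
    have := hf.norm_sub_le x y
    simpa [add_sub_add_comm] using this
  refine ⟨h.toHomeomorph _ ?_, fun p => rfl⟩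
  rcases subsingleton_or_nontrivial E with hE | hE
  · exact .inl hE
  · right
    have : ‖((ContinuousLinearEquiv.refl ℝ E).symm : E →L[ℝ] E)‖₊ = 1 := by
      have h1 : ‖((ContinuousLinearEquiv.refl ℝ E).symm : E →L[ℝ] E)‖ = 1 :=
        ContinuousLinearMap.norm_id
      exact NNReal.eq h1
    rw [this]
    simpa using hK

/-- Radial rescaling of the hexagon by the ray-dependent factor `W`. -/
noncomputable def radial (W : ℝ × ℝ → ℝ) (p : ℝ × ℝ) : ℝ × ℝ :=
  (1 + (W p - 1) * max 0 (1 - hexN p))⁻¹ • p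

/-- Ray-dependent factors admissible for `radial`. -/
structure RadialFactor (W : ℝ × ℝ → ℝ) : Prop where
  cont : ∀ p ≠ 0, ContinuousAt W p
  homog : ∀ t : ℝ, 0 < t → ∀ p, W (t • p) = W p
  bdd : ∃ m > 0, ∃ M, ∀ p, m ≤ W p ∧ W p ≤ M

namespace RadialFactor

variable {W : ℝ × ℝ → ℝ}

lemma inv (hW : RadialFactor W) : RadialFactor fun p => (W p)⁻¹ := by
  obtain ⟨m, hm, M, h⟩ := hW.bdd
  refine ⟨fun p hp => (hW.cont p hp).inv₀ (hm.trans_le (h p).1).ne', fun t ht p => by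
    rw [hW.homog t ht p],
    M⁻¹, inv_pos.2 (hm.trans_le ((h 0).1.trans (h 0).2)), m⁻¹, fun p => ⟨?_, ?_⟩⟩
  · exact inv_anti₀ (hm.trans_le (h p).1) (h p).2
  · exact inv_anti₀ hm (h p).1

lemma pos (hW : RadialFactor W) (p : ℝ × ℝ) : 0 < W p := by
  obtain ⟨m, hm, M, h⟩ := hW.bdd
  exact hm.trans_le (h p).1

lemma denom_ge {w a : ℝ} (ha : a ≤ 1) (h0 : 0 ≤ a) : min 1 w ≤ 1 + (w - 1) * a := by
  rcases le_total w 1 with h | h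
  · rw [min_eq_right h]; nlinarith
  · rw [min_eq_left h]; nlinarith

lemma hat_mem (p : ℝ × ℝ) : 0 ≤ max 0 (1 - hexN p) ∧ max 0 (1 - hexN p) ≤ 1 :=
  ⟨le_max_left _ _, max_le zero_le_one (by linarith [hexN_nonneg p])⟩

lemma denom_pos (hW : RadialFactor W) (p : ℝ × ℝ) :
    0 < 1 + (W p - 1) * max 0 (1 - hexN p) :=
  (lt_min one_pos (hW.pos p)).trans_le (denom_ge (hat_mem p).2 (hat_mem p).1)

lemma continuous (hW : RadialFactor W) : Continuous (radial W) := by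
  rw [continuous_iff_continuousAt]
  intro p
  by_cases hp : p = 0
  · subst hp
    obtain ⟨m, hm, M, h⟩ := hW.bdd
    have h0 : radial W 0 = 0 := by simp [radial]
    have hbound : ∀ p, ‖radial W p‖ ≤ (min 1 m)⁻¹ * ‖p‖ := by
      intro p
      rw [radial, norm_smul, Real.norm_eq_abs, abs_of_pos (inv_pos.2 (hW.denom_pos p))]
      refine mul_le_mul_of_nonneg_right ?_ (norm_nonneg _)
      refine inv_anti₀ (lt_min one_pos hm) ?_
      exact (min_le_min_left 1 (h p).1).trans (denom_ge (hat_mem p).2 (hat_mem p).1)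
    rw [ContinuousAt, h0]
    refine squeeze_zero_norm hbound ?_
    have : Continuous fun p : ℝ × ℝ => (min 1 m)⁻¹ * ‖p‖ := by fun_prop
    simpa using this.tendsto 0
  · have h1 : ContinuousAt (fun p => max 0 (1 - hexN p)) p := continuous_hat.continuousAt
    exact ((continuousAt_const.add (((hW.cont p hp).sub continuousAt_const).mul h1)).inv₀
      (hW.denom_pos p).ne').smul continuousAt_id

lemma radial_of_one_le {p : ℝ × ℝ} (hp : 1 ≤ hexN p) : radial W p = p := by
  simp [radial, max_eq_left (sub_nonpos.2 hp)]

lemma radial_of_le {p : ℝ × ℝ} (hp : hexN p ≤ 1) :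
    radial W p = (hexN p + W p * (1 - hexN p))⁻¹ • p := by
  rw [radial, max_eq_right (sub_nonneg.2 hp)]
  congr 2
  ring

lemma denom_pos_of_le (hW : RadialFactor W) {p : ℝ × ℝ} (hp : hexN p ≤ 1) :
    0 < hexN p + W p * (1 - hexN p) := by
  have := hW.denom_pos p
  rw [max_eq_right (sub_nonneg.2 hp)] at this
  linarith

lemma hexN_radial (hW : RadialFactor W) {p : ℝ × ℝ} (hp : hexN p ≤ 1) :
    hexN (radial W p) = (hexN p + W p * (1 - hexN p))⁻¹ * hexN p := by
  rw [radial_of_le hp, hexN_smul (inv_nonneg.2 (hW.denom_pos_of_le hp).le)]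

lemma one_sub_hexN_radial (hW : RadialFactor W) {p : ℝ × ℝ} (hp : hexN p ≤ 1) :
    1 - hexN (radial W p) = (hexN p + W p * (1 - hexN p))⁻¹ * (W p * (1 - hexN p)) := by
  rw [hW.hexN_radial hp]
  have := (hW.denom_pos_of_le hp).ne'
  field_simp
  ring

lemma hexN_radial_le (hW : RadialFactor W) {p : ℝ × ℝ} (hp : hexN p ≤ 1) :
    hexN (radial W p) ≤ 1 := by
  have h1 := hW.one_sub_hexN_radial hp
  have h2 := inv_pos.2 (hW.denom_pos_of_le hp)
  have h3 := hW.pos p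
  have : 0 ≤ (hexN p + W p * (1 - hexN p))⁻¹ * (W p * (1 - hexN p)) :=
    mul_nonneg h2.le (mul_nonneg h3.le (by linarith))
  linarith

lemma radial_inv_radial (hW : RadialFactor W) (p : ℝ × ℝ) :
    radial (fun q => (W q)⁻¹) (radial W p) = p := by
  rcases le_total (hexN p) 1 with hp | hp
  · rw [radial_of_le (hW.hexN_radial_le hp)]
    have hd := hW.denom_pos_of_le hp
    have hWr : W (radial W p) = W p := by
      rw [radial_of_le hp, hW.homog _ (inv_pos.2 hd)]
    rw [hWr, hW.one_sub_hexN_radial hp, hW.hexN_radial hp, radial_of_le hp, smul_smul]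
    have hw := (hW.pos p).ne'
    have : (hexN p + W p * (1 - hexN p))⁻¹ * hexN p +
        (W p)⁻¹ * ((hexN p + W p * (1 - hexN p))⁻¹ * (W p * (1 - hexN p)))
        = (hexN p + W p * (1 - hexN p))⁻¹ := by
      field_simp
      ring
    rw [this, inv_inv, mul_inv_cancel₀ hd.ne', one_smul]
  · rw [radial_of_one_le hp, radial_of_one_le hp]

/-- The radial rescaling as a homeomorphism. -/
noncomputable def homeo (hW : RadialFactor W) : (ℝ × ℝ) ≃ₜ (ℝ × ℝ) where
  toFun := radial W
  invFun := radial fun q => (W q)⁻¹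
  left_inv := hW.radial_inv_radial
  right_inv p := by
    have := hW.inv.radial_inv_radial p
    simpa using this
  continuous_toFun := hW.continuous
  continuous_invFun := hW.inv.continuous

end RadialFactor

/-- `f` is, on the hexagon, the truncation by `hexN` of a homogeneous function increasing with
unit speed in some direction. -/
def HexModel (f : ℝ × ℝ → ℝ) : Prop :=
  ∃ g : ℝ × ℝ → ℝ, ∃ v : ℝ × ℝ, Continuous g ∧ (∀ t ≥ 0, ∀ p, g (t • p) = t * g p) ∧
    (∀ p s, g (p + s • v) = g p + s) ∧ hexN v ≤ 1 ∧
    ∀ p, hexN p ≤ 1 → f p = max (-hexN p) (min (g p) (hexN p))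

lemma lipschitz_recenter {v : ℝ × ℝ} (hv : hexN v ≤ 1) {t : ℝ} (ht : |t| ≤ 1 / 4) :
    LipschitzWith (1 / 2) fun p : ℝ × ℝ => (t * max 0 (1 - hexN p)) • v := by
  refine LipschitzWith.of_dist_le_mul fun p q => ?_
  rw [dist_eq_norm, ← sub_smul, norm_smul, ← mul_sub, norm_mul, Real.norm_eq_abs, Real.norm_eq_abs,
    dist_eq_norm]
  have h1 : |max 0 (1 - hexN p) - max 0 (1 - hexN q)| ≤ 2 * ‖p - q‖ := by
    have := abs_max_sub_max_le_abs (1 - hexN p) (1 - hexN q) 0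
    rw [max_comm, max_comm 0]
    refine this.trans ?_
    have h2 := abs_hexN_sub_le q p
    rw [norm_sub_rev] at h2
    calc |1 - hexN p - (1 - hexN q)| = |hexN q - hexN p| := by congr 1; ring
      _ ≤ _ := h2
  have h2 := (norm_le_hexN v).trans hv
  have : |t| * |max 0 (1 - hexN p) - max 0 (1 - hexN q)| ≤ 1 / 4 * (2 * ‖p - q‖) :=
    mul_le_mul ht h1 (abs_nonneg _) (by norm_num)
  calc |t| * |max 0 (1 - hexN p) - max 0 (1 - hexN q)| * ‖v‖
      ≤ 1 / 4 * (2 * ‖p - q‖) * 1 := mul_le_mul this h2 (norm_nonneg _) (by positivity)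
    _ = _ := by push_cast; ring

/-- A homeomorphism supported in the unit hexagon that is straightening the zero set. -/
lemma exists_straighten {f g : ℝ × ℝ → ℝ} {v : ℝ × ℝ} (hg : Continuous g)
    (hgh : ∀ t ≥ 0, ∀ p, g (t • p) = t * g p) (hgv : ∀ p s, g (p + s • v) = g p + s)
    (hv : hexN v ≤ 1) (hf : ∀ p, hexN p ≤ 1 → f p = max (-hexN p) (min (g p) (hexN p)))
    {s : ℝ} (hs : |s| = 1) :
    ∃ A : (ℝ × ℝ) ≃ₜ (ℝ × ℝ), (∀ p, 1 ≤ hexN p → A p = p) ∧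
      ∀ p, hexN p ≤ 1 → (f p + s * (1 - hexN p) = 0 ↔ g (A p) = 0) := by
  obtain ⟨C, hC⟩ : ∃ C, ∀ p, |g p| / hexN p ≤ C := by
    obtain ⟨C, hC⟩ := (isCompact_closedBall (0 : ℝ × ℝ) 1).exists_bound_of_continuousOn
      hg.continuousOn
    refine ⟨max C 0, fun p => ?_⟩
    by_cases hp : hexN p = 0
    · simp [hp]
    have hpos : 0 < hexN p := (hexN_nonneg p).lt_of_ne' hp
    have h1 : g ((hexN p)⁻¹ • p) = (hexN p)⁻¹ * g p := hgh _ (inv_nonneg.2 hpos.le) p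
    have h2 := hC ((hexN p)⁻¹ • p) (by
      rw [mem_closedBall_zero_iff]
      refine (norm_le_hexN _).trans ?_
      rw [hexN_smul (inv_nonneg.2 hpos.le), inv_mul_cancel₀ hp])
    rw [h1, Real.norm_eq_abs, abs_mul, abs_of_pos (inv_pos.2 hpos)] at h2
    rw [div_eq_inv_mul]
    exact h2.trans (le_max_left _ _)
  set W : ℝ × ℝ → ℝ := fun p => 4 * max 1 (|g p| / hexN p) with hWdef
  have hW : RadialFactor W := by
    refine ⟨fun p hp => ?_, fun t ht p => ?_, 4, by norm_num, 4 * max 1 C, fun p => ⟨?_, ?_⟩⟩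
    · have hp' : hexN p ≠ 0 := fun h => hp (eq_zero_of_hexN h)
      exact continuousAt_const.mul (continuousAt_const.max
        (hg.abs.continuousAt.div continuous_hexN.continuousAt hp'))
    · simp only [hWdef]
      rw [hgh t ht.le, hexN_smul ht.le, abs_mul, abs_of_pos ht, mul_div_mul_left _ _ ht.ne']
    · have := le_max_left 1 (|g p| / hexN p)
      simp only [hWdef]
      linarith
    · exact mul_le_mul_of_nonneg_left (max_le_max le_rfl (hC p)) (by norm_num)
  have ht : |s / 4| ≤ 1 / 4 := by rw [abs_div, hs]; norm_num
  obtain ⟨R, hR⟩ := exists_homeomorph_add (by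
    rw [← NNReal.coe_lt_coe]; norm_num) (lipschitz_recenter hv ht)
  refine ⟨hW.homeo.trans R, fun p hp => ?_, fun p hp => ?_⟩
  · have h1 : hW.homeo p = p := RadialFactor.radial_of_one_le hp
    rw [Homeomorph.trans_apply, h1, hR, max_eq_left (sub_nonpos.2 hp)]
    simp
  · have h1 : hW.homeo p = radial W p := rfl
    rw [Homeomorph.trans_apply, h1, hR, hgv, max_eq_right (sub_nonneg.2 (hW.hexN_radial_le hp)),
      hW.one_sub_hexN_radial hp]
    have hd := hW.denom_pos_of_le hp
    have h2 : g (radial W p) = (hexN p + W p * (1 - hexN p))⁻¹ * g p := by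
      rw [RadialFactor.radial_of_le hp, hgh _ (inv_nonneg.2 hd.le)]
    have h3 : g (radial W p) + s / 4 * ((hexN p + W p * (1 - hexN p))⁻¹ * (W p * (1 - hexN p)))
        = (hexN p + W p * (1 - hexN p))⁻¹ * (g p + s * (max 1 (|g p| / hexN p) * (1 - hexN p))) := by
      rw [h2]
      simp only [hWdef]
      ring
    rw [h3, mul_eq_zero, or_iff_right (inv_ne_zero hd.ne'), hf p hp]
    by_cases hp0 : hexN p = 0
    · have hg0 : g p = 0 := by
        have := hgh 0 le_rfl p
        rw [eq_zero_of_hexN hp0] at this ⊢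
        simpa using this
      simp [hp0, hg0]
    have hpos : 0 < hexN p := (hexN_nonneg p).lt_of_ne' hp0
    rcases le_total |g p| (hexN p) with h | h
    · rw [max_eq_left ((div_le_one hpos).2 h)]
      have := abs_le.1 h
      rw [min_eq_left this.2, max_eq_right this.1, one_mul]
    · rw [max_eq_right ((one_le_div hpos).2 h)]
      have hg0 : |g p| / hexN p ≠ 0 := (div_pos (hpos.trans_le h) hpos).ne'
      rcases le_total 0 (g p) with h0 | h0
      · rw [abs_of_nonneg h0] at h hg0 ⊢
        rw [min_eq_right h, max_eq_right (by linarith)]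
        have : g p + s * (g p / hexN p * (1 - hexN p)) =
          (g p / hexN p) * (hexN p + s * (1 - hexN p)) := by field_simp
        rw [this, mul_eq_zero, or_iff_right hg0]
      · rw [abs_of_nonpos h0] at h hg0 ⊢
        rw [min_eq_left (by linarith), max_eq_left (by linarith)]
        have : g p + s * (-g p / hexN p * (1 - hexN p)) =
          (-g p / hexN p) * (-hexN p + s * (1 - hexN p)) := by field_simp; ring
        rw [this, mul_eq_zero, or_iff_right hg0]

lemma isPreconnected_zero_hex {g : ℝ × ℝ → ℝ} (hgh : ∀ t ≥ 0, ∀ p, g (t • p) = t * g p) :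
    IsPreconnected {p | g p = 0 ∧ hexN p ≤ 1} := by
  have h0 : g 0 = 0 := by simpa using hgh 0 le_rfl 0
  refine isPreconnected_of_forall 0 fun p hp => ⟨segment ℝ 0 p, ?_, left_mem_segment _ _ _,
    right_mem_segment _ _ _, (convex_segment _ _).isPreconnected⟩
  intro q hq
  rw [segment_eq_image] at hq
  obtain ⟨t, ht, rfl⟩ := hq
  simp only [smul_zero, zero_add, mem_ofPred_eq]
  rw [hgh t ht.1, hexN_smul ht.1, hp.1]
  have := hp.2
  exact ⟨by simp, (mul_le_mul ht.2 this (hexN_nonneg p) zero_le_one).trans (by norm_num)⟩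

/-- Flipping the sign at the centre of a hexagon moves the zero set by a homeomorphism supported
in the hexagon. -/
lemma HexModel.exists_move {f : ℝ × ℝ → ℝ} (hf : HexModel f) :
    (∃ φ : (ℝ × ℝ) ≃ₜ (ℝ × ℝ), (∀ p, 1 ≤ hexN p → φ p = p) ∧
      ∀ p, hexN p ≤ 1 → (f (φ p) + (1 - hexN (φ p)) = 0 ↔ f p - (1 - hexN p) = 0)) ∧
    IsPreconnected {p | f p - (1 - hexN p) = 0 ∧ hexN p ≤ 1} := by
  obtain ⟨g, v, hg, hgh, hgv, hv, hfg⟩ := hf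
  obtain ⟨A, hA1, hA2⟩ := exists_straighten hg hgh hgv hv hfg (s := 1) (by norm_num)
  obtain ⟨B, hB1, hB2⟩ := exists_straighten hg hgh hgv hv hfg (s := -1) (by norm_num)
  have hin : ∀ (C : (ℝ × ℝ) ≃ₜ (ℝ × ℝ)), (∀ p, 1 ≤ hexN p → C p = p) →
      ∀ p, hexN p ≤ 1 → hexN (C p) ≤ 1 := by
    intro C hC p hp
    by_contra h
    push Not at h
    have h1 : C p = p := C.injective (hC _ h.le)
    rw [h1] at h
    linarith
  have hsymm : ∀ (C : (ℝ × ℝ) ≃ₜ (ℝ × ℝ)), (∀ p, 1 ≤ hexN p → C p = p) →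
      ∀ p, 1 ≤ hexN p → C.symm p = p := fun C hC p hp =>
    C.symm_apply_eq.2 (hC p hp).symm
  constructor
  · refine ⟨B.trans A.symm, fun p hp => ?_, fun p hp => ?_⟩
    · rw [Homeomorph.trans_apply, hB1 p hp, hsymm A hA1 p hp]
    · have h1 := hA2 (A.symm (B p)) (hin _ (hsymm A hA1) _ (hin _ hB1 p hp))
      rw [A.apply_symm_apply, one_mul] at h1
      rw [Homeomorph.trans_apply, h1, ← hB2 p hp]
      ring_nf
  · have : {p | f p - (1 - hexN p) = 0 ∧ hexN p ≤ 1} =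
        B.symm '' {p | g p = 0 ∧ hexN p ≤ 1} := by
      ext p
      rw [B.image_symm]
      simp only [mem_ofPred_eq, mem_preimage]
      constructor
      · rintro ⟨h1, h2⟩
        exact ⟨(hB2 p h2).1 (by rw [← h1]; ring), hin B hB1 p h2⟩
      · rintro ⟨h1, h2⟩
        have h3 : hexN p ≤ 1 := by
          have := hin _ (hsymm B hB1) _ h2
          rwa [B.symm_apply_apply] at this
        exact ⟨by rw [← (hB2 p h3).2 h1]; ring, h3⟩
    rw [this]
    exact (isPreconnected_zero_hex hgh).image _ B.symm.continuous.continuousOn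

/-- A lattice point as a point of the plane. -/
def toR (v : ℤ × ℤ) : ℝ × ℝ := (v.1, v.2)

lemma toR_add (u v : ℤ × ℤ) : toR (u + v) = toR u + toR v := by
  simp [toR]

/-- The combination of the bumps of the six neighbours of the origin with coefficients `c`. -/
noncomputable def ringSum (c : Fin 6 → ℝ) (p : ℝ × ℝ) : ℝ := ∑ i, c i * hat (p - toR (dir i))

lemma hat_eq_of_hexN {p : ℝ × ℝ} {x y : ℝ} (h : hexN p = max (1 - x) (1 - y)) :
    hat p = max 0 (min x y) := by
  rw [hat, h]
  congr 1
  rcases le_total x y with h | h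
  · rw [min_eq_left h, max_eq_left (by linarith)]; ring
  · rw [min_eq_right h, max_eq_right (by linarith)]; ring

/-- The bump of the first neighbour, seen from the unit hexagon. -/
lemma hat_sub_dir_zero {p : ℝ × ℝ} (hp : hexN p ≤ 1) :
    hat (p - toR (dir 0)) = max 0 (min (p.1 - p.2) p.1) := by
  obtain ⟨a, b⟩ := p
  rw [hexN_le_iff] at hp
  simp only [abs_le] at hp
  apply hat_eq_of_hexN
  simp only [toR, dir, Fin.isValue, Matrix.cons_val_zero, Int.cast_one, Int.cast_zero,
    Prod.mk_sub_mk, sub_zero]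
  apply le_antisymm
  · rw [hexN_le_iff]
    simp only [abs_le, le_max_iff, neg_le]
    grind
  · have h := hexN_le_iff.1 (le_refl (hexN (a - 1, b)))
    simp only [abs_le] at h
    exact max_le (by linarith) (by linarith)

/-- Rotation of the lattice by one sixth of a turn. -/
noncomputable def rot : (ℝ × ℝ) ≃L[ℝ] (ℝ × ℝ) :=
  LinearEquiv.toContinuousLinearEquiv
    { toFun := fun p => (p.1 - p.2, p.1)
      invFun := fun p => (p.2, p.2 - p.1)
      left_inv := fun p => by ext <;> simp
      right_inv := fun p => by ext <;> simp
      map_add' := fun p q => by ext <;> simp; ring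
      map_smul' := fun t p => by ext <;> simp; ring }

lemma rot_apply (p : ℝ × ℝ) : rot p = (p.1 - p.2, p.1) := rfl

lemma rot_symm_apply (p : ℝ × ℝ) : rot.symm p = (p.2, p.2 - p.1) := rfl

lemma hexN_rot (p : ℝ × ℝ) : hexN (rot p) = hexN p := by
  simp only [hexN, rot_apply]
  have : p.1 - p.2 - p.1 = -p.2 := by ring
  rw [this, abs_neg, max_comm, max_assoc, max_comm |p.2|]

lemma rot_dir (i : Fin 6) : rot (toR (dir i)) = toR (dir (i + 1)) := by
  fin_cases i <;> simp [rot_apply, toR, dir]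

lemma hat_rot (p : ℝ × ℝ) : hat (rot p) = hat p := by
  rw [hat, hexN_rot, hat]

lemma hat_sub_dir_succ (p : ℝ × ℝ) (i : Fin 6) :
    hat (p - toR (dir (i + 1))) = hat (rot.symm p - toR (dir i)) := by
  rw [← rot_dir, ← hat_rot (rot.symm p - _), map_sub, rot.apply_symm_apply]

lemma hexN_rot_symm (p : ℝ × ℝ) : hexN (rot.symm p) = hexN p := by
  rw [← hexN_rot, rot.apply_symm_apply]

lemma ringSum_rot (c : Fin 6 → ℝ) (p : ℝ × ℝ) :
    ringSum (fun i => c (i - 1)) p = ringSum c (rot.symm p) := by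
  simp only [ringSum]
  rw [← Equiv.sum_comp (Equiv.addRight (1 : Fin 6))]
  simp [hat_sub_dir_succ]

lemma HexModel.rotate {c : Fin 6 → ℝ} (h : HexModel (ringSum c)) :
    HexModel (ringSum fun i => c (i - 1)) := by
  obtain ⟨g, v, hg, hgh, hgv, hv, hfg⟩ := h
  refine ⟨fun p => g (rot.symm p), rot v, hg.comp rot.symm.continuous, fun t ht p => ?_,
    fun p s => ?_, ?_, fun p hp => ?_⟩
  · beta_reduce
    rw [map_smul, hgh t ht]
  · beta_reduce
    rw [map_add, map_smul, rot.symm_apply_apply, hgv]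
  · rwa [hexN_rot]
  · rw [ringSum_rot, hfg _ (by rwa [hexN_rot_symm]), hexN_rot_symm]

lemma HexModel.rotate_fin {c : Fin 6 → ℝ} (h : HexModel (ringSum c)) (m : Fin 6) :
    HexModel (ringSum fun i => c (i - m)) := by
  induction m using Fin.induction with
  | zero => simpa using h
  | succ m ih =>
    have := ih.rotate
    convert this using 4 with i
    rw [← Fin.coeSucc_eq_succ]
    abel

lemma HexModel.neg {c : Fin 6 → ℝ} (h : HexModel (ringSum c)) :
    HexModel (ringSum fun i => -c i) := by
  obtain ⟨g, v, hg, hgh, hgv, hv, hfg⟩ := h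
  refine ⟨fun p => -g p, -v, hg.neg, fun t ht p => ?_, fun p s => ?_, ?_, fun p hp => ?_⟩
  · beta_reduce
    rw [hgh t ht]; ring
  · have := hgv p (-s)
    beta_reduce
    rw [smul_neg, ← neg_smul, this]; ring
  · rwa [hexN_neg]
  · have h1 : ringSum (fun i => -c i) p = -ringSum c p := by simp [ringSum]
    rw [h1, hfg p hp]
    have := hexN_nonneg p
    rcases le_total (g p) (hexN p) with h2 | h2
    · rw [min_eq_left h2]
      rcases le_total (-hexN p) (g p) with h3 | h3
      · rw [max_eq_right h3, min_eq_left (by linarith), max_eq_right (by linarith)]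
      · rw [max_eq_left h3, min_eq_right (by linarith), max_eq_right (by linarith)]; ring
    · rw [min_eq_right h2, max_eq_right (by linarith), min_eq_left (by linarith),
        max_eq_left (by linarith)]

/-- The values of the six bumps on the unit hexagon. -/
lemma ringSum_eq (c : Fin 6 → ℝ) {p : ℝ × ℝ} (hp : hexN p ≤ 1) :
    ringSum c p = c 0 * max 0 (min (p.1 - p.2) p.1) + c 1 * max 0 (min p.1 p.2)
      + c 2 * max 0 (min p.2 (p.2 - p.1)) + c 3 * max 0 (min (p.2 - p.1) (-p.1))
      + c 4 * max 0 (min (-p.1) (-p.2)) + c 5 * max 0 (min (-p.2) (p.1 - p.2)) := by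
  have key : ∀ q : ℝ × ℝ, hexN q ≤ 1 → ∀ m : ℕ, hexN (rot.symm^[m] q) ≤ 1 := by
    intro q hq m
    induction m with
    | zero => simpa
    | succ m ih => rw [Function.iterate_succ_apply', hexN_rot_symm]; exact ih
  have h1 : hat (p - toR (dir 1)) = _ :=
    (hat_sub_dir_succ p 0).trans (hat_sub_dir_zero (key p hp 1))
  have h2 : hat (p - toR (dir 2)) = _ := (hat_sub_dir_succ p 1).trans
    ((hat_sub_dir_succ _ 0).trans (hat_sub_dir_zero (key p hp 2)))
  have h3 : hat (p - toR (dir 3)) = _ := (hat_sub_dir_succ p 2).trans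
    ((hat_sub_dir_succ _ 1).trans ((hat_sub_dir_succ _ 0).trans (hat_sub_dir_zero (key p hp 3))))
  have h4 : hat (p - toR (dir 4)) = _ := (hat_sub_dir_succ p 3).trans
    ((hat_sub_dir_succ _ 2).trans ((hat_sub_dir_succ _ 1).trans ((hat_sub_dir_succ _ 0).trans
      (hat_sub_dir_zero (key p hp 4)))))
  have h5 : hat (p - toR (dir 5)) = _ := (hat_sub_dir_succ p 4).trans
    ((hat_sub_dir_succ _ 3).trans ((hat_sub_dir_succ _ 2).trans ((hat_sub_dir_succ _ 1).trans
      ((hat_sub_dir_succ _ 0).trans (hat_sub_dir_zero (key p hp 5))))))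
  rw [ringSum, Fin.sum_univ_six, hat_sub_dir_zero hp, h1, h2, h3, h4, h5]
  simp only [rot_symm_apply]
  ring_nf

/-- The basic coefficient pattern with `l` leading plus signs. -/
noncomputable def pat (l : Fin 6) (i : Fin 6) : ℝ := if i < l then 1 else -1

lemma hexModel_pat_one : HexModel (ringSum (pat 1)) := by
  refine ⟨fun p => min (p.1 + p.2) (p.1 - 2 * p.2), (1, 0), by fun_prop, fun t ht p => ?_,
    fun p s => ?_, by simp [hexN], fun p hp => ?_⟩
  · simp only [Prod.smul_fst, Prod.smul_snd, smul_eq_mul]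
    rw [mul_min_of_nonneg _ _ ht]
    ring_nf
  · simp only [Prod.fst_add, Prod.snd_add, Prod.smul_fst, Prod.smul_snd, smul_eq_mul]
    rw [← min_add_add_right]
    ring_nf
  · rw [ringSum_eq _ hp]
    obtain ⟨a, b⟩ := p
    clear hp
    simp only [pat, hexN, Fin.reduceLT, if_true, if_false]
    rcases le_total 0 a with h1 | h1 <;> rcases le_total 0 b with h2 | h2 <;>
      rcases le_total a b with h3 | h3 <;>
      simp (disch := grind) only [abs_of_nonneg, abs_of_nonpos, max_eq_left, max_eq_right,
        min_eq_left, min_eq_right] <;> linarith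

lemma hexModel_pat_two : HexModel (ringSum (pat 2)) := by
  refine ⟨fun p => min (p.1 + p.2) (2 * p.1 - p.2), (2 / 3, 1 / 3), by fun_prop, fun t ht p => ?_,
    fun p s => ?_, ?_, fun p hp => ?_⟩
  · simp only [Prod.smul_fst, Prod.smul_snd, smul_eq_mul]
    rw [mul_min_of_nonneg _ _ ht]
    ring_nf
  · simp only [Prod.fst_add, Prod.snd_add, Prod.smul_fst, Prod.smul_snd, smul_eq_mul]
    rw [← min_add_add_right]
    ring_nf
  · rw [hexN_le_iff]
    norm_num [abs_le]
  · rw [ringSum_eq _ hp]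
    obtain ⟨a, b⟩ := p
    clear hp
    simp only [pat, hexN, Fin.reduceLT, if_true, if_false]
    rcases le_total 0 a with h1 | h1 <;> rcases le_total 0 b with h2 | h2 <;>
      rcases le_total a b with h3 | h3 <;>
      simp (disch := grind) only [abs_of_nonneg, abs_of_nonpos, max_eq_left, max_eq_right,
        min_eq_left, min_eq_right] <;> linarith

lemma hexModel_pat_three : HexModel (ringSum (pat 3)) := by
  refine ⟨fun p => p.1 + p.2, (1 / 2, 1 / 2), by fun_prop, fun t ht p => ?_,
    fun p s => ?_, ?_, fun p hp => ?_⟩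
  · simp only [Prod.smul_fst, Prod.smul_snd, smul_eq_mul]
    ring_nf
  · simp only [Prod.fst_add, Prod.snd_add, Prod.smul_fst, Prod.smul_snd, smul_eq_mul]
    ring_nf
  · rw [hexN_le_iff]
    norm_num [abs_le]
  · rw [ringSum_eq _ hp]
    obtain ⟨a, b⟩ := p
    clear hp
    simp only [pat, hexN, Fin.reduceLT, if_true, if_false]
    rcases le_total 0 a with h1 | h1 <;> rcases le_total 0 b with h2 | h2 <;>
      rcases le_total a b with h3 | h3 <;>
      simp (disch := grind) only [abs_of_nonneg, abs_of_nonpos, max_eq_left, max_eq_right,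
        min_eq_left, min_eq_right] <;> linarith

lemma hexModel_pat {l : Fin 6} (hl : l ≠ 0) : HexModel (ringSum (pat l)) := by
  fin_cases l
  · exact absurd rfl hl
  · exact hexModel_pat_one
  · exact hexModel_pat_two
  · exact hexModel_pat_three
  · have := (hexModel_pat_two.rotate_fin 4).neg
    convert this using 3 with i
    have h : i < 4 ↔ ¬ (i - 4 < 2) := by revert i; decide
    change (if i < 4 then (1 : ℝ) else -1) = -(if i - 4 < 2 then (1 : ℝ) else -1)
    by_cases h' : i - 4 < 2 <;> simp only [h, h'] <;> simp
  · have := (hexModel_pat_one.rotate_fin 5).neg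
    convert this using 3 with i
    have h : i < 5 ↔ ¬ (i - 5 < 1) := by revert i; decide
    change (if i < 5 then (1 : ℝ) else -1) = -(if i - 5 < 1 then (1 : ℝ) else -1)
    by_cases h' : i - 5 < 1 <;> simp only [h, h'] <;> simp

open Classical in
/-- The sign of a lattice point relative to a set. -/
noncomputable def sgn (S : Set (ℤ × ℤ)) (v : ℤ × ℤ) : ℝ := if v ∈ S then 1 else -1

/-- The lattice points of the closed rectangle around `box k`. -/
noncomputable def window (k : ℤ) : Finset (ℤ × ℤ) :=
  Finset.Icc 0 (2 * k + 1) ×ˢ Finset.Icc (-k) (k + 1)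

/-- The piecewise linear function on the rectangle interpolating the signs. -/
noncomputable def field (k : ℤ) (S : Set (ℤ × ℤ)) (p : ℝ × ℝ) : ℝ :=
  ∑ v ∈ window k, sgn S v * hat (p - toR v)

/-- The closed lattice rectangle. -/
def rect (k : ℤ) : Set (ℝ × ℝ) := Icc 0 (2 * k + 1 : ℝ) ×ˢ Icc (-k : ℝ) (k + 1)

/-- The open lattice rectangle. -/
def rectInt (k : ℤ) : Set (ℝ × ℝ) := Ioo 0 (2 * k + 1 : ℝ) ×ˢ Ioo (-k : ℝ) (k + 1)

lemma mem_window {k : ℤ} {v : ℤ × ℤ} :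
    v ∈ window k ↔ (0 ≤ v.1 ∧ v.1 ≤ 2 * k + 1) ∧ -k ≤ v.2 ∧ v.2 ≤ k + 1 := by
  simp [window]

lemma box_subset_window {k : ℤ} {v : ℤ × ℤ} (h : v ∈ box k) : v ∈ window k := by
  rw [mem_box] at h
  rw [mem_window]
  omega

lemma dir_bound (i : Fin 6) : (-1 ≤ (dir i).1 ∧ (dir i).1 ≤ 1) ∧ -1 ≤ (dir i).2 ∧ (dir i).2 ≤ 1 := by
  fin_cases i <;> simp [dir]

lemma add_dir_mem_window {k : ℤ} {v : ℤ × ℤ} (h : v ∈ box k) (i : Fin 6) :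
    v + dir i ∈ window k := by
  rw [mem_box] at h
  have := dir_bound i
  rw [mem_window]
  simp only [Prod.fst_add, Prod.snd_add]
  omega

lemma toR_sub (u v : ℤ × ℤ) : toR (u - v) = toR u - toR v := by
  simp [toR]

/-- A nonzero lattice point that is not a neighbour of the origin has norm at least two. -/
lemma two_le_hexN_toR {u : ℤ × ℤ} (h0 : u ≠ 0) (h : ∀ i, u ≠ dir i) : 2 ≤ hexN (toR u) := by
  by_contra hlt
  push Not at hlt
  have key : |u.1| ≤ 1 ∧ |u.2| ≤ 1 ∧ |u.1 - u.2| ≤ 1 := by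
    simp only [hexN, toR, max_lt_iff] at hlt
    obtain ⟨h1, h2, h3⟩ := hlt
    have a1 : |u.1| < 2 := by exact_mod_cast h1
    have a2 : |u.2| < 2 := by exact_mod_cast h2
    have a3 : |u.1 - u.2| < 2 := by exact_mod_cast h3
    omega
  obtain ⟨a, b⟩ := u
  simp only [abs_le] at key
  have ha : a = -1 ∨ a = 0 ∨ a = 1 := by omega
  have hb : b = -1 ∨ b = 0 ∨ b = 1 := by omega
  rcases ha with rfl | rfl | rfl <;> rcases hb with rfl | rfl | rfl
  · exact h 4 rfl
  · exact h 3 rfl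
  · omega
  · exact h 5 rfl
  · exact h0 rfl
  · exact h 2 rfl
  · omega
  · exact h 0 rfl
  · exact h 1 rfl

lemma hat_eq_zero {p : ℝ × ℝ} (h : 1 ≤ hexN p) : hat p = 0 := by
  rw [hat, max_eq_left (by linarith)]

lemma hat_eq {p : ℝ × ℝ} (h : hexN p ≤ 1) : hat p = 1 - hexN p := by
  rw [hat, max_eq_right (by linarith)]

lemma field_insert {k : ℤ} {S : Set (ℤ × ℤ)} {e : ℤ × ℤ} (he : e ∈ window k) (heS : e ∉ S)
    (p : ℝ × ℝ) : field k (insert e S) p = field k S p + 2 * hat (p - toR e) := by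
  rw [field, field, ← Finset.add_sum_erase _ _ he, ← Finset.add_sum_erase _ _ he]
  have : ∑ v ∈ (window k).erase e, sgn (insert e S) v * hat (p - toR v)
      = ∑ v ∈ (window k).erase e, sgn S v * hat (p - toR v) := by
    refine Finset.sum_congr rfl fun v hv => ?_
    have : v ≠ e := (Finset.mem_erase.1 hv).1
    have h' : v ∈ insert e S ↔ v ∈ S := by rw [mem_insert_iff, or_iff_right this]
    by_cases hvS : v ∈ S
    · rw [sgn, sgn, if_pos hvS, if_pos (h'.2 hvS)]
    · rw [sgn, sgn, if_neg hvS, if_neg (mt h'.1 hvS)]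
  rw [this]
  simp only [sgn, mem_insert_iff, true_or, if_true, heS, if_false]
  ring

lemma field_eq_ringSum {k : ℤ} {S : Set (ℤ × ℤ)} {e : ℤ × ℤ} (he : e ∈ box k)
    {p : ℝ × ℝ} (hp : hexN (p - toR e) ≤ 1) :
    field k S p = sgn S e * (1 - hexN (p - toR e))
      + ringSum (fun i => sgn S (e + dir i)) (p - toR e) := by
  have hsub : insert e (Finset.univ.image fun i => e + dir i) ⊆ window k := by
    intro v hv
    simp only [Finset.mem_insert, Finset.mem_image, Finset.mem_univ, true_and] at hv
    rcases hv with rfl | ⟨i, rfl⟩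
    · exact box_subset_window he
    · exact add_dir_mem_window he i
  rw [field, ← Finset.sum_subset hsub]
  · rw [Finset.sum_insert, Finset.sum_image, hat_eq hp, ringSum]
    · simp only [toR_add, sub_sub]
    · intro i _ j _ hij
      exact (dir_inj i j).1 (by simpa using hij)
    · simp only [Finset.mem_image, Finset.mem_univ, true_and, not_exists]
      intro i hi
      exact dir_ne_zero i (by simpa using hi)
  · intro v _ hv
    simp only [Finset.mem_insert, Finset.mem_image, Finset.mem_univ, true_and, not_or,
      not_exists] at hv
    have h2 : 2 ≤ hexN (toR (v - e)) := by
      refine two_le_hexN_toR (sub_ne_zero.2 hv.1) fun i hi => hv.2 i ?_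
      rw [← hi]; abel
    rw [hat_eq_zero, mul_zero]
    have h3 := hexN_add_le (p - toR e) (-(p - toR v))
    rw [hexN_neg] at h3
    have h4 : p - toR e + -(p - toR v) = toR (v - e) := by rw [toR_sub]; abel
    rw [h4] at h3
    linarith

lemma hexModel_step {k : ℤ} (hk : 1 ≤ k) {S : Set (ℤ × ℤ)} {e : ℤ × ℤ} (hS : Good k S)
    (hS' : Good k (insert e S)) (he : e ∉ S) :
    HexModel (ringSum fun i => sgn S (e + dir i)) := by
  obtain ⟨i₀, l, hl, h⟩ := hS.contiguous hk hS' he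
  convert (hexModel_pat hl).rotate_fin i₀ using 3 with i
  have := h (i - i₀)
  rw [add_sub_cancel] at this
  simp only [sgn, pat, this]

/-- Adding a lattice point to a good set moves the zero set by a homeomorphism supported in the
hexagon of that point. -/
lemma exists_hex_move {k : ℤ} (hk : 1 ≤ k) {S : Set (ℤ × ℤ)} {e : ℤ × ℤ} (hS : Good k S)
    (hS' : Good k (insert e S)) (he : e ∉ S) :
    (∃ φ : (ℝ × ℝ) ≃ₜ (ℝ × ℝ), (∀ p, 1 ≤ hexN (p - toR e) → φ p = p) ∧
      ∀ p, field k (insert e S) (φ p) = 0 ↔ field k S p = 0) ∧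
    IsPreconnected {p | field k S p = 0 ∧ hexN (p - toR e) ≤ 1} := by
  have hbox := hS.mem_box_of_insert hS' he
  obtain ⟨⟨φ, hφ1, hφ2⟩, hconn⟩ := (hexModel_step hk hS hS' he).exists_move
  have hf : ∀ p, hexN p ≤ 1 → field k S (p + toR e)
      = ringSum (fun i => sgn S (e + dir i)) p - (1 - hexN p) := by
    intro p hp
    rw [field_eq_ringSum hbox (by simpa using hp)]
    simp only [sgn, he, if_false, add_sub_cancel_right]
    ring
  have hin : ∀ p, hexN p ≤ 1 → hexN (φ p) ≤ 1 := by
    intro p hp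
    by_contra h
    push Not at h
    have h1 : φ p = p := φ.injective (hφ1 _ h.le)
    rw [h1] at h
    linarith
  refine ⟨⟨((Homeomorph.addRight (-toR e)).trans φ).trans (Homeomorph.addRight (toR e)),
    fun p hp => ?_, fun p => ?_⟩, ?_⟩
  · simp only [Homeomorph.trans_apply, Homeomorph.coe_addRight]
    rw [hφ1 _ (by rwa [← sub_eq_add_neg])]
    abel
  · simp only [Homeomorph.trans_apply, Homeomorph.coe_addRight]
    rw [field_insert (box_subset_window hbox) he]
    obtain ⟨q, rfl⟩ : ∃ q, p = q + toR e := ⟨p - toR e, by abel⟩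
    rw [add_neg_cancel_right, add_sub_cancel_right]
    rcases le_total (hexN q) 1 with hq | hq
    · rw [hf _ hq, hf _ (hin q hq), hat_eq (hin q hq), ← hφ2 q hq]
      ring_nf
    · rw [hφ1 q hq, hat_eq_zero hq]
      simp
  · have : {p | field k S p = 0 ∧ hexN (p - toR e) ≤ 1} = (fun p => p + toR e) ''
        {p | ringSum (fun i => sgn S (e + dir i)) p - (1 - hexN p) = 0 ∧ hexN p ≤ 1} := by
      ext p
      simp only [mem_ofPred_eq, mem_image]
      constructor
      · rintro ⟨h1, h2⟩
        refine ⟨p - toR e, ⟨?_, h2⟩, by abel⟩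
        rw [← hf _ h2, sub_add_cancel, h1]
      · rintro ⟨q, ⟨h1, h2⟩, rfl⟩
        exact ⟨by rw [hf _ h2, h1], by simpa using h2⟩
    rw [this]
    exact hconn.image _ (by fun_prop)

lemma mem_rectInt_of_hexN_lt {k : ℤ} {e : ℤ × ℤ} (he : e ∈ box k) {p : ℝ × ℝ}
    (hp : hexN (p - toR e) < 1) : p ∈ rectInt k := by
  simp only [hexN, max_lt_iff, toR, Prod.fst_sub, Prod.snd_sub, abs_lt] at hp
  rw [mem_box] at he
  obtain ⟨⟨h1, h2⟩, h3, h4⟩ := he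
  have h1' : (1 : ℝ) ≤ e.1 := by exact_mod_cast h1
  have h2' : (e.1 : ℝ) ≤ 2 * k := by exact_mod_cast h2
  have h3' : (1 - k : ℝ) ≤ e.2 := by exact_mod_cast h3
  have h4' : (e.2 : ℝ) ≤ k := by exact_mod_cast h4
  simp only [rectInt, mem_prod, mem_Ioo]
  refine ⟨⟨?_, ?_⟩, ?_, ?_⟩ <;> linarith

lemma mem_rect_of_hexN_le {k : ℤ} {e : ℤ × ℤ} (he : e ∈ box k) {p : ℝ × ℝ}
    (hp : hexN (p - toR e) ≤ 1) : p ∈ rect k := by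
  simp only [hexN_le_iff, toR, Prod.fst_sub, Prod.snd_sub, abs_le] at hp
  rw [mem_box] at he
  obtain ⟨⟨h1, h2⟩, h3, h4⟩ := he
  have h1' : (1 : ℝ) ≤ e.1 := by exact_mod_cast h1
  have h2' : (e.1 : ℝ) ≤ 2 * k := by exact_mod_cast h2
  have h3' : (1 - k : ℝ) ≤ e.2 := by exact_mod_cast h3
  have h4' : (e.2 : ℝ) ≤ k := by exact_mod_cast h4
  simp only [rect, mem_prod, mem_Icc]
  refine ⟨⟨?_, ?_⟩, ?_, ?_⟩ <;> linarith

lemma rectInt_subset_rect (k : ℤ) : rectInt k ⊆ rect k :=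
  prod_mono Ioo_subset_Icc_self Ioo_subset_Icc_self

/-- A homeomorphism supported in `T` preserves every superset of `T`. -/
lemma homeo_mem_iff {X : Type*} [TopologicalSpace X] {φ : X ≃ₜ X} {T U : Set X}
    (hφ : ∀ p, p ∉ T → φ p = p) (hTU : T ⊆ U) (p : X) : φ p ∈ U ↔ p ∈ U := by
  by_cases hp : p ∈ T
  · by_cases hq : φ p ∈ T
    · exact ⟨fun _ => hTU hp, fun _ => hTU hq⟩
    · have : φ p = p := φ.injective (hφ _ hq)
      rw [this]
  · rw [hφ p hp]

lemma homeo_symm_support {X : Type*} [TopologicalSpace X] {φ : X ≃ₜ X} {T : Set X}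
    (hφ : ∀ p, p ∉ T → φ p = p) (p : X) (hp : p ∉ T) : φ.symm p = p := by
  rw [Homeomorph.symm_apply_eq, hφ p hp]

/-- `ψ` straightens the zero set of the field of `S`. -/
def Realizes (k : ℤ) (S : Set (ℤ × ℤ)) (ψ : (ℝ × ℝ) ≃ₜ (ℝ × ℝ)) : Prop :=
  (∀ p, p ∉ rectInt k → ψ p = p) ∧ ∀ p ∈ rect k, field k S (ψ p) = 0 ↔ p.2 = 1 / 2

lemma Realizes.trans {k : ℤ} {S S' : Set (ℤ × ℤ)} {ψ φ : (ℝ × ℝ) ≃ₜ (ℝ × ℝ)}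
    (h : Realizes k S ψ) (hφ : ∀ p, p ∉ rectInt k → φ p = p)
    (hz : ∀ p, field k S' (φ p) = 0 ↔ field k S p = 0) : Realizes k S' (ψ.trans φ) :=
  ⟨fun p hp => by rw [Homeomorph.trans_apply, h.1 p hp, hφ p hp],
    fun p hp => by rw [Homeomorph.trans_apply, hz, h.2 p hp]⟩

/-- In the rectangle the field only depends on the corners of the lattice cell. -/
lemma field_cell {k : ℤ} (S : Set (ℤ × ℤ)) {i j : ℤ} {α β : ℝ} (hi : 0 ≤ i ∧ i ≤ 2 * k)
    (hj : -k ≤ j ∧ j ≤ k) (hα : 0 ≤ α ∧ α ≤ 1) (hβ : 0 ≤ β ∧ β ≤ 1) :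
    field k S (i + α, j + β) = sgn S (i, j) * hat (α, β) + sgn S (i + 1, j) * hat (α - 1, β)
      + sgn S (i, j + 1) * hat (α, β - 1) + sgn S (i + 1, j + 1) * hat (α - 1, β - 1) := by
  have hsub : ({i, i + 1} ×ˢ {j, j + 1} : Finset (ℤ × ℤ)) ⊆ window k := by
    rintro ⟨a, b⟩ hv
    simp only [Finset.mem_product, Finset.mem_insert, Finset.mem_singleton] at hv
    rw [mem_window]
    simp only
    omega
  rw [field, ← Finset.sum_subset hsub]
  · rw [Finset.sum_product, Finset.sum_pair (by omega), Finset.sum_pair (by omega),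
      Finset.sum_pair (by omega)]
    simp only [toR, Prod.mk_sub_mk, add_sub_cancel_left, Int.cast_add, Int.cast_one,
      add_sub_add_left_eq_sub]
    ring
  · rintro ⟨a, b⟩ _ hv
    rw [hat_eq_zero, mul_zero]
    simp only [Finset.mem_product, Finset.mem_insert, Finset.mem_singleton] at hv
    have hcase : a ≤ i - 1 ∨ i + 2 ≤ a ∨ b ≤ j - 1 ∨ j + 2 ≤ b := by omega
    simp only [hexN, toR, Prod.mk_sub_mk, le_max_iff, le_abs]
    rcases hcase with h | h | h | h
    · have : (a : ℝ) ≤ i - 1 := by exact_mod_cast h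
      exact .inl (.inl (by linarith))
    · have : (i : ℝ) + 2 ≤ a := by exact_mod_cast h
      exact .inl (.inr (by linarith))
    · have : (b : ℝ) ≤ j - 1 := by exact_mod_cast h
      exact .inr (.inl (.inl (by linarith)))
    · have : (j : ℝ) + 2 ≤ b := by exact_mod_cast h
      exact .inr (.inl (.inr (by linarith)))

lemma hat_cell {α β : ℝ} (hα : 0 ≤ α ∧ α ≤ 1) (hβ : 0 ≤ β ∧ β ≤ 1) :
    hat (α, β) = 1 - max α β ∧ hat (α - 1, β) = max 0 (α - β) ∧
    hat (α, β - 1) = max 0 (β - α) ∧ hat (α - 1, β - 1) = min α β := by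
  simp only [hat, hexN]
  rcases le_total α β with h | h
  · refine ⟨?_, ?_, ?_, ?_⟩ <;>
    simp (disch := grind) only [abs_of_nonneg, abs_of_nonpos, max_eq_left, max_eq_right,
        min_eq_left, min_eq_right] <;> linarith
  · refine ⟨?_, ?_, ?_, ?_⟩ <;>
    simp (disch := grind) only [abs_of_nonneg, abs_of_nonpos, max_eq_left, max_eq_right,
        min_eq_left, min_eq_right] <;> linarith

/-- Writing a real number of an integral interval as integer plus remainder. -/
lemma exists_int_add {x : ℝ} {a b : ℤ} (hab : a < b) (ha : a ≤ x) (hb : x ≤ b) :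
    ∃ i : ℤ, ∃ α : ℝ, (a ≤ i ∧ i < b) ∧ (0 ≤ α ∧ α ≤ 1) ∧ x = i + α := by
  rcases hb.lt_or_eq with h | h
  · exact ⟨⌊x⌋, Int.fract x, ⟨Int.le_floor.2 ha, Int.floor_lt.2 h⟩,
      ⟨Int.fract_nonneg x, (Int.fract_lt_one x).le⟩, (Int.floor_add_fract x).symm⟩
  · exact ⟨b - 1, 1, ⟨by omega, by omega⟩, ⟨by norm_num, le_refl _⟩, by rw [h]; push_cast; ring⟩

lemma field_half {k : ℤ} (hk : 1 ≤ k) {p : ℝ × ℝ} (hp : p ∈ rect k) :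
    field k {v | v.2 ≤ 0} p = 0 ↔ p.2 = 1 / 2 := by
  obtain ⟨x, y⟩ := p
  simp only [rect, mem_prod, mem_Icc] at hp
  obtain ⟨i, α, hi, hα, rfl⟩ := exists_int_add (x := x) (a := 0) (b := 2 * k + 1) (by omega)
    (by exact_mod_cast hp.1.1) (by exact_mod_cast hp.1.2)
  obtain ⟨j, β, hj, hβ, rfl⟩ := exists_int_add (x := y) (a := -k) (b := k + 1) (by omega)
    (by exact_mod_cast hp.2.1) (by exact_mod_cast hp.2.2)
  rw [field_cell _ (by omega) (by omega) hα hβ]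
  obtain ⟨h1, h2, h3, h4⟩ := hat_cell hα hβ
  rw [h1, h2, h3, h4]
  simp only [sgn, mem_ofPred_eq]
  have e1 : max α β + min α β = α + β := max_add_min α β
  have e2 : 1 - max α β + max 0 (α - β) = 1 - β := by
    rcases le_total α β with h | h
    · rw [max_eq_right h, max_eq_left (by linarith)]; ring
    · rw [max_eq_left h, max_eq_right (by linarith)]; ring
  have e3 : max 0 (β - α) + min α β = β := by
    rcases le_total α β with h | h
    · rw [min_eq_left h, max_eq_right (by linarith)]; ring
    · rw [min_eq_right h, max_eq_left (by linarith)]; ring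
  rcases lt_trichotomy j 0 with h | h | h
  · rw [if_pos (by omega), if_pos (by omega)]
    have : (j : ℝ) ≤ -1 := by exact_mod_cast (by omega : j ≤ -1)
    constructor <;> intro h' <;> linarith
  · subst h
    norm_num
    constructor <;> intro h' <;> linarith
  · rw [if_neg (by omega), if_neg (by omega)]
    have : (1 : ℝ) ≤ j := by exact_mod_cast h
    constructor <;> intro h' <;> linarith

lemma realizes_half {k : ℤ} (hk : 1 ≤ k) : Realizes k {v | v.2 ≤ 0} (Homeomorph.refl _) :=
  ⟨fun _ _ => rfl, fun _ hp => field_half hk hp⟩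

lemma Good.exists_realizes {k : ℤ} (hk : 1 ≤ k) {S : Set (ℤ × ℤ)} (hS : Good k S) :
    ∃ ψ, Realizes k S ψ := by
  have hb : ∃ ψ, Realizes k (bot k) ψ := by
    refine (good_bot k).induction (P := fun S => (∃ ψ, Realizes k S ψ) → ∃ ψ, Realizes k (bot k) ψ)
      good_half (good_half.bot_subset) id ?_ ⟨_, realizes_half hk⟩
    rintro S e hS hS' he ih ⟨ψ, hψ⟩
    obtain ⟨φ, hφ1, hφ2⟩ := (exists_hex_move hk hS hS' he).1
    have hφ : ∀ p, p ∉ rectInt k → φ p = p := fun p hp => hφ1 p (not_lt.1 fun h =>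
      hp (mem_rectInt_of_hexN_lt (hS.mem_box_of_insert hS' he) h))
    exact ih ⟨_, hψ.trans (homeo_symm_support hφ) fun p => by
      rw [← hφ2, φ.apply_symm_apply]⟩
  refine (good_bot k).induction (P := fun S => ∃ ψ, Realizes k S ψ) hS hS.bot_subset hb ?_
  rintro S e hS hS' he ⟨ψ, hψ⟩
  obtain ⟨φ, hφ1, hφ2⟩ := (exists_hex_move hk hS hS' he).1
  have hφ : ∀ p, p ∉ rectInt k → φ p = p := fun p hp => hφ1 p (not_lt.1 fun h =>
    hp (mem_rectInt_of_hexN_lt (hS.mem_box_of_insert hS' he) h))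
  exact ⟨_, hψ.trans hφ hφ2⟩

/-- Partial labelling of the crosscut `ψ (x, 1/2)` by the vertices of the path `e`. -/
structure Labelled (k : ℤ) (e : ℕ → ℤ × ℤ) (ψ : (ℝ × ℝ) ≃ₜ (ℝ × ℝ)) (j : ℕ) (v : ℝ)
    (lam : ℝ → ℕ) : Prop where
  v_mem : v ∈ Icc 0 (2 * k + 1 : ℝ)
  mono : MonotoneOn lam (Icc 0 v)
  le : ∀ x ∈ Icc 0 v, lam x ≤ j
  near : ∀ x ∈ Icc 0 v, hexN (ψ (x, 1 / 2) - toR (e (lam x))) ≤ 1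

lemma line_mem_rect {k : ℤ} (hk : 1 ≤ k) {x : ℝ} (hx : x ∈ Icc 0 (2 * k + 1 : ℝ)) :
    (x, (1 / 2 : ℝ)) ∈ rect k := by
  have : (1 : ℝ) ≤ k := by exact_mod_cast hk
  simp only [rect, mem_prod, mem_Icc] at hx ⊢
  refine ⟨hx, ?_, ?_⟩ <;> linarith

lemma Labelled.step {k : ℤ} (hk : 1 ≤ k) {S : Set (ℤ × ℤ)} {e : ℕ → ℤ × ℤ} {j : ℕ}
    (hS : Good k S) (hS' : Good k (insert (e j) S)) (he : e j ∉ S)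
    {ψ : (ℝ × ℝ) ≃ₜ (ℝ × ℝ)} (hψ : Realizes k S ψ)
    {v : ℝ} {lam : ℝ → ℕ} (hl : Labelled k e ψ j v lam) {x₀ : ℝ} (hx₀ : x₀ ∈ Icc 0 v)
    (hx₀' : hexN (ψ (x₀, 1 / 2) - toR (e j)) ≤ 1) :
    ∃ ψ' v' lam', Realizes k (insert (e j) S) ψ' ∧ Labelled k e ψ' j v' lam' ∧
      ∀ x ∈ Icc 0 (2 * k + 1 : ℝ), hexN (ψ' (x, 1 / 2) - toR (e j)) ≤ 1 → x ≤ v' := by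
  classical
  have hbox := hS.mem_box_of_insert hS' he
  obtain ⟨⟨φ, hφ1, hφ2⟩, hconn⟩ := exists_hex_move hk hS hS' he
  have hφ : ∀ p, p ∉ rectInt k → φ p = p := fun p hp => hφ1 p (not_lt.1 fun h =>
    hp (mem_rectInt_of_hexN_lt hbox h))
  have hφH : ∀ p, hexN (φ p - toR (e j)) ≤ 1 ↔ hexN (p - toR (e j)) ≤ 1 :=
    homeo_mem_iff (U := {p | hexN (p - toR (e j)) ≤ 1}) (T := {p | hexN (p - toR (e j)) < 1})
      (fun p hp => hφ1 p (not_lt.1 hp)) (fun p hp => by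
        rw [mem_ofPred_eq] at hp ⊢
        exact hp.le)
  set J : Set ℝ := {x | x ∈ Icc 0 (2 * k + 1 : ℝ) ∧ hexN (ψ (x, 1 / 2) - toR (e j)) ≤ 1} with hJ
  have hJc : IsCompact J := by
    refine isCompact_Icc.inter_right (t := {x | hexN (ψ (x, 1 / 2) - toR (e j)) ≤ 1}) ?_
    exact isClosed_le (continuous_hexN.comp (by fun_prop)) continuous_const
  have hx₀J : x₀ ∈ J := ⟨⟨hx₀.1, hx₀.2.trans hl.v_mem.2⟩, hx₀'⟩
  have hJeq : J = Prod.fst '' (ψ.symm '' {p | field k S p = 0 ∧ hexN (p - toR (e j)) ≤ 1}) := by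
    ext x
    constructor
    · rintro ⟨h1, h2⟩
      refine ⟨(x, 1 / 2), ⟨ψ (x, 1 / 2), ⟨?_, h2⟩, by simp⟩, rfl⟩
      rw [hψ.2 _ (line_mem_rect hk h1)]
    · rintro ⟨p, ⟨q, ⟨h1, h2⟩, rfl⟩, rfl⟩
      have hq := mem_rect_of_hexN_le hbox h2
      have hr : ψ.symm q ∈ rect k :=
        (homeo_mem_iff (homeo_symm_support hψ.1) (rectInt_subset_rect k) q).2 hq
      have h3 := (hψ.2 _ hr).1 (by rwa [ψ.apply_symm_apply])
      refine ⟨hr.1, ?_⟩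
      have : ((ψ.symm q).1, (1 / 2 : ℝ)) = ψ.symm q := Prod.ext rfl h3.symm
      rwa [this, ψ.apply_symm_apply]
  have hJo : J.OrdConnected := by
    rw [hJeq]
    exact ((hconn.image _ ψ.symm.continuous.continuousOn).image _
      continuous_fst.continuousOn).ordConnected
  have hv'J : sSup J ∈ J := hJc.sSup_mem ⟨x₀, hx₀J⟩
  have hlt : ∀ x, x ≤ sSup J → x ∉ J → ∀ y ∈ J, x < y := by
    intro x hx hxJ y hy
    by_contra h
    exact hxJ (hJo.out hy hv'J ⟨not_lt.1 h, hx⟩)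
  have hold : ∀ x ∈ Icc 0 (sSup J), x ∉ J → x ∈ Icc 0 v := fun x hx hxJ =>
    ⟨hx.1, ((hlt x hx.2 hxJ _ hx₀J).le).trans hx₀.2⟩
  refine ⟨ψ.trans φ, sSup J, fun x => if x ∈ J then j else lam x, hψ.trans hφ hφ2,
    ⟨hv'J.1, ?_, ?_, ?_⟩, ?_⟩
  · intro x hx y hy hxy
    beta_reduce
    by_cases h1 : x ∈ J <;> by_cases h2 : y ∈ J
    · rw [if_pos h1, if_pos h2]
    · exact absurd (hlt y hy.2 h2 x h1) (not_lt.2 hxy)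
    · rw [if_neg h1, if_pos h2]
      exact hl.le x (hold x hx h1)
    · rw [if_neg h1, if_neg h2]
      exact hl.mono (hold x hx h1) (hold y hy h2) hxy
  · intro x hx
    split_ifs with h1
    · exact le_rfl
    · exact hl.le x (hold x hx h1)
  · intro x hx
    rw [Homeomorph.trans_apply]
    split_ifs with h1
    · exact (hφH _).2 h1.2
    · rw [hφ1]
      · exact hl.near x (hold x hx h1)
      · by_contra h
        exact h1 ⟨⟨hx.1, hx.2.trans hv'J.1.2⟩, (not_le.1 h).le⟩
  · intro x hx hx'
    rw [Homeomorph.trans_apply, hφH] at hx'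
    exact le_csSup hJc.bddAbove ⟨hx, hx'⟩

lemma ringSum_half_dir (c : Fin 6 → ℝ) (i : Fin 6) :
    hexN ((1 / 2 : ℝ) • toR (dir i)) = 1 / 2 ∧ ringSum c ((1 / 2 : ℝ) • toR (dir i)) = c i / 2 := by
  have h : hexN ((1 / 2 : ℝ) • toR (dir i)) = 1 / 2 := by
    rw [hexN_smul (by norm_num)]
    fin_cases i <;> norm_num [hexN, toR, dir]
  refine ⟨h, ?_⟩
  rw [ringSum_eq _ (by rw [h]; norm_num)]
  fin_cases i <;> norm_num [toR, dir] <;> ring_nf <;> rfl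

lemma field_midpoint {k : ℤ} {S : Set (ℤ × ℤ)} {u : ℤ × ℤ} (hu : u ∈ box k) {i : Fin 6}
    (h1 : u ∈ S) (h2 : u + dir i ∉ S) :
    field k S (toR u + (1 / 2 : ℝ) • toR (dir i)) = 0 := by
  obtain ⟨h3, h4⟩ := ringSum_half_dir (fun i => sgn S (u + dir i)) i
  rw [field_eq_ringSum hu] <;> rw [add_sub_cancel_left, h3]
  · rw [h4]
    simp only [sgn, h1, h2, if_true, if_false]
    norm_num
  · norm_num

lemma InducedPath.exists_labelled {k : ℤ} (hk : 1 ≤ k) {e : ℕ → ℤ × ℤ} {L : ℕ}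
    (h : InducedPath k e L) {j : ℕ} (hj : j ≤ L) :
    ∃ ψ v lam, Realizes k (below k e L (j + 1)) ψ ∧ Labelled k e ψ j v lam ∧
      ∀ x ∈ Icc 0 (2 * k + 1 : ℝ), hexN (ψ (x, 1 / 2) - toR (e j)) ≤ 1 → x ≤ v := by
  have hk' : (1 : ℝ) ≤ k := by exact_mod_cast hk
  induction j with
  | zero =>
    obtain ⟨ψ, hψ⟩ := (h.good_below (Nat.zero_le (L + 1))).exists_realizes hk
    have h0 : hexN (ψ (0, 1 / 2) - toR (e 0)) ≤ 1 := by
      rw [hψ.1 _ (by simp [rectInt]), h.zero, hexN_le_iff]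
      norm_num [toR, abs_le]
    have hl : Labelled k e ψ 0 0 fun _ => 0 := by
      refine ⟨⟨le_rfl, by linarith⟩, fun _ _ _ _ _ => le_rfl, fun _ _ => le_rfl, fun x hx => ?_⟩
      have : x = 0 := le_antisymm hx.2 hx.1
      rwa [this]
    rw [below_succ]
    refine hl.step hk (h.good_below (by omega)) ?_ (h.notMem_below le_rfl hj) hψ
      ⟨le_rfl, le_rfl⟩ h0
    rw [← below_succ]
    exact h.good_below (by omega)
  | succ j ih =>
    obtain ⟨ψ, v, lam, hψ, hl, hv⟩ := ih (by omega)
    obtain ⟨i, hi⟩ := h.adj j (by omega)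
    have hbox := h.mem_box j (by omega)
    have hmem : e j ∈ below k e L (j + 1) := by rw [below_succ]; exact mem_insert _ _
    have hnot : e (j + 1) ∉ below k e L (j + 1) := h.notMem_below le_rfl hj
    set m := toR (e j) + (1 / 2 : ℝ) • toR (dir i) with hm
    have hm1 : hexN (m - toR (e j)) ≤ 1 := by
      rw [hm, add_sub_cancel_left, (ringSum_half_dir 0 i).1]; norm_num
    have hm2 : hexN (m - toR (e (j + 1))) ≤ 1 := by
      have : m - toR (e (j + 1)) = -((1 / 2 : ℝ) • toR (dir i)) := by
        rw [hm, hi, toR_add]; module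
      rw [this, hexN_neg, (ringSum_half_dir 0 i).1]; norm_num
    have hmz : field k (below k e L (j + 1)) m = 0 := field_midpoint hbox hmem (hi ▸ hnot)
    have hr : ψ.symm m ∈ rect k :=
      (homeo_mem_iff (homeo_symm_support hψ.1) (rectInt_subset_rect k) m).2
        (mem_rect_of_hexN_le hbox hm1)
    have h3 := (hψ.2 _ hr).1 (by rwa [ψ.apply_symm_apply])
    have h4 : ψ ((ψ.symm m).1, 1 / 2) = m := by
      have : ((ψ.symm m).1, (1 / 2 : ℝ)) = ψ.symm m := Prod.ext rfl h3.symm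
      rw [this, ψ.apply_symm_apply]
    have hx : (ψ.symm m).1 ∈ Icc 0 v := ⟨hr.1.1, hv _ hr.1 (by rwa [h4])⟩
    have hl' : Labelled k e ψ (j + 1) v lam :=
      ⟨hl.v_mem, hl.mono, fun x hx => (hl.le x hx).trans (Nat.le_succ j), hl.near⟩
    rw [below_succ _ _ _ (j + 1)]
    refine hl'.step hk (h.good_below (by omega)) ?_ hnot hψ hx (by rwa [h4])
    rw [← below_succ]
    exact h.good_below (by omega)

/-- A crosscut of the lattice rectangle that follows a given induced path monotonically. -/
theorem InducedPath.exists_crosscut {k : ℤ} (hk : 1 ≤ k) {e : ℕ → ℤ × ℤ} {L : ℕ}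
    (h : InducedPath k e L) :
    ∃ ψ : (ℝ × ℝ) ≃ₜ (ℝ × ℝ), ∃ lam : ℝ → ℕ, (∀ p, p ∉ rectInt k → ψ p = p) ∧
      MonotoneOn lam (Icc 0 (2 * k + 1 : ℝ)) ∧ (∀ x ∈ Icc 0 (2 * k + 1 : ℝ), lam x ≤ L) ∧
      ∀ x ∈ Icc 0 (2 * k + 1 : ℝ), hexN (ψ (x, 1 / 2) - toR (e (lam x))) ≤ 1 := by
  have hk' : (1 : ℝ) ≤ k := by exact_mod_cast hk
  obtain ⟨ψ, v, lam, hψ, hl, hv⟩ := h.exists_labelled hk le_rfl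
  have : v = 2 * k + 1 := by
    refine le_antisymm hl.v_mem.2 (hv _ ⟨by linarith, le_rfl⟩ ?_)
    rw [hψ.1 _ (by simp [rectInt]), h.last, hexN_le_iff]
    norm_num [toR, abs_le]
  subst this
  exact ⟨ψ, lam, hψ.1, hl.mono, hl.le, hl.near⟩

/-- The closed unit square. -/
def sq : Set (ℝ × ℝ) := Icc 0 1 ×ˢ Icc 0 1

/-- The open unit square. -/
def sqInt : Set (ℝ × ℝ) := Ioo 0 1 ×ˢ Ioo 0 1

lemma mem_sq {p : ℝ × ℝ} : p ∈ sq ↔ (0 ≤ p.1 ∧ p.1 ≤ 1) ∧ 0 ≤ p.2 ∧ p.2 ≤ 1 := Iff.rfl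

lemma mem_sqInt {p : ℝ × ℝ} : p ∈ sqInt ↔ (0 < p.1 ∧ p.1 < 1) ∧ 0 < p.2 ∧ p.2 < 1 := Iff.rfl

lemma exists_seq_of_reflTransGen {α : Type*} {R : α → α → Prop} {a b : α}
    (h : Relation.ReflTransGen R a b) :
    ∃ (M : ℕ) (f : ℕ → α), f 0 = a ∧ f M = b ∧ ∀ i < M, R (f i) (f (i + 1)) := by
  induction h with
  | refl => exact ⟨0, fun _ => a, rfl, rfl, fun i hi => absurd hi (Nat.not_lt_zero i)⟩
  | @tail b c _ hbc ih =>
    obtain ⟨M, f, h0, hM, hf⟩ := ih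
    refine ⟨M + 1, fun i => if i ≤ M then f i else c, by simpa using h0, by simp, fun i hi => ?_⟩
    beta_reduce
    rcases Nat.lt_succ_iff_lt_or_eq.1 hi with h | rfl
    · rw [if_pos h.le, if_pos (by omega)]; exact hf i h
    · rw [if_pos le_rfl, if_neg (by omega), hM]; exact hbc

/-- A chain of labelled lattice points joining the two ends of the crosscut. -/
structure NodeChain (k : ℤ) (P : ℤ × ℤ → ℝ → Prop) (e : ℕ → ℤ × ℤ) (s : ℕ → ℝ) (M : ℕ) : Prop where
  mem_box : ∀ i ≤ M, e i ∈ box k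
  valid : ∀ i ≤ M, P (e i) (s i)
  mono : ∀ i < M, s i ≤ s (i + 1)
  adj : ∀ i < M, e i = e (i + 1) ∨ Adj (e i) (e (i + 1))
  zero : e 0 = (1, 1)
  last : e M = (2 * k, 0)

lemma NodeChain.mono' {k : ℤ} {P : ℤ × ℤ → ℝ → Prop} {e : ℕ → ℤ × ℤ} {s : ℕ → ℝ} {M : ℕ}
    (h : NodeChain k P e s M) {i j : ℕ} (hij : i ≤ j) (hj : j ≤ M) : s i ≤ s j := by
  induction j, hij using Nat.le_induction with
  | base => exact le_rfl
  | succ j hij ih => exact (ih (by omega)).trans (h.mono j (by omega))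

lemma NodeChain.shortcut {k : ℤ} {P : ℤ × ℤ → ℝ → Prop} {e : ℕ → ℤ × ℤ} {s : ℕ → ℝ} {M : ℕ}
    (h : NodeChain k P e s M) {i d : ℕ} (hid : i + d ≤ M)
    (hj : i + 1 + d ≤ M → e i = e (i + 1 + d) ∨ Adj (e i) (e (i + 1 + d)))
    (hlast : i + d = M → e i = e M) :
    ∃ e' s', NodeChain k P e' s' (M - d) := by
  refine ⟨fun t => if t ≤ i then e t else e (t + d), fun t => if t ≤ i then s t else s (t + d),
    fun t ht => ?_, fun t ht => ?_, fun t ht => ?_, fun t ht => ?_, ?_, ?_⟩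
  · split_ifs with h1
    · exact h.mem_box t (by omega)
    · exact h.mem_box _ (by omega)
  · split_ifs with h1
    · exact h.valid t (by omega)
    · exact h.valid _ (by omega)
  · split_ifs with h1 h2
    · exact h.mono t (by omega)
    · exact h.mono' (by omega) (by omega)
    · omega
    · exact h.mono' (by omega) (by omega)
  · rcases lt_trichotomy t i with h1 | rfl | h1
    · rw [if_pos h1.le, if_pos (by omega)]
      exact h.adj t (by omega)
    · rw [if_pos le_rfl, if_neg (by omega)]
      exact hj (by omega)
    · rw [if_neg (by omega), if_neg (by omega), Nat.add_right_comm]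
      exact h.adj _ (by omega)
  · rw [if_pos (Nat.zero_le _), h.zero]
  · rcases hid.eq_or_lt with h1 | h1
    · rw [if_pos (by omega), ← h.last, ← hlast h1]
      congr 1; omega
    · rw [if_neg (by omega), ← h.last]
      congr 1; omega

/-- A shortest node chain is an induced path. -/
lemma NodeChain.exists_induced {k : ℤ} {P : ℤ × ℤ → ℝ → Prop} {e : ℕ → ℤ × ℤ} {s : ℕ → ℝ} {M : ℕ}
    (h : NodeChain k P e s M) :
    ∃ e' s' M', NodeChain k P e' s' M' ∧ InducedPath k e' M' := by
  classical
  have hex : ∃ M e s, NodeChain k P e s M := ⟨M, e, s, h⟩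
  obtain ⟨e', s', h'⟩ := Nat.find_spec hex
  set M' := Nat.find hex
  have hmin : ∀ d, 0 < d → d ≤ M' → ¬ ∃ e s, NodeChain k P e s (M' - d) := fun d hd hd' hc =>
    Nat.find_min hex (m := M' - d) (by omega) hc
  have hne : ∀ i j, i < j → j ≤ M' → e' i ≠ e' j := by
    intro i j hij hj heq
    refine hmin (j - i) (by omega) (by omega) (h'.shortcut (i := i) (by omega) (fun h1 => ?_) ?_)
    · rw [heq, show i + 1 + (j - i) = j + 1 by omega]
      exact h'.adj j (by omega)
    · intro h1
      rw [heq, show j = M' by omega]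
  refine ⟨e', s', M', h', h'.mem_box, fun i hi => ?_, fun i j hij hj => ⟨fun ha => ?_, ?_⟩,
    h'.zero, h'.last⟩
  · exact (h'.adj i hi).resolve_left (hne i (i + 1) (by omega) hi)
  · refine hmin (j - i - 1) (by omega) (by omega)
      (h'.shortcut (i := i) (by omega) (fun h1 => .inr ?_) ?_)
    · rwa [show i + 1 + (j - i - 1) = j by omega]
    · intro h1
      omega
  · exact hne i j (by omega) hj

/-- The lattice point of the box near a point of the plane. -/
noncomputable def node (k : ℤ) (p : ℝ × ℝ) : ℤ × ℤ :=
  (max 1 (min ⌊p.1⌋ (2 * k)), max (1 - k) (min ⌊p.2⌋ k))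

lemma node_mem_box {k : ℤ} (hk : 1 ≤ k) (p : ℝ × ℝ) : node k p ∈ box k := by
  rw [mem_box]
  simp only [node]
  omega

lemma abs_clamp_sub_le {x : ℝ} {a b : ℤ} (hab : a ≤ b) (h1 : (a : ℝ) - 1 ≤ x)
    (h2 : x ≤ b + 1) : |x - (max a (min ⌊x⌋ b) : ℤ)| ≤ 1 := by
  have h3 := Int.floor_le x
  have h4 := Int.lt_floor_add_one x
  rw [abs_le]
  rcases le_total ⌊x⌋ b with h | h
  · rw [min_eq_left h]
    rcases le_total a ⌊x⌋ with h' | h'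
    · rw [max_eq_right h']
      constructor <;> linarith
    · rw [max_eq_left h']
      have : (⌊x⌋ : ℝ) ≤ a := by exact_mod_cast h'
      constructor <;> linarith
  · rw [min_eq_right h, max_eq_right hab]
    have : (b : ℝ) ≤ ⌊x⌋ := by exact_mod_cast h
    constructor <;> linarith

lemma norm_sub_node_le {k : ℤ} (hk : 1 ≤ k) {p : ℝ × ℝ} (hp : p ∈ rect k) :
    ‖p - toR (node k p)‖ ≤ 1 := by
  simp only [rect, mem_prod, mem_Icc] at hp
  rw [Prod.norm_def, max_le_iff]
  constructor
  · exact abs_clamp_sub_le (by omega) (by push_cast; linarith) (by push_cast; linarith)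
  · exact abs_clamp_sub_le (by omega) (by push_cast; linarith) (by push_cast; linarith)

lemma abs_floor_sub_le {x y : ℝ} (h : |x - y| ≤ 1) : ⌊x⌋ ≤ ⌊y⌋ + 1 ∧ ⌊y⌋ ≤ ⌊x⌋ + 1 := by
  rw [abs_le] at h
  constructor
  · rw [← Int.floor_add_one]; exact Int.floor_mono (by linarith)
  · rw [← Int.floor_add_one]; exact Int.floor_mono (by linarith)

lemma eq_or_adj {u v : ℤ × ℤ} (h1 : -1 ≤ v.1 - u.1 ∧ v.1 - u.1 ≤ 1)
    (h2 : -1 ≤ v.2 - u.2 ∧ v.2 - u.2 ≤ 1) (h3 : v.1 = u.1 ∨ v.2 = u.2) : u = v ∨ Adj u v := by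
  obtain ⟨a, b⟩ := u
  obtain ⟨c, d⟩ := v
  simp only at h1 h2 h3
  rcases h3 with rfl | rfl
  · have : d = b - 1 ∨ d = b ∨ d = b + 1 := by omega
    rcases this with rfl | rfl | rfl
    · exact .inr ⟨5, by simp [dir]; ring⟩
    · exact .inl rfl
    · exact .inr ⟨2, by simp [dir]⟩
  · have : c = a - 1 ∨ c = a ∨ c = a + 1 := by omega
    rcases this with rfl | rfl | rfl
    · exact .inr ⟨3, by simp [dir]; ring⟩
    · exact .inl rfl
    · exact .inr ⟨0, by simp [dir]⟩

/-- Rescaling the unit square to the lattice rectangle. -/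
noncomputable def scale (k : ℕ) : (ℝ × ℝ) ≃ₜ (ℝ × ℝ) :=
  (Homeomorph.smulOfNeZero ((2 * k + 1 : ℝ)) (by positivity)).trans (Homeomorph.addRight (0, -(k : ℝ)))

lemma scale_apply (k : ℕ) (p : ℝ × ℝ) :
    scale k p = ((2 * k + 1) * p.1, (2 * k + 1) * p.2 - k) := by
  ext <;> simp [scale, sub_eq_add_neg]

lemma scale_mem_rect {k : ℕ} {p : ℝ × ℝ} (hp : p ∈ sq) : scale k p ∈ rect k := by
  rw [mem_sq] at hp
  rw [scale_apply]
  simp only [rect, mem_prod, mem_Icc, Int.cast_natCast]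
  have : (0 : ℝ) ≤ 2 * k + 1 := by positivity
  refine ⟨⟨?_, ?_⟩, ?_, ?_⟩ <;> nlinarith

lemma scale_mem_rectInt {k : ℕ} {p : ℝ × ℝ} : scale k p ∈ rectInt k ↔ p ∈ sqInt := by
  rw [mem_sqInt, scale_apply]
  simp only [rectInt, mem_prod, mem_Ioo, Int.cast_natCast]
  have : (0 : ℝ) < 2 * k + 1 := by positivity
  constructor
  · rintro ⟨⟨h1, h2⟩, h3, h4⟩
    refine ⟨⟨?_, ?_⟩, ?_, ?_⟩ <;> nlinarith
  · rintro ⟨⟨h1, h2⟩, h3, h4⟩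
    refine ⟨⟨?_, ?_⟩, ?_, ?_⟩ <;> nlinarith

lemma norm_scale_sub (k : ℕ) (p q : ℝ × ℝ) : ‖scale k p - scale k q‖ = (2 * k + 1) * ‖p - q‖ := by
  have : scale k p - scale k q = (2 * k + 1 : ℝ) • (p - q) := by
    rw [scale_apply, scale_apply]; ext <;> simp <;> ring
  rw [this, norm_smul, Real.norm_of_nonneg (by positivity)]

/-- The step relation between labelled points of the square. -/
def SqStep (good : ℝ × ℝ → ℝ → Prop) (δ : ℝ) (a b : (ℝ × ℝ) × ℝ) : Prop :=
  good b.1 b.2 ∧ b.1 ∈ sq ∧ dist a.1 b.1 ≤ δ ∧ a.2 ≤ b.2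

/-- A chain of labelled points across the square is followed monotonically by a crosscut. -/
theorem exists_crosscut {δ : ℝ} (hδ : 0 < δ) : ∃ δ' > 0, ∀ good : ℝ × ℝ → ℝ → Prop,
    good (0, 1 / 2) 0 →
    Relation.ReflTransGen (SqStep good δ') ((0, 1 / 2), 0) ((1, 1 / 2), 1) →
    ∃ ψ : (ℝ × ℝ) ≃ₜ (ℝ × ℝ), ∃ τ : ℝ → ℝ, (∀ p, p ∉ sqInt → ψ p = p) ∧
      MonotoneOn τ (Icc 0 1) ∧
      ∀ x ∈ Icc (0 : ℝ) 1, ∃ r, good r (τ x) ∧ dist (ψ (x, 1 / 2)) r ≤ δ := by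
  obtain ⟨k, hk⟩ := exists_nat_gt (3 / δ + 1)
  have hn : (0 : ℝ) < 2 * k + 1 := by positivity
  have hk1 : (1 : ℤ) ≤ k := by
    have : (1 : ℝ) < k := by have : 0 < 3 / δ := by positivity
                             linarith
    exact_mod_cast this.le
  have hkδ : 3 ≤ (2 * k + 1) * δ := by
    have h1 : 3 / δ ≤ 2 * k + 1 := by linarith [k.cast_nonneg (α := ℝ)]
    rwa [div_le_iff₀ hδ] at h1
  refine ⟨1 / (2 * k + 1), by positivity, fun good hg0 hchain => ?_⟩
  set P : ℤ × ℤ → ℝ → Prop := fun v s => ∃ r, good r s ∧ ‖scale k r - toR v‖ ≤ 2 with hP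
  set R : (ℤ × ℤ) × ℝ → (ℤ × ℤ) × ℝ → Prop := fun a b => b.1 ∈ box k ∧ P b.1 b.2 ∧ a.2 ≤ b.2 ∧
    (a.1 = b.1 ∨ Adj a.1 b.1) with hR
  have hs0 : (0, (1 / 2 : ℝ)) ∈ sq := by rw [mem_sq]; norm_num
  have hlift : ∀ a b, a.1 ∈ sq → SqStep good (1 / (2 * k + 1)) a b →
      Relation.ReflTransGen R (node k (scale k a.1), a.2) (node k (scale k b.1), b.2) := by
    rintro ⟨r, s⟩ ⟨r', s'⟩ hr ⟨hg, hr', hd, hs⟩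
    simp only at hr hg hr' hd hs ⊢
    have hd' : ‖scale k r - scale k r'‖ ≤ 1 := by
      rw [norm_scale_sub, ← dist_eq_norm]
      calc (2 * k + 1 : ℝ) * dist r r' ≤ (2 * k + 1) * (1 / (2 * k + 1)) := by gcongr
        _ = 1 := by field_simp
    have hn1 := norm_sub_node_le hk1 (scale_mem_rect (k := k) hr)
    have hn2 := norm_sub_node_le hk1 (scale_mem_rect (k := k) hr')
    have hb1 := node_mem_box hk1 (scale k r)
    have hb2 := node_mem_box hk1 (scale k r')
    have hf1 := abs_floor_sub_le ((norm_fst_le (scale k r - scale k r')).trans hd')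
    have hf2 := abs_floor_sub_le ((norm_snd_le (scale k r - scale k r')).trans hd')
    have e1 : -1 ≤ (node k (scale k r')).1 - (node k (scale k r)).1 ∧
        (node k (scale k r')).1 - (node k (scale k r)).1 ≤ 1 := by
      simp only [node]; omega
    have e2 : -1 ≤ (node k (scale k r')).2 - (node k (scale k r)).2 ∧
        (node k (scale k r')).2 - (node k (scale k r)).2 ≤ 1 := by
      simp only [node]; omega
    set u := node k (scale k r)
    set v := node k (scale k r')
    have hmid : ‖scale k r' - toR (v.1, u.2)‖ ≤ 2 := by
      rw [Prod.norm_def, max_le_iff] at hn1 hn2 hd' ⊢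
      simp only [Prod.fst_sub, Prod.snd_sub, toR, Real.norm_eq_abs, abs_le] at *
      refine ⟨⟨?_, ?_⟩, ?_, ?_⟩ <;> linarith
    have hbm : ((v.1, u.2) : ℤ × ℤ) ∈ box k := by
      rw [mem_box] at *
      exact ⟨hb2.1, hb1.2⟩
    refine .head (b := ((v.1, u.2), s')) ⟨hbm, ⟨r', hg, hmid⟩, hs, ?_⟩
      (.single ⟨hb2, ⟨r', hg, hn2.trans (by norm_num)⟩, le_rfl, ?_⟩)
    · exact eq_or_adj e1 (by simp) (.inr rfl)
    · exact eq_or_adj (by simp) e2 (.inl rfl)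
  have hall : ∀ b, Relation.ReflTransGen (SqStep good (1 / (2 * k + 1))) ((0, 1 / 2), 0) b →
      b.1 ∈ sq ∧ Relation.ReflTransGen R (node k (scale k (0, 1 / 2)), 0)
        (node k (scale k b.1), b.2) := by
    intro b hb
    induction hb with
    | refl => exact ⟨hs0, .refl⟩
    | tail _ hbc ih => exact ⟨hbc.2.1, ih.2.trans (hlift _ _ ih.1 hbc)⟩
  have hc := (hall _ hchain).2
  have hk1' : (1 : ℝ) ≤ k := by exact_mod_cast hk1
  have hsc0 : scale k (0, 1 / 2) = (0, 1 / 2) := by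
    rw [scale_apply]; ext <;> simp; ring
  have hsc1 : scale k (1, 1 / 2) = (2 * (k : ℝ) + 1, 1 / 2) := by
    rw [scale_apply]; ext <;> simp; ring
  have hnode0 : node k (scale k (0, 1 / 2)) = (1, 0) := by
    rw [hsc0]
    have : ⌊(1 / 2 : ℝ)⌋ = 0 := by norm_num
    simp only [node, this, Int.floor_zero]
    ext <;> simp only <;> omega
  have hnode1 : node k (scale k (1, 1 / 2)) = (2 * (k : ℤ), 0) := by
    rw [hsc1]
    have h1 : ⌊(1 / 2 : ℝ)⌋ = 0 := by norm_num
    have h2 : ⌊(2 * k + 1 : ℝ)⌋ = 2 * k + 1 := by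
      rw [show (2 * k + 1 : ℝ) = ((2 * k + 1 : ℤ) : ℝ) by push_cast; ring, Int.floor_intCast]
    simp only [node, h1, h2]
    ext <;> simp only <;> omega
  simp only at hc
  rw [hnode0, hnode1] at hc
  have hbox11 : ((1, 1) : ℤ × ℤ) ∈ box k := by
    rw [mem_box]; simp only; omega
  have hbox10 : ((1, 0) : ℤ × ℤ) ∈ box k := by
    rw [mem_box]; simp only; omega
  have hP11 : P (1, 1) 0 := by
    refine ⟨_, hg0, ?_⟩
    rw [hsc0, Prod.norm_def]; norm_num [toR]
  have hP10 : P (1, 0) 0 := by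
    refine ⟨_, hg0, ?_⟩
    rw [hsc0, Prod.norm_def]; norm_num [toR]
  have hc' : Relation.ReflTransGen R ((1, 1), 0) ((2 * (k : ℤ), 0), 1) :=
    .head (b := ((1, 0), 0)) ⟨hbox10, hP10, le_rfl, .inr ⟨5, rfl⟩⟩ hc
  obtain ⟨M, f, hf0, hfM, hf⟩ := exists_seq_of_reflTransGen hc'
  have hval : ∀ i ≤ M, (f i).1 ∈ box k ∧ P (f i).1 (f i).2 := by
    intro i hi
    rcases i with _ | i
    · rw [hf0]; exact ⟨hbox11, hP11⟩
    · exact ⟨(hf i hi).1, (hf i hi).2.1⟩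
  have hN : NodeChain k P (fun i => (f i).1) (fun i => (f i).2) M :=
    ⟨fun i hi => (hval i hi).1, fun i hi => (hval i hi).2, fun i hi => (hf i hi).2.2.1,
      fun i hi => (hf i hi).2.2.2, by rw [hf0], by rw [hfM]⟩
  obtain ⟨e, s, L, hN', hI⟩ := hN.exists_induced
  obtain ⟨ψ, lam, hψ, hmono, hle, hnear⟩ := hI.exists_crosscut hk1
  have hx : ∀ x ∈ Icc (0 : ℝ) 1, (2 * k + 1) * x ∈ Icc 0 (2 * (k : ℤ) + 1 : ℝ) := by
    rintro x ⟨h1, h2⟩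
    constructor
    · positivity
    · push_cast; nlinarith
  refine ⟨((scale k).trans ψ).trans (scale k).symm, fun x => s (lam ((2 * (k : ℝ) + 1) * x)),
    fun p hp => ?_, fun x hx' y hy hxy => ?_, fun x hx' => ?_⟩
  · simp only [Homeomorph.trans_apply]
    rw [hψ _ (by rwa [scale_mem_rectInt]), Homeomorph.symm_apply_apply]
  · exact hN'.mono' (hmono (hx x hx') (hx y hy) (by gcongr)) (hle _ (hx y hy))
  · obtain ⟨r, hr, hr'⟩ := hN'.valid _ (hle _ (hx x hx'))
    refine ⟨r, hr, ?_⟩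
    have h1 := hnear _ (hx x hx')
    simp only [Homeomorph.trans_apply]
    have h2 : scale k (x, 1 / 2) = ((2 * (k : ℝ) + 1) * x, 1 / 2) := by
      rw [scale_apply]; ext <;> simp; ring
    rw [h2]
    set q := ψ ((2 * (k : ℝ) + 1) * x, 1 / 2)
    set w := toR (e (lam ((2 * (k : ℝ) + 1) * x)))
    have h3 : (2 * k + 1) * dist ((scale k).symm q) r ≤ 3 := by
      rw [dist_eq_norm, ← norm_scale_sub, Homeomorph.apply_symm_apply]
      calc ‖q - scale k r‖ ≤ ‖q - w‖ + ‖w - scale k r‖ := norm_sub_le_norm_sub_add_norm_sub _ _ _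
        _ ≤ 1 + 2 := by
          gcongr
          · exact (norm_le_hexN _).trans h1
          · rwa [norm_sub_rev]
        _ = 3 := by norm_num
    exact le_of_mul_le_mul_left (h3.trans hkδ) hn

/-- A continuous bijection that is the identity off a compact set is a homeomorphism. -/
lemma exists_homeomorph_of_support {X : Type*} [TopologicalSpace X] [T2Space X]
    [WeaklyLocallyCompactSpace X] {f : X → X} (hf : Continuous f) (hb : Function.Bijective f)
    {K : Set X} (hK : IsCompact K) (hid : ∀ x, x ∉ K → f x = x) :
    ∃ φ : X ≃ₜ X, ∀ x, φ x = f x := by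
  have hp : IsProperMap f := by
    rw [isProperMap_iff_isCompact_preimage]
    refine ⟨hf, fun C hC => ?_⟩
    refine (hK.union hC).of_isClosed_subset (hC.isClosed.preimage hf) fun x hx => ?_
    by_cases h : x ∈ K
    · exact .inl h
    · right
      rw [mem_preimage, hid x h] at hx
      exact hx
  exact ⟨(Equiv.ofBijective f hb).toHomeomorphOfContinuousClosed hf hp.isClosedMap, fun _ => rfl⟩

lemma sqInt_subset_sq : sqInt ⊆ sq := prod_mono Ioo_subset_Icc_self Ioo_subset_Icc_self

lemma isCompact_sq : IsCompact sq := isCompact_Icc.prod isCompact_Icc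

lemma isOpen_sqInt : IsOpen sqInt := isOpen_Ioo.prod isOpen_Ioo

/-- A reparametrisation of the horizontal chord extends to the square. -/
lemma exists_homeomorph_of_strictMono {t : ℝ → ℝ} (ht : Continuous t) (hm : StrictMono t)
    (hid : ∀ x, x ∉ Ioo (0 : ℝ) 1 → t x = x) :
    ∃ ρ : (ℝ × ℝ) ≃ₜ (ℝ × ℝ), (∀ p, p ∉ sqInt → ρ p = p) ∧ ∀ x, ρ (t x, 1 / 2) = (x, 1 / 2) := by
  set w : ℝ → ℝ := fun y => max 0 (1 - |2 * y - 1|) with hw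
  have hw0 : ∀ y, 0 ≤ w y := fun y => le_max_left _ _
  have hw1 : ∀ y, w y ≤ 1 := fun y => max_le zero_le_one (by linarith [abs_nonneg (2 * y - 1)])
  have hwc : Continuous w := by fun_prop
  set f : ℝ × ℝ → ℝ × ℝ := fun p => (p.1 + w p.2 * (t p.1 - p.1), p.2) with hf
  have hfc : Continuous f := by fun_prop
  have hfid : ∀ p, p ∉ sqInt → f p = p := by
    rintro ⟨x, y⟩ hp
    by_cases hx : x ∈ Ioo (0 : ℝ) 1
    · have hy : y ∉ Ioo (0 : ℝ) 1 := fun hy => hp ⟨hx, hy⟩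
      have : w y = 0 := by
        simp only [hw]
        rw [mem_Ioo, not_and_or, not_lt, not_lt] at hy
        apply max_eq_left
        rcases hy with hy | hy
        · rw [abs_of_nonpos (by linarith)]; linarith
        · rw [abs_of_nonneg (by linarith)]; linarith
      simp [hf, this]
    · simp [hf, hid x hx]
  have hsm : ∀ y, StrictMono fun x => x + w y * (t x - x) := by
    intro y a b hab
    have h1 := hm hab
    have h2 := hw0 y
    have h3 := hw1 y
    beta_reduce
    rcases h3.lt_or_eq with h4 | h4
    · nlinarith [mul_pos (sub_pos.2 h4) (sub_pos.2 hab), mul_nonneg h2 (sub_pos.2 h1).le]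
    · rw [h4]; linarith
  have hinj : Function.Injective f := by
    rintro ⟨x, y⟩ ⟨x', y'⟩ h
    simp only [hf, Prod.mk.injEq] at h
    obtain ⟨h1, rfl⟩ := h
    rw [(hsm y).injective h1]
  have hsurj : Function.Surjective f := by
    rintro ⟨x, y⟩
    have hc : Continuous fun x => x + w y * (t x - x) := by fun_prop
    have h1 : min x 0 ∉ Ioo (0 : ℝ) 1 := fun h => absurd h.1 (by simp)
    have h2 : max x 1 ∉ Ioo (0 : ℝ) 1 := fun h => absurd h.2 (by simp)
    have hiv := intermediate_value_Icc (a := min x 0) (b := max x 1) (by simp) hc.continuousOn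
    obtain ⟨z, -, hz⟩ := hiv (show x ∈ _ by simp [hid _ h1, hid _ h2])
    exact ⟨(z, y), Prod.ext hz rfl⟩
  obtain ⟨φ, hφ⟩ := exists_homeomorph_of_support hfc ⟨hinj, hsurj⟩ isCompact_sq
    fun p hp => hfid p fun h => hp (sqInt_subset_sq h)
  refine ⟨φ.symm, fun p hp => ?_, fun x => ?_⟩
  · rw [Homeomorph.symm_apply_eq, hφ, hfid p hp]
  · rw [Homeomorph.symm_apply_eq, hφ]
    simp [hf, hw]

/-- A monotone function with small jumps is close to a Lipschitz monotone function. -/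
lemma exists_monotone_continuous_near {τ : ℝ → ℝ} (hm : Monotone τ) (h01 : ∀ x, τ x ∈ Icc (0 : ℝ) 1)
    {κ d : ℝ} (hd : 0 < d) (hj : ∀ x y, |x - y| ≤ d → |τ x - τ y| ≤ κ) :
    ∃ T : ℝ → ℝ, Continuous T ∧ Monotone T ∧ ∀ x, τ x - κ ≤ T x ∧ T x ≤ τ x := by
  have hκ : 0 ≤ κ := (abs_nonneg _).trans (hj 0 0 (by simpa using hd.le))
  set T : ℝ → ℝ := fun x => ⨅ y, (τ y + (1 / d) * |x - y|) with hT
  have hbdd : ∀ x, BddBelow (range fun y => τ y + (1 / d) * |x - y|) := by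
    refine fun x => ⟨0, ?_⟩
    rintro _ ⟨y, rfl⟩
    have := (h01 y).1
    positivity
  refine ⟨T, ?_, ?_, fun x => ⟨?_, ?_⟩⟩
  · refine LipschitzWith.continuous (K := (1 / d).toNNReal) (LipschitzWith.of_le_add_mul _ ?_)
    intro x x'
    rw [Real.coe_toNNReal _ (by positivity), hT, ciInf_add (hbdd x')]
    refine le_ciInf fun y => (ciInf_le (hbdd x) y).trans ?_
    rw [add_assoc, ← mul_add]
    gcongr
    calc |x - y| ≤ |x - x'| + |x' - y| := abs_sub_le _ _ _
      _ = |x' - y| + dist x x' := by rw [Real.dist_eq, add_comm]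
  · intro x x' hxx
    refine le_ciInf fun y => (ciInf_le (hbdd x) (y - (x' - x))).trans ?_
    have h1 : τ (y - (x' - x)) ≤ τ y := hm (by linarith)
    rw [show x - (y - (x' - x)) = x' - y by ring]
    linarith
  · refine le_ciInf fun y => ?_
    rcases le_total |x - y| d with h | h
    · have := (abs_le.1 (hj x y h)).2
      have h2 : 0 ≤ 1 / d * |x - y| := by positivity
      linarith
    · have h2 : 1 ≤ 1 / d * |x - y| := by
        rw [one_div, inv_mul_eq_div, le_div_iff₀ hd]; linarith
      linarith [(h01 x).2, (h01 y).1]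
  · exact (ciInf_le (hbdd x) x).trans (by simp)

/-- Approximation of a monotone function with small jumps by an increasing homeomorphism. -/
lemma exists_strictMono_near {τ : ℝ → ℝ} (hm : MonotoneOn τ (Icc 0 1))
    (h01 : MapsTo τ (Icc 0 1) (Icc 0 1)) {κ d : ℝ} (hκ : 0 < κ) (hκ' : κ ≤ 1 / 4) (hd : 0 < d)
    (hj : ∀ x ∈ Icc (0 : ℝ) 1, ∀ y ∈ Icc (0 : ℝ) 1, |x - y| ≤ d → |τ x - τ y| ≤ κ)
    (h0 : τ 0 ≤ κ) (h1 : 1 - κ ≤ τ 1) :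
    ∃ t : ℝ → ℝ, Continuous t ∧ StrictMono t ∧ (∀ x, x ∉ Ioo (0 : ℝ) 1 → t x = x) ∧
      ∀ x ∈ Icc (0 : ℝ) 1, |t x - τ x| ≤ 3 * κ := by
  set c : ℝ → ℝ := fun x => max 0 (min x 1) with hc
  have hcm : Monotone c := fun x y h => max_le_max le_rfl (min_le_min h le_rfl)
  have hc01 : ∀ x, c x ∈ Icc (0 : ℝ) 1 := fun x => ⟨le_max_left _ _, max_le zero_le_one
    (min_le_right _ _)⟩
  have hceq : ∀ x ∈ Icc (0 : ℝ) 1, c x = x := fun x hx => by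
    simp only [hc]; rw [min_eq_left hx.2, max_eq_right hx.1]
  have hclip : ∀ x y, x ≤ y → c y - c x ≤ y - x := by
    intro x y hxy
    simp only [hc]
    rcases le_total x 1 with h | h <;> rcases le_total y 1 with h' | h' <;>
    rcases le_total 0 x with h2 | h2 <;> rcases le_total 0 y with h3 | h3 <;>
    simp (disch := grind) only [max_eq_left, max_eq_right, min_eq_left, min_eq_right] <;> linarith
  have hcabs : ∀ x y, |c x - c y| ≤ |x - y| := by
    intro x y
    rcases le_total x y with h | h
    · rw [abs_sub_comm, abs_sub_comm x, abs_of_nonneg (sub_nonneg.2 (hcm h)),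
        abs_of_nonneg (sub_nonneg.2 h)]
      exact hclip x y h
    · rw [abs_of_nonneg (sub_nonneg.2 (hcm h)), abs_of_nonneg (sub_nonneg.2 h)]
      exact hclip y x h
  obtain ⟨T, hTc, hTm, hT⟩ := exists_monotone_continuous_near (τ := fun x => τ (c x))
    (fun x y h => hm (hc01 x) (hc01 y) (hcm h)) (fun x => h01 (hc01 x)) hd
    (fun x y h => hj _ (hc01 x) _ (hc01 y) ((hcabs x y).trans h))
  have hm0 : (0 : ℝ) ∈ Icc (0 : ℝ) 1 := ⟨le_rfl, zero_le_one⟩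
  have hm1 : (1 : ℝ) ∈ Icc (0 : ℝ) 1 := ⟨zero_le_one, le_rfl⟩
  set U : ℝ → ℝ := fun x => T x + κ * x with hU
  have hUs : StrictMono U := fun x y h => add_lt_add_of_le_of_lt (hTm h.le) (by gcongr)
  have hUc : Continuous U := by fun_prop
  have hUτ : ∀ x ∈ Icc (0 : ℝ) 1, |U x - τ x| ≤ κ := by
    intro x hx
    have := hT x
    simp only [hceq x hx] at this
    have h2 : κ * x ≤ κ := mul_le_of_le_one_right hκ.le hx.2
    have h3 : 0 ≤ κ * x := mul_nonneg hκ.le hx.1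
    rw [abs_le]
    constructor <;> simp only [hU] <;> linarith
  have hU0 := hUτ 0 hm0
  have hU1 := hUτ 1 hm1
  have hτ0 := (h01 hm0).1
  have hτ1 := (h01 hm1).2
  rw [abs_le] at hU0 hU1
  have hpos : 0 < U 1 - U 0 := sub_pos.2 (hUs zero_lt_one)
  set V : ℝ → ℝ := fun x => (U x - U 0) / (U 1 - U 0) with hV
  have hVs : StrictMono V := fun x y h => by
    simp only [hV]
    gcongr
    exact hUs h
  have hV0 : V 0 = 0 := by simp [hV]
  have hV1 : V 1 = 1 := by simp only [hV]; rw [div_self hpos.ne']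
  have hVU : ∀ x ∈ Icc (0 : ℝ) 1, |V x - U x| ≤ 2 * κ := by
    intro x hx
    have hv0 : 0 ≤ V x := by rw [← hV0]; exact hVs.monotone hx.1
    have hv1 : V x ≤ 1 := by rw [← hV1]; exact hVs.monotone hx.2
    have e : U x = U 0 + (U 1 - U 0) * V x := by
      simp only [hV]; field_simp; ring
    rw [e, abs_le]
    constructor <;> nlinarith
  refine ⟨fun x => V (c x) + (x - c x), ?_, ?_, ?_, ?_⟩
  · fun_prop
  · intro x y hxy
    have h2 := hclip x y hxy.le
    beta_reduce
    rcases (hcm hxy.le).lt_or_eq with h | h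
    · have := hVs h; linarith
    · rw [h]; linarith
  · intro x hx
    beta_reduce
    rw [mem_Ioo, not_and_or, not_lt, not_lt] at hx
    rcases hx with hx | hx
    · have : c x = 0 := by simp only [hc]; rw [max_eq_left]; exact (min_le_left _ _).trans hx
      rw [this, hV0]; ring
    · have : c x = 1 := by simp only [hc]; rw [min_eq_right hx]; simp
      rw [this, hV1]; ring
  · intro x hx
    beta_reduce
    rw [hceq x hx, sub_self, add_zero]
    calc |V x - τ x| ≤ |V x - U x| + |U x - τ x| := abs_sub_le _ _ _
      _ ≤ 3 * κ := by linarith [hVU x hx, hUτ x hx]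

/-- A continuous injective map on a compact set separates points uniformly. -/
lemma exists_sep {E X : Type*} [PseudoMetricSpace E] [MetricSpace X] {K : Set E}
    (hK : IsCompact K) {γ : E → X} (hγ : ContinuousOn γ K) (hinj : InjOn γ K) {κ : ℝ}
    (hκ : 0 < κ) : ∃ η > 0, ∀ s ∈ K, ∀ t ∈ K, dist (γ s) (γ t) ≤ η → dist s t < κ := by
  set C : Set (E × E) := (K ×ˢ K) ∩ {p : E × E | κ ≤ dist p.1 p.2} with hC
  have hCc : IsCompact C :=
    (hK.prod hK).inter_right (isClosed_le continuous_const (by fun_prop))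
  have hcont : ContinuousOn (fun p : E × E => dist (γ p.1) (γ p.2)) C :=
    continuous_dist.comp_continuousOn
      ((hγ.comp continuousOn_fst fun p (hp : p ∈ C) => hp.1.1).prodMk
        (hγ.comp continuousOn_snd fun p (hp : p ∈ C) => hp.1.2))
  rcases C.eq_empty_or_nonempty with h | h
  · refine ⟨1, one_pos, fun s hs t ht _ => not_le.1 fun hst => ?_⟩
    have : (s, t) ∈ C := ⟨⟨hs, ht⟩, hst⟩
    rw [h] at this
    exact this
  · obtain ⟨p, hp, hmin⟩ := hCc.exists_isMinOn h hcont
    have hpos : 0 < dist (γ p.1) (γ p.2) := by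
      rw [dist_pos]
      intro heq
      have := hinj hp.1.1 hp.1.2 heq
      have h2 : κ ≤ dist p.1 p.2 := hp.2
      rw [this, dist_self] at h2
      linarith
    refine ⟨dist (γ p.1) (γ p.2) / 2, by linarith, fun s hs t ht hst => not_le.1 fun h' => ?_⟩
    have : dist (γ p.1) (γ p.2) ≤ dist (γ s) (γ t) := hmin (a := (s, t)) ⟨⟨hs, ht⟩, h'⟩
    linarith

/-- Uniform continuity on compact sets, in terms of distances. -/
lemma exists_unif {E X : Type*} [PseudoMetricSpace E] [PseudoMetricSpace X] {K : Set E}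
    (hK : IsCompact K) {γ : E → X} (hγ : ContinuousOn γ K) {ε : ℝ} (hε : 0 < ε) :
    ∃ δ > 0, ∀ s ∈ K, ∀ t ∈ K, dist s t < δ → dist (γ s) (γ t) < ε := by
  have := hK.uniformContinuousOn_of_continuous hγ
  rw [Metric.uniformContinuousOn_iff] at this
  exact this ε hε

/-- A path following the chord `γ` with monotone labels can be reparametrised to be close to
`γ`. -/
theorem exists_reparam {X : Type*} [MetricSpace X] {γ : ℝ → X} (hγ : ContinuousOn γ (Icc 0 1))
    (hinj : InjOn γ (Icc 0 1)) {ε : ℝ} (hε : 0 < ε) : ∃ η > 0, ∀ (Γ : ℝ → X) (τ : ℝ → ℝ),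
    ContinuousOn Γ (Icc 0 1) → MonotoneOn τ (Icc 0 1) → MapsTo τ (Icc 0 1) (Icc 0 1) →
    (∀ x ∈ Icc (0 : ℝ) 1, dist (Γ x) (γ (τ x)) ≤ η) → dist (Γ 0) (γ 0) ≤ η →
    dist (Γ 1) (γ 1) ≤ η →
    ∃ ρ : (ℝ × ℝ) ≃ₜ (ℝ × ℝ), ∃ σ : ℝ → ℝ, (∀ p, p ∉ sqInt → ρ p = p) ∧
      ∀ x ∈ Icc (0 : ℝ) 1, σ x ∈ Icc (0 : ℝ) 1 ∧ ρ (x, 1 / 2) = (σ x, 1 / 2) ∧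
        dist (Γ (σ x)) (γ x) ≤ ε := by
  obtain ⟨δ, hδ, hδ'⟩ := exists_unif isCompact_Icc hγ (half_pos hε)
  set κ := min (δ / 4) (1 / 4) with hκdef
  have hκ : 0 < κ := lt_min (by linarith) (by norm_num)
  have hκδ : κ ≤ δ / 4 := min_le_left _ _
  obtain ⟨η₁, hη₁, hsep⟩ := exists_sep isCompact_Icc hγ hinj hκ
  set η := min (ε / 2) (η₁ / 4) with hηdef
  have hη : 0 < η := lt_min (by linarith) (by linarith)
  have hη2 : η ≤ ε / 2 := min_le_left _ _
  have hη3 : η ≤ η₁ / 4 := min_le_right _ _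
  refine ⟨η, hη, fun Γ τ hΓ hm h01 hnear hn0 hn1 => ?_⟩
  have hm0 : (0 : ℝ) ∈ Icc (0 : ℝ) 1 := ⟨le_rfl, zero_le_one⟩
  have hm1 : (1 : ℝ) ∈ Icc (0 : ℝ) 1 := ⟨zero_le_one, le_rfl⟩
  obtain ⟨d, hd, hd'⟩ := exists_unif isCompact_Icc hΓ hη
  have h0 : τ 0 ≤ κ := by
    have h2 := dist_triangle_left (γ (τ 0)) (γ 0) (Γ 0)
    have h3 := hsep _ (h01 hm0) _ hm0 (by linarith [hnear 0 hm0])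
    rw [Real.dist_eq, sub_zero] at h3
    exact (le_abs_self _).trans h3.le
  have h1 : 1 - κ ≤ τ 1 := by
    have h2 := dist_triangle_left (γ (τ 1)) (γ 1) (Γ 1)
    have h3 := hsep _ (h01 hm1) _ hm1 (by linarith [hnear 1 hm1])
    rw [Real.dist_eq] at h3
    linarith [neg_abs_le (τ 1 - 1)]
  have hj : ∀ x ∈ Icc (0 : ℝ) 1, ∀ y ∈ Icc (0 : ℝ) 1, |x - y| ≤ d / 2 → |τ x - τ y| ≤ κ := by
    intro x hx y hy hxy
    have h4 := hd' x hx y hy (by rw [Real.dist_eq]; linarith)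
    have h5 := hsep _ (h01 hx) _ (h01 hy) (by
      have e1 := dist_triangle_left (γ (τ x)) (γ (τ y)) (Γ x)
      have e2 := dist_triangle (Γ x) (Γ y) (γ (τ y))
      linarith [hnear x hx, hnear y hy])
    rw [Real.dist_eq] at h5
    exact h5.le
  obtain ⟨t, htc, htm, htid, htn⟩ := exists_strictMono_near hm h01 hκ (min_le_right _ _)
    (half_pos hd) hj h0 h1
  obtain ⟨ρ, hρ, hρt⟩ := exists_homeomorph_of_strictMono htc htm htid
  have hsurj : ∀ x ∈ Icc (0 : ℝ) 1, ∃ y ∈ Icc (0 : ℝ) 1, t y = x := by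
    intro x hx
    have := intermediate_value_Icc zero_le_one htc.continuousOn
    rw [htid 0 (by simp), htid 1 (by simp)] at this
    exact this hx
  choose! σ hσ hσt using hsurj
  refine ⟨ρ, σ, hρ, fun x hx => ⟨hσ x hx, ?_, ?_⟩⟩
  · have := hρt (σ x)
    rwa [hσt x hx] at this
  · have h2 := htn _ (hσ x hx)
    rw [hσt x hx] at h2
    have h3 := hδ' _ (h01 (hσ x hx)) _ hx (by
      rw [dist_comm, Real.dist_eq]; linarith)
    linarith [dist_triangle (Γ (σ x)) (γ (τ (σ x))) (γ x), hnear _ (hσ x hx)]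

section Mono

variable {X : Type*} [MetricSpace X] [CompactSpace X]

/-- Monotone maps: continuous surjections with connected fibres. -/
structure Mono (g : X → X) : Prop where
  cont : Continuous g
  surj : Function.Surjective g
  fiber : ∀ b, IsPreconnected (g ⁻¹' {b})

lemma Mono.comp_homeomorph {g : X → X} (hg : Mono g) (Ψ : X ≃ₜ X) : Mono fun x => g (Ψ x) where
  cont := hg.cont.comp Ψ.continuous
  surj := hg.surj.comp Ψ.surjective
  fiber b := by
    have : (fun x => g (Ψ x)) ⁻¹' {b} = Ψ ⁻¹' (g ⁻¹' {b}) := rfl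
    rw [this, ← Homeomorph.image_symm]
    exact (hg.fiber b).image _ Ψ.symm.continuous.continuousOn

lemma Mono.preimage {g : X → X} (hg : Mono g) {C : Set X} (hC : IsPreconnected C) :
    IsPreconnected (g ⁻¹' C) := by
  have hop : ∀ U : Set X, IsOpen U → IsOpen {b | g ⁻¹' {b} ⊆ U} := by
    intro U hU
    have : {b | g ⁻¹' {b} ⊆ U} = (g '' Uᶜ)ᶜ := by
      ext b
      rw [mem_ofPred_eq]
      constructor
      · rintro h ⟨x, hx, rfl⟩
        exact hx (h rfl)
      · intro h x hx
        by_contra hxU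
        exact h ⟨x, hxU, hx⟩
    rw [this, isOpen_compl_iff]
    exact (hU.isClosed_compl.isCompact.image hg.cont).isClosed
  rintro U V hU hV hUV ⟨x, hxC, hxU⟩ ⟨y, hyC, hyV⟩
  by_contra hne
  have hdis : ∀ z, g z ∈ C → z ∈ U → z ∈ V → False := fun z h1 h2 h3 => hne ⟨z, h1, h2, h3⟩
  have key : ∀ b ∈ C, g ⁻¹' {b} ⊆ U ∨ g ⁻¹' {b} ⊆ V := by
    intro b hb
    have hbs : g ⁻¹' {b} ⊆ U ∪ V := fun z hz => hUV (by
      have : g z = b := hz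
      simpa [this] using hb)
    by_contra hcon
    push Not at hcon
    obtain ⟨h1, h2⟩ := hcon
    obtain ⟨z1, hz1, hz1'⟩ := Set.not_subset.1 h1
    obtain ⟨z2, hz2, hz2'⟩ := Set.not_subset.1 h2
    obtain ⟨z, hz, hz'⟩ := hg.fiber b U V hU hV hbs
      ⟨z2, hz2, (hbs hz2).resolve_right hz2'⟩ ⟨z1, hz1, (hbs hz1).resolve_left hz1'⟩
    have : g z = b := hz
    exact hdis z (this ▸ hb) hz'.1 hz'.2
  obtain ⟨b, hb, hbU, hbV⟩ := hC _ _ (hop U hU) (hop V hV) (fun b hb => key b hb)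
    ⟨g x, hxC, (key _ hxC).resolve_right fun h => hdis x hxC hxU (h rfl)⟩
    ⟨g y, hyC, (key _ hyC).resolve_left fun h => hdis y hyC (h rfl) hyV⟩
  obtain ⟨z, rfl⟩ := hg.surj b
  exact hdis z hb (hbU rfl) (hbV rfl)

end Mono

/-- Points of a preconnected set are joined by chains with small steps. -/
lemma chain_of_isPreconnected {X : Type*} [PseudoMetricSpace X] {C : Set X} (hC : IsPreconnected C)
    {a b : X} (ha : a ∈ C) (hb : b ∈ C) {δ : ℝ} (hδ : 0 < δ) :
    Relation.ReflTransGen (fun x y => y ∈ C ∧ dist x y ≤ δ) a b := by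
  set R := Relation.ReflTransGen (fun x y : X => y ∈ C ∧ dist x y ≤ δ) a
  set U : Set X := ⋃ x ∈ {x | R x}, Metric.ball x (δ / 2)
  set V : Set X := ⋃ x ∈ {x | x ∈ C ∧ ¬ R x}, Metric.ball x (δ / 2)
  have hU : IsOpen U := isOpen_biUnion fun _ _ => Metric.isOpen_ball
  have hV : IsOpen V := isOpen_biUnion fun _ _ => Metric.isOpen_ball
  by_contra hab
  have haU : a ∈ U := mem_biUnion (show a ∈ {x | R x} from Relation.ReflTransGen.refl)
    (Metric.mem_ball_self (by linarith))
  have hbV : b ∈ V := mem_biUnion (show b ∈ {x | x ∈ C ∧ ¬ R x} from ⟨hb, hab⟩)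
    (Metric.mem_ball_self (by linarith))
  have hcov : C ⊆ U ∪ V := by
    intro x hx
    by_cases h : R x
    · exact Or.inl (mem_biUnion (show x ∈ {x | R x} from h) (Metric.mem_ball_self (by linarith)))
    · exact Or.inr (mem_biUnion (show x ∈ {x | x ∈ C ∧ ¬ R x} from ⟨hx, h⟩)
        (Metric.mem_ball_self (by linarith)))
  obtain ⟨z, hz, hzU, hzV⟩ := hC U V hU hV hcov ⟨a, ha, haU⟩ ⟨b, hb, hbV⟩
  obtain ⟨x, hx, hzx⟩ := mem_iUnion₂.1 hzU
  obtain ⟨y, hy, hzy⟩ := mem_iUnion₂.1 hzV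
  rw [mem_ofPred_eq] at hx hy
  refine hy.2 (hx.tail ⟨hy.1, ?_⟩)
  rw [Metric.mem_ball] at hzx hzy
  linarith [dist_triangle_left x y z]

/-- Uniform local connectedness. -/
def ULC (X : Type*) [PseudoMetricSpace X] : Prop :=
  ∀ ε : ℝ, 0 < ε → ∃ η : ℝ, 0 < η ∧ ∀ a b : X, dist a b ≤ η →
    ∃ C : Set X, IsPreconnected C ∧ a ∈ C ∧ b ∈ C ∧ ∀ c ∈ C, dist c b ≤ ε

lemma ulc_of_locallyConnected (X : Type*) [PseudoMetricSpace X] [CompactSpace X]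
    [LocallyConnectedSpace X] : ULC X := by
  intro ε hε
  have h : ∀ x : X, ∃ V : Set X, V ⊆ Metric.ball x (ε / 2) ∧ IsOpen V ∧ x ∈ V ∧ IsConnected V := by
    intro x
    obtain ⟨V, hV1, hV2, hV3, hV4⟩ := locallyConnectedSpace_iff_subsets_isOpen_isConnected.1
      ‹LocallyConnectedSpace X› x (Metric.ball x (ε / 2)) (Metric.ball_mem_nhds x (by linarith))
    exact ⟨V, hV1, hV2, hV3, hV4⟩
  choose V hV1 hV2 hV3 hV4 using h
  obtain ⟨δ, hδ, hL⟩ := lebesgue_number_lemma_of_metric (isCompact_univ (X := X)) hV2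
    (fun x _ => mem_iUnion.2 ⟨x, hV3 x⟩)
  refine ⟨δ / 2, by linarith, fun a b hab => ?_⟩
  obtain ⟨i, hi⟩ := hL a (mem_univ _)
  have hb : b ∈ V i := hi (by rw [Metric.mem_ball, dist_comm]; linarith)
  refine ⟨V i, (hV4 i).isPreconnected, hi (Metric.mem_ball_self hδ), hb, fun c hc => ?_⟩
  have h1 := hV1 i hc
  have h2 := hV1 i hb
  rw [Metric.mem_ball] at h1 h2
  linarith [dist_triangle_right c b i]

/-- A labelled step following the path `γ` through `g`. -/
def Follow {X : Type*} [PseudoMetricSpace X] (g : X → X) (γ : ℝ → X) (η κ δ : ℝ) (u v : X × ℝ) :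
    Prop :=
  dist u.1 v.1 ≤ δ ∧ u.2 ≤ v.2 ∧ v.2 ∈ Icc (0 : ℝ) 1 ∧ dist (g v.1) (γ v.2) ≤ η ∧
    (v.2 = 0 ∨ v.2 = 1 ∨ ∃ t, |t - v.2| ≤ κ ∧ g v.1 = γ t)

/-- Monotone maps lift paths to labelled chains. -/
lemma exists_follow {X : Type*} [MetricSpace X] [CompactSpace X] (hX : ULC X) {γ : ℝ → X}
    (hγ : ContinuousOn γ (Icc 0 1)) {η' κ : ℝ} (hη' : 0 < η') (hκ : 0 < κ) :
    ∃ η > 0, ∀ g : X → X, Mono g → ∀ a b, dist (g a) (γ 0) ≤ η → dist (g b) (γ 1) ≤ η →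
      ∀ δ : ℝ, 0 < δ → Relation.ReflTransGen (Follow g γ η' κ δ) (a, 0) (b, 1) := by
  obtain ⟨η, hη, hC⟩ := hX η' hη'
  obtain ⟨d', hd', hu'⟩ := exists_unif isCompact_Icc hγ hη'
  set d := min d' κ
  have hd : 0 < d := lt_min hd' hκ
  have hu : ∀ s ∈ Icc (0 : ℝ) 1, ∀ t ∈ Icc (0 : ℝ) 1, dist s t < d → dist (γ s) (γ t) < η' :=
    fun s hs t ht h => hu' s hs t ht (h.trans_le (min_le_left _ _))
  have hdκ : d ≤ κ := min_le_right _ _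
  refine ⟨η, hη, fun g hg a b ha hb δ hδ => ?_⟩
  have lift : ∀ (D : Set X) (s : ℝ), s ∈ Icc (0 : ℝ) 1 → IsPreconnected D →
      (∀ c ∈ D, dist c (γ s) ≤ η') →
      (s = 0 ∨ s = 1 ∨ ∀ c ∈ D, ∃ t, |t - s| ≤ κ ∧ c = γ t) → ∀ x y, g x ∈ D → g y ∈ D →
      Relation.ReflTransGen (Follow g γ η' κ δ) (x, s) (y, s) := by
    intro D s hs hD hDs hDt x y hx hy
    have := chain_of_isPreconnected (hg.preimage hD) (a := x) (b := y) hx hy hδ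
    induction this with
    | refl => exact .refl
    | tail _ h2 ih =>
      have ih' := ih (by
        rename_i z _ h1
        rcases Relation.ReflTransGen.cases_tail h1 with h | ⟨_, _, h⟩
        · rw [h]; exact hx
        · exact h.1)
      exact ih'.tail ⟨h2.2, le_rfl, hs, hDs _ h2.1, hDt.imp_right (Or.imp_right fun h => h _ h2.1)⟩
  obtain ⟨C0, hC0, ha0, hγ0, hd0⟩ := hC _ _ ha
  obtain ⟨C1, hC1, hb1, hγ1, hd1⟩ := hC _ _ hb
  obtain ⟨n, hn⟩ := exists_nat_gt (1 / d)
  have hn0 : (0 : ℝ) < n := (by positivity : (0 : ℝ) < 1 / d).trans hn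
  have hnd : 1 / (n : ℝ) < d := by
    rw [div_lt_iff₀ hn0]
    rw [div_lt_iff₀ hd] at hn
    linarith
  have hmem : ∀ k : ℕ, k ≤ n → (k : ℝ) / n ∈ Icc (0 : ℝ) 1 := fun k hk =>
    ⟨by positivity, by rw [div_le_one hn0]; exact_mod_cast hk⟩
  choose z hz using fun s => hg.surj (γ s)
  have main : ∀ k : ℕ, k ≤ n →
      Relation.ReflTransGen (Follow g γ η' κ δ) (a, 0) (z ((k : ℝ) / n), (k : ℝ) / n) := by
    intro k
    induction k with
    | zero =>
      intro _
      simp only [Nat.cast_zero, zero_div]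
      exact lift C0 0 (by simp) hC0 hd0 (Or.inl rfl) a (z 0) ha0 (by rw [hz]; exact hγ0)
    | succ k ih =>
      intro hk
      have h1 := hmem k (by omega)
      have h2 := hmem (k + 1) hk
      have hle : (k : ℝ) / n ≤ ((k + 1 : ℕ) : ℝ) / n := by
        gcongr; omega
      have hlen : ((k + 1 : ℕ) : ℝ) / n = (k : ℝ) / n + 1 / n := by push_cast; ring
      have hsub : Icc ((k : ℝ) / n) (((k + 1 : ℕ) : ℝ) / n) ⊆ Icc (0 : ℝ) 1 :=
        Icc_subset_Icc h1.1 h2.2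
      refine ((ih (by omega)).trans (lift (γ '' Icc ((k : ℝ) / n) (((k + 1 : ℕ) : ℝ) / n)) _ h1
        (isPreconnected_Icc.image _ (hγ.mono hsub)) ?_ (Or.inr (Or.inr ?_)) _
        (z (((k + 1 : ℕ) : ℝ) / n)) ?_ ?_)).tail
        ⟨by simpa using hδ.le, hle, h2, ?_, Or.inr (Or.inr ⟨_, by simpa using hκ.le, hz _⟩)⟩
      · rintro _ ⟨t, ht, rfl⟩
        refine (hu _ (hsub ht) _ h1 ?_).le
        rw [Real.dist_eq, abs_of_nonneg (by linarith [ht.1])]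
        linarith [ht.2]
      · rintro _ ⟨t, ht, rfl⟩
        refine ⟨t, ?_, rfl⟩
        rw [abs_of_nonneg (by linarith [ht.1])]
        linarith [ht.2]
      · rw [hz]; exact mem_image_of_mem _ (left_mem_Icc.2 hle)
      · rw [hz]; exact mem_image_of_mem _ (right_mem_Icc.2 hle)
      · rw [hz, dist_self]; exact hη'.le
  have hend := main n le_rfl
  rw [div_self hn0.ne'] at hend
  exact hend.trans (lift C1 1 (by simp) hC1 hd1 (Or.inr (Or.inl rfl)) _ b (by rw [hz]; exact hγ1) hb1)

section Cells

variable {X : Type*} [MetricSpace X] [CompactSpace X]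

/-- A singular disc in `X`, embedded on its interior. -/
structure PreCell (B : ℝ × ℝ → X) : Prop where
  cont : ContinuousOn B sq
  inj : InjOn B sqInt
  sep : ∀ p ∈ sqInt, ∀ q ∈ sq, q ∉ sqInt → B p ≠ B q
  isOpen_image : IsOpen (B '' sqInt)

namespace PreCell

variable {B : ℝ × ℝ → X}

lemma eq_of_eq (hB : PreCell B) {p q : ℝ × ℝ} (hp : p ∈ sqInt) (hq : q ∈ sq) (h : B p = B q) : p = q := by
  by_cases hq' : q ∈ sqInt
  · exact hB.inj hp hq' h
  · exact absurd h (hB.sep p hp q hq hq')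

lemma isClosed_image (hB : PreCell B) : IsClosed (B '' sq) := (isCompact_sq.image_of_continuousOn hB.cont).isClosed

lemma isOpen_image_of_isOpen (hB : PreCell B) {U : Set (ℝ × ℝ)} (hU : U ⊆ sqInt) (hUo : IsOpen U) :
    IsOpen (B '' U) := by
  have : B '' U = B '' sqInt ∩ (B '' (sq ∩ Uᶜ))ᶜ := by
    ext x
    constructor
    · rintro ⟨p, hp, rfl⟩
      refine ⟨mem_image_of_mem _ (hU hp), ?_⟩
      rintro ⟨q, hq, hqp⟩
      exact hq.2 (hB.eq_of_eq (hU hp) hq.1 hqp.symm ▸ hp)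
    · rintro ⟨⟨p, hp, rfl⟩, h⟩
      refine mem_image_of_mem _ ?_
      by_contra hpU
      exact h (mem_image_of_mem _ ⟨sqInt_subset_sq hp, hpU⟩)
  rw [this]
  refine hB.isOpen_image.inter (IsClosed.isOpen_compl (self := ?_))
  exact ((isCompact_sq.inter_right hUo.isClosed_compl).image_of_continuousOn
    (hB.cont.mono inter_subset_left)).isClosed

lemma exists_lift (hB : PreCell B) {K : Set (ℝ × ℝ)} (hK : IsCompact K) (hKs : K ⊆ sqInt) {δ' : ℝ} (hδ' : 0 < δ') :
    ∃ δ > 0, ∀ a ∈ K, ∀ x, dist (B a) x < δ → ∃ b ∈ sqInt, B b = x ∧ dist a b < δ' := by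
  obtain ⟨δ, hδ, hL⟩ := lebesgue_number_lemma_of_metric
    (hK.image_of_continuousOn (hB.cont.mono (hKs.trans sqInt_subset_sq)))
    (c := fun a : ℝ × ℝ => B '' (Metric.ball a (δ' / 2) ∩ sqInt))
    (fun a => hB.isOpen_image_of_isOpen inter_subset_right (Metric.isOpen_ball.inter isOpen_sqInt))
    (by
      rintro _ ⟨a, ha, rfl⟩
      exact mem_iUnion.2 ⟨a, mem_image_of_mem _ ⟨Metric.mem_ball_self (by linarith), hKs ha⟩⟩)
  refine ⟨δ, hδ, fun a ha x hx => ?_⟩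
  obtain ⟨i, hi⟩ := hL (B a) (mem_image_of_mem _ ha)
  obtain ⟨a', ha', haa⟩ := hi (Metric.mem_ball_self hδ)
  obtain ⟨b, hb, hbx⟩ := hi (show x ∈ Metric.ball (B a) δ by rwa [Metric.mem_ball, dist_comm])
  obtain rfl := hB.inj ha'.2 (hKs ha) haa
  refine ⟨b, hb.2, hbx, ?_⟩
  have h1 := ha'.1
  have h2 := hb.1
  rw [Metric.mem_ball] at h1 h2
  linarith [dist_triangle_right a' b i]

/-- Homeomorphisms of the square fixing its boundary descend to `X`. -/
lemma exists_descend (hB : PreCell B) (ψ : (ℝ × ℝ) ≃ₜ (ℝ × ℝ)) (hψ : ∀ p, p ∉ sqInt → ψ p = p) :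
    ∃ Ψ : X ≃ₜ X, (∀ p ∈ sq, Ψ (B p) = B (ψ p)) ∧ ∀ x, x ∉ B '' sqInt → Ψ x = x := by
  classical
  have hbasic : ∀ φ : (ℝ × ℝ) ≃ₜ (ℝ × ℝ), (∀ p, p ∉ sqInt → φ p = p) → ∃ F : X → X,
      Continuous F ∧ (∀ p ∈ sq, F (B p) = B (φ p)) ∧ ∀ x, x ∉ B '' sqInt → F x = x := by
    intro φ hφ
    set F : X → X := fun x => if h : x ∈ B '' sqInt then B (φ h.choose) else x with hF
    have hF1 : ∀ p ∈ sqInt, F (B p) = B (φ p) := by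
      intro p hp
      have h : B p ∈ B '' sqInt := mem_image_of_mem _ hp
      simp only [hF, h, dif_pos]
      rw [hB.inj h.choose_spec.1 hp h.choose_spec.2]
    have hF2 : ∀ x, x ∉ B '' sqInt → F x = x := by
      intro x hx
      simp only [hF]
      rw [dif_neg hx]
    have hF3 : ∀ p ∈ sq, F (B p) = B (φ p) := by
      intro p hp
      by_cases h : p ∈ sqInt
      · exact hF1 p h
      · rw [hφ p h, hF2]
        rintro ⟨q, hq, hqp⟩
        exact hB.sep q hq p hp h hqp
    refine ⟨F, ?_, hF3, hF2⟩
    have hmaps : MapsTo φ sq sq := fun p hp =>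
      (homeo_mem_iff hφ sqInt_subset_sq p).2 hp
    rw [← continuousOn_univ]
    have hcover : (univ : Set X) = B '' sq ∪ (B '' sqInt)ᶜ := by
      ext x
      by_cases h : x ∈ B '' sqInt
      · simp [image_mono sqInt_subset_sq h]
      · simp only [mem_univ, true_iff]; exact Or.inr h
    rw [hcover]
    refine ContinuousOn.union_of_isClosed ?_ (continuousOn_id.congr fun x hx => hF2 x hx)
      hB.isClosed_image hB.isOpen_image.isClosed_compl
    rw [continuousOn_iff_isClosed]
    intro t ht
    refine ⟨B '' (sq ∩ (fun p => B (φ p)) ⁻¹' t), ?_, ?_⟩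
    · have hc : ContinuousOn (fun p => B (φ p)) sq := hB.cont.comp φ.continuous.continuousOn hmaps
      exact ((isCompact_sq.of_isClosed_subset
        (hc.preimage_isClosed_of_isClosed isCompact_sq.isClosed ht)
        inter_subset_left).image_of_continuousOn (hB.cont.mono inter_subset_left)).isClosed
    · ext x
      constructor
      · rintro ⟨hx, p, hp, rfl⟩
        refine ⟨⟨p, ⟨hp, ?_⟩, rfl⟩, mem_image_of_mem _ hp⟩
        rw [mem_preimage, ← hF3 p hp]
        exact hx
      · rintro ⟨⟨p, ⟨hp, hpt⟩, rfl⟩, -⟩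
        refine ⟨?_, mem_image_of_mem _ hp⟩
        rw [mem_preimage, hF3 p hp]
        exact hpt
  obtain ⟨F, hFc, hF1, hF2⟩ := hbasic ψ hψ
  have hψ' : ∀ p, p ∉ sqInt → ψ.symm p = p := fun p hp => homeo_symm_support hψ p hp
  obtain ⟨G, hGc, hG1, hG2⟩ := hbasic ψ.symm hψ'
  have inv : ∀ (φ : (ℝ × ℝ) ≃ₜ (ℝ × ℝ)) (F G : X → X), (∀ p, p ∉ sqInt → φ p = p) →
      (∀ p ∈ sq, F (B p) = B (φ p)) → (∀ x, x ∉ B '' sqInt → F x = x) →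
      (∀ p ∈ sq, G (B p) = B (φ.symm p)) → (∀ x, x ∉ B '' sqInt → G x = x) →
      ∀ x, G (F x) = x := by
    intro φ F G hφ hF1 hF2 hG1 hG2 x
    by_cases hx : x ∈ B '' sqInt
    · obtain ⟨p, hp, rfl⟩ := hx
      rw [hF1 p (sqInt_subset_sq hp), hG1 _
        ((homeo_mem_iff hφ sqInt_subset_sq p).2 (sqInt_subset_sq hp)), φ.symm_apply_apply]
    · rw [hF2 x hx, hG2 x hx]
  refine ⟨⟨⟨F, G, inv ψ F G hψ hF1 hF2 hG1 hG2,
    inv ψ.symm G F hψ' hG1 hG2 (by simpa using hF1) hF2⟩, hFc, hGc⟩, hF1, hF2⟩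

end PreCell

end Cells

lemma exists_lt_dist_of_disjoint {X : Type*} [MetricSpace X] {s t : Set X} (hs : IsCompact s)
    (ht : IsClosed t) (hst : Disjoint s t) : ∃ D : ℝ, 0 < D ∧ ∀ x ∈ s, ∀ y ∈ t, D < dist x y := by
  obtain ⟨r, hr, h⟩ := Metric.exists_pos_forall_lt_edist hs ht hst
  refine ⟨r, hr, fun x hx y hy => ?_⟩
  have := h x hx y hy
  rw [edist_nndist] at this
  rw [← coe_nndist]
  exact_mod_cast this

/-- The boundary of the unit square. -/
def sqBd : Set (ℝ × ℝ) := sq ∩ sqIntᶜ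

lemma isCompact_sqBd : IsCompact sqBd := isCompact_sq.inter_right isOpen_sqInt.isClosed_compl

section

variable {X : Type*} [MetricSpace X] [CompactSpace X]

/-- Boundary points whose image is near that of `p` are joined to `p` near the fibre. -/
def NearFiber (B : ℝ × ℝ → X) (p : ℝ × ℝ) : Prop :=
  ∀ ε : ℝ, 0 < ε → ∃ η : ℝ, 0 < η ∧ ∀ r ∈ sqBd, dist (B r) (B p) ≤ η →
    ∃ C ⊆ sqBd, IsPreconnected C ∧ p ∈ C ∧ r ∈ C ∧ ∀ c ∈ C, dist (B c) (B p) ≤ ε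

/-- A singular disc whose horizontal chord is an arc with well-behaved ends. -/
structure ChordCell (B : ℝ × ℝ → X) : Prop extends PreCell B where
  chord_inj : InjOn (fun s : ℝ => B (s, 1 / 2)) (Icc 0 1)
  near_left : NearFiber B (0, 1 / 2)
  near_right : NearFiber B (1, 1 / 2)

lemma continuousOn_chord {B : ℝ × ℝ → X} (hB : ContinuousOn B sq) :
    ContinuousOn (fun s : ℝ => B (s, 1 / 2)) (Icc 0 1) :=
  hB.comp (by fun_prop) fun s hs => ⟨hs, by norm_num, by norm_num⟩

/-- A monotone map that nearly fixes the boundary of a singular disc and such that the lifts of the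
middle of the chord are inside the disc can be corrected to nearly fix the chord. -/
lemma ChordCell.exists_fix {B : ℝ × ℝ → X} (hB : ChordCell B) (hX : ULC X) {ε : ℝ} (hε : 0 < ε) :
    ∃ κ : ℝ, 0 < κ ∧ ∃ η : ℝ, 0 < η ∧ ∀ g : X → X, Mono g →
      (∀ r ∈ sqBd, dist (g (B r)) (B r) ≤ η) →
      (∀ s ∈ Icc κ (1 - κ), ∀ x, g x = B (s, 1 / 2) → x ∈ B '' sqInt) →
      ∃ Ψ : X ≃ₜ X, (∀ x, x ∉ B '' sqInt → Ψ x = x) ∧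
        ∀ s ∈ Icc (0 : ℝ) 1, dist (g (Ψ (B (s, 1 / 2)))) (B (s, 1 / 2)) ≤ ε := by
  set γ : ℝ → X := fun s : ℝ => B (s, 1 / 2) with hγdef
  have hγ : ContinuousOn γ (Icc 0 1) := continuousOn_chord hB.cont
  have hchord : ∀ s ∈ Ioo (0 : ℝ) 1, (s, (1 / 2 : ℝ)) ∈ sqInt := fun s hs =>
    ⟨hs, by norm_num, by norm_num⟩
  obtain ⟨ηr, hηr, hrep⟩ := exists_reparam hγ hB.chord_inj hε
  set e := ηr / 4 with he
  have he0 : 0 < e := by positivity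
  obtain ⟨ηp, hηp, hnp⟩ := hB.near_left e he0
  obtain ⟨ηq, hηq, hnq⟩ := hB.near_right e he0
  set m := min ηp ηq
  have hm : 0 < m := lt_min hηp hηq
  have hmp : m ≤ ηp := min_le_left _ _
  have hmq : m ≤ ηq := min_le_right _ _
  obtain ⟨d, hd, hu⟩ := exists_unif isCompact_Icc hγ (half_pos hm)
  set κ := min (1 / 5) (d / 3) with hκdef
  have hκ : 0 < κ := by positivity
  have hκ5 : κ ≤ 1 / 5 := min_le_left _ _
  have hκd : κ ≤ d / 3 := min_le_right _ _
  obtain ⟨ηs, hηs, hsep⟩ := exists_sep isCompact_Icc hγ hB.chord_inj hκ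
  have hKsub : Icc κ (1 - κ) ⊆ Icc (0 : ℝ) 1 := Icc_subset_Icc hκ.le (by linarith)
  obtain ⟨D, hD, hDist⟩ := exists_lt_dist_of_disjoint
    (isCompact_Icc.image_of_continuousOn (hγ.mono hKsub))
    (isCompact_sqBd.image_of_continuousOn (hB.cont.mono inter_subset_left)).isClosed (by
      rw [Set.disjoint_left]
      rintro _ ⟨s, hs, rfl⟩ ⟨r, hr, hrs⟩
      exact hB.sep _ (hchord s ⟨by linarith [hs.1], by linarith [hs.2]⟩) r hr.1 hr.2 hrs.symm)
  set η₁ := min (min e (m / 8)) (min (ηs / 3) (D / 3)) with hη₁def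
  have hη₁ : 0 < η₁ := by positivity
  have hη₁e : η₁ ≤ e := (min_le_left _ _).trans (min_le_left _ _)
  have hη₁m : η₁ ≤ m / 8 := (min_le_left _ _).trans (min_le_right _ _)
  have hη₁s : η₁ ≤ ηs / 3 := (min_le_right _ _).trans (min_le_left _ _)
  have hη₁D : η₁ ≤ D / 3 := (min_le_right _ _).trans (min_le_right _ _)
  obtain ⟨ηf, hηf, hfol⟩ := exists_follow hX hγ hη₁ (half_pos hκ)
  refine ⟨κ / 2, half_pos hκ, min η₁ ηf, lt_min hη₁ hηf, fun g hg hbd hmid => ?_⟩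
  have hp : ((0 : ℝ), (1 / 2 : ℝ)) ∈ sqBd := ⟨by norm_num [mem_sq], by norm_num [mem_sqInt]⟩
  have hq : ((1 : ℝ), (1 / 2 : ℝ)) ∈ sqBd := ⟨by norm_num [mem_sq], by norm_num [mem_sqInt]⟩
  have hbd₁ : ∀ r ∈ sqBd, dist (g (B r)) (B r) ≤ η₁ := fun r hr =>
    (hbd r hr).trans (min_le_left _ _)
  have hgB : ContinuousOn (fun a => g (B a)) sq := hg.cont.comp_continuousOn hB.cont
  obtain ⟨ρ', hρ', hgu⟩ := exists_unif isCompact_sq hgB hη₁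
  obtain ⟨δ₀, hδ₀, hgu'⟩ := exists_unif isCompact_univ hg.cont.continuousOn hη₁
  obtain ⟨δ', hδ', hcross⟩ := exists_crosscut (half_pos hρ')
  set ρ := min ρ' δ' / 2 with hρdef
  have hρ : 0 < ρ := by positivity
  have hρ1 : 2 * ρ ≤ ρ' := by
    have := min_le_left ρ' δ'
    linarith
  have hρ2 : 2 * ρ ≤ δ' := by
    have := min_le_right ρ' δ'
    linarith
  set K : Set (ℝ × ℝ) := sq ∩ ⋂ r ∈ sqBd, {a | ρ ≤ dist a r} with hK
  have hKc : IsCompact K := isCompact_sq.inter_right (isClosed_biInter fun r _ =>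
    isClosed_le continuous_const (by fun_prop))
  have hKi : K ⊆ sqInt := by
    intro a ha
    by_contra h
    have h1 : ρ ≤ dist a a := mem_iInter₂.1 ha.2 a ⟨ha.1, h⟩
    rw [dist_self] at h1
    linarith
  have hKn : ∀ a ∈ sq, a ∉ K → ∃ r ∈ sqBd, dist a r < ρ := by
    intro a ha haK
    by_contra hcon
    push Not at hcon
    exact haK ⟨ha, mem_iInter₂.2 fun r hr => hcon r hr⟩
  obtain ⟨δ₁, hδ₁, hlift⟩ := hB.exists_lift hKc hKi hρ
  set good : ℝ × ℝ → ℝ → Prop := fun r s =>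
    r ∈ sq ∧ s ∈ Icc (0 : ℝ) 1 ∧ dist (g (B r)) (γ s) ≤ ηr / 2 with hgood
  set Reach := Relation.ReflTransGen (SqStep good δ') ((0, 1 / 2), 0) with hReach
  have hnear : ∀ s ∈ Icc (0 : ℝ) 1, ∀ t ∈ Icc (0 : ℝ) 1, |s - t| ≤ 2 * κ →
      dist (γ s) (γ t) ≤ m / 2 := fun s hs t ht h =>
    (hu s hs t ht (by rw [Real.dist_eq]; linarith)).le
  have hstart : ∀ b ∈ K, ∀ r ∈ sqBd, ∀ s ∈ Icc (0 : ℝ) 1, dist b r < 2 * ρ →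
      dist (g (B b)) (γ s) ≤ η₁ → s ≤ 2 * κ → Reach (b, s) := by
    intro b hb r hr s hs hbr hbs hsκ
    have h1 := hgu b hb.1 r hr.1 (by linarith)
    have h2 := hnear s hs 0 (by simp) (by rw [sub_zero, abs_of_nonneg hs.1]; exact hsκ)
    have h3 : dist (B r) (γ 0) ≤ ηp := by
      have t1 := dist_triangle (B r) (g (B r)) (γ 0)
      have t2 := dist_triangle (g (B r)) (g (B b)) (γ 0)
      have t3 := dist_triangle (g (B b)) (γ s) (γ 0)
      have t4 := hbd₁ r hr
      rw [dist_comm] at t4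
      rw [dist_comm] at h1
      linarith
    obtain ⟨C, hC, hCc, hpC, hrC, hCe⟩ := hnp r hr h3
    have hch := chain_of_isPreconnected hCc hpC hrC hδ'
    have hr0 : Reach (r, 0) := by
      rw [hReach]
      refine hch.lift (fun a => (a, (0 : ℝ))) fun a c hac => ⟨⟨(hC hac.1).1, by simp, ?_⟩, (hC hac.1).1, hac.2,
        le_rfl⟩
      have t1 := dist_triangle (g (B c)) (B c) (γ 0)
      have t2 := hCe c hac.1
      have t3 := hbd₁ c (hC hac.1)
      beta_reduce
      linarith
    exact hr0.tail ⟨⟨hb.1, hs, by linarith⟩, hb.1, by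
      rw [dist_comm]; linarith, hs.1⟩
  have hend : ∀ a ∈ sq, ∀ s₀ : ℝ, ∀ b ∈ sq, ∀ r ∈ sqBd, ∀ s ∈ Icc (0 : ℝ) 1, Reach (a, s₀) →
      dist a b < ρ → dist b r < ρ → s₀ ≤ s → 1 - 2 * κ ≤ s → dist (g (B b)) (γ s) ≤ η₁ →
      Reach ((1, 1 / 2), 1) := by
    intro a ha s₀ b hb r hr s hs has hab hbr hs₀ hsκ hbs
    have h1 := hgu b hb r hr.1 (by linarith)
    have h2 := hnear s hs 1 (by simp) (by
      rw [abs_sub_comm, abs_of_nonneg (by linarith [hs.2])]; linarith)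
    have h3 : dist (B r) (γ 1) ≤ ηq := by
      have t1 := dist_triangle (B r) (g (B r)) (γ 1)
      have t2 := dist_triangle (g (B r)) (g (B b)) (γ 1)
      have t3 := dist_triangle (g (B b)) (γ s) (γ 1)
      have t4 := hbd₁ r hr
      rw [dist_comm] at t4
      rw [dist_comm] at h1
      linarith
    obtain ⟨C, hC, hCc, hqC, hrC, hCe⟩ := hnq r hr h3
    have hch := chain_of_isPreconnected hCc hrC hqC hδ'
    have hgd : ∀ c ∈ C, good c 1 := by
      intro c hc
      refine ⟨(hC hc).1, by simp, ?_⟩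
      have t1 := dist_triangle (g (B c)) (B c) (γ 1)
      have t2 := hCe c hc
      have t3 := hbd₁ c (hC hc)
      linarith
    have hr1 : Reach (r, 1) := has.tail ⟨hgd r hrC, hr.1, by
      linarith [dist_triangle a b r], hs₀.trans hs.2⟩
    exact hr1.trans (hch.lift (fun a => (a, (1 : ℝ))) fun a c hac =>
      ⟨hgd c hac.1, (hC hac.1).1, hac.2, le_rfl⟩)
  set δ := min δ₀ δ₁ / 2 with hδdef
  have hδ : 0 < δ := by positivity
  have hδ0 : δ < δ₀ := by have := min_le_left δ₀ δ₁; linarith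
  have hδ1 : δ < δ₁ := by have := min_le_right δ₀ δ₁; linarith
  have hchain := hfol g hg (B (0, 1 / 2)) (B (1, 1 / 2)) ((hbd _ hp).trans (min_le_right _ _))
    ((hbd _ hq).trans (min_le_right _ _)) δ hδ
  have hpn : ∀ r ∈ sqBd, B r ∉ B '' K := by
    rintro r hr ⟨b, hb, hbr⟩
    exact hB.sep b (hKi hb) r hr.1 hr.2 hbr
  have inv : ∀ u : X × ℝ, Relation.ReflTransGen (Follow g γ η₁ (κ / 2) δ) (B (0, 1 / 2), 0) u →
      dist (g u.1) (γ u.2) ≤ η₁ ∧ u.2 ∈ Icc (0 : ℝ) 1 ∧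
      ((u.1 ∉ B '' K ∧ u.2 < κ) ∨ (∃ b ∈ K, B b = u.1 ∧ Reach (b, u.2)) ∨
        Reach ((1, 1 / 2), 1)) := by
    intro u hu
    induction hu with
    | refl => exact ⟨hbd₁ _ hp, by simp, Or.inl ⟨hpn _ hp, hκ⟩⟩
    | @tail u v _ huv ih =>
      obtain ⟨hd1, hle, hv01, hv, hvt⟩ := huv
      obtain ⟨hu', hu01, hcase⟩ := ih
      refine ⟨hv, hv01, ?_⟩
      have hgg : dist (g u.1) (g v.1) < η₁ := hgu' _ (mem_univ _) _ (mem_univ _) (by linarith)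
      have hjump : |u.2 - v.2| < κ := by
        rw [← Real.dist_eq]
        refine hsep _ hu01 _ hv01 ?_
        have t1 := dist_triangle (γ u.2) (g u.1) (γ v.2)
        have t2 := dist_triangle (g u.1) (g v.1) (γ v.2)
        rw [dist_comm] at hu'
        linarith
      rw [abs_sub_lt_iff] at hjump
      have hmidK : v.2 ∈ Icc κ (1 - κ) → v.1 ∈ B '' K := by
        intro hvm
        obtain h | h | ⟨t, ht, htg⟩ := hvt
        · exact absurd hvm.1 (by rw [h]; linarith)
        · exact absurd hvm.2 (by rw [h]; linarith)
        rw [abs_le] at ht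
        obtain ⟨b, hb, hbv⟩ := hmid t ⟨by linarith [hvm.1], by linarith [hvm.2]⟩ v.1 htg
        refine ⟨b, ?_, hbv⟩
        by_contra hbK
        obtain ⟨r, hr, hbr⟩ := hKn b (sqInt_subset_sq hb) hbK
        have h1 := hgu b (sqInt_subset_sq hb) r hr.1 (by linarith)
        have h2 := hDist _ (mem_image_of_mem γ hvm) _ (mem_image_of_mem B hr)
        have t1 := dist_triangle (γ v.2) (g v.1) (B r)
        have t2 := dist_triangle (g (B b)) (g (B r)) (B r)
        have t3 := hbd₁ r hr
        rw [hbv] at h1 t2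
        rw [dist_comm] at hv
        linarith
      rcases hcase with ⟨huK, huκ⟩ | ⟨b, hb, hbu, hbR⟩ | h
      · by_cases hvK : v.1 ∈ B '' K
        · obtain ⟨b, hb, hbv⟩ := hvK
          refine Or.inr (Or.inl ⟨b, hb, hbv, ?_⟩)
          obtain ⟨a, ha, hau, hba⟩ := hlift b hb u.1 (by rw [hbv, dist_comm]; linarith)
          obtain ⟨r, hr, har⟩ := hKn a (sqInt_subset_sq ha) fun h => huK ⟨a, h, hau⟩
          exact hstart b hb r hr v.2 hv01 (by linarith [dist_triangle b a r])
            (by rw [hbv]; exact hv) (by linarith)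
        · refine Or.inl ⟨hvK, ?_⟩
          by_contra hvκ
          exact hvK (hmidK ⟨by linarith, by linarith⟩)
      · obtain ⟨b', hb', hbv, hbb⟩ := hlift b hb v.1 (by rw [hbu]; linarith)
        by_cases hbK : b' ∈ K
        · refine Or.inr (Or.inl ⟨b', hbK, hbv, hbR.tail
            ⟨⟨sqInt_subset_sq hb', hv01, ?_⟩, sqInt_subset_sq hb', ?_, hle⟩⟩)
          · rw [hbv]; linarith
          · linarith
        · have hvK : v.1 ∉ B '' K := by
            rintro ⟨c, hc, hcv⟩
            exact hbK (hB.inj hb' (hKi hc) (hbv.trans hcv.symm) ▸ hc)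
          by_cases hvκ : v.2 < κ
          · exact Or.inl ⟨hvK, hvκ⟩
          · have : 1 - κ < v.2 := by
              by_contra h
              exact hvK (hmidK ⟨by linarith, by linarith⟩)
            obtain ⟨r, hr, hbr⟩ := hKn b' (sqInt_subset_sq hb') hbK
            exact Or.inr (Or.inr (hend b hb.1 u.2 b' (sqInt_subset_sq hb') r hr v.2 hv01 hbR hbb hbr
              hle (by linarith) (by rw [hbv]; exact hv)))
      · exact Or.inr (Or.inr h)
  have hfinal : Reach ((1, 1 / 2), 1) := by
    obtain ⟨-, -, h | ⟨b, hb, hbq, -⟩ | h⟩ := inv _ hchain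
    · exact absurd h.2 (by linarith)
    · exact absurd ⟨b, hb, hbq⟩ (hpn _ hq)
    · exact h
  obtain ⟨ψ, τ, hψ, hτ, hψτ⟩ := hcross good
    ⟨hp.1, by simp, (hbd₁ _ hp).trans (by linarith)⟩ hfinal
  have hψsq : ∀ a, a ∈ sq → ψ a ∈ sq := fun a ha => (homeo_mem_iff hψ sqInt_subset_sq a).2 ha
  have hline : ∀ x ∈ Icc (0 : ℝ) 1, (x, (1 / 2 : ℝ)) ∈ sq := fun x hx =>
    ⟨hx, by norm_num, by norm_num⟩
  obtain ⟨φ, σ, hφ, hφσ⟩ := hrep (fun x => g (B (ψ (x, 1 / 2)))) τ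
    (hgB.comp (by fun_prop) fun x hx => hψsq _ (hline x hx)) hτ
    (fun x hx => by
      obtain ⟨r, hr, -⟩ := hψτ x hx
      exact hr.2.1)
    (fun x hx => by
      obtain ⟨r, hr, hrx⟩ := hψτ x hx
      have h1 := hgu _ (hψsq _ (hline x hx)) r hr.1 (by linarith)
      have h2 := hr.2.2
      have t1 := dist_triangle (g (B (ψ (x, 1 / 2)))) (g (B r)) (γ (τ x))
      linarith)
    (by rw [hψ _ hp.2]; exact (hbd₁ _ hp).trans (by linarith))
    (by rw [hψ _ hq.2]; exact (hbd₁ _ hq).trans (by linarith))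
  obtain ⟨Ψ, hΨ, hΨi⟩ := hB.exists_descend (φ.trans ψ) (fun p hp => by
    rw [Homeomorph.trans_apply, hφ p hp, hψ p hp])
  refine ⟨Ψ, hΨi, fun s hs => ?_⟩
  obtain ⟨-, h1, h2⟩ := hφσ s hs
  rw [hΨ _ (hline s hs), Homeomorph.trans_apply, h1]
  exact h2

end

section

variable {X : Type*} [MetricSpace X] [CompactSpace X]

lemma exists_mem_of_dist_le {B : ℝ × ℝ → X} (hB : ContinuousOn B sq) (p : ℝ × ℝ)
    {U : Set (ℝ × ℝ)} (hU : IsOpen U) (h : ∀ r ∈ sqBd, B r = B p → r ∈ U) :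
    ∃ η : ℝ, 0 < η ∧ ∀ r ∈ sqBd, dist (B r) (B p) ≤ η → r ∈ U := by
  have hc : IsCompact (B '' (sqBd ∩ Uᶜ)) :=
    (isCompact_sqBd.inter_right hU.isClosed_compl).image_of_continuousOn
      (hB.mono (inter_subset_left.trans inter_subset_left))
  obtain ⟨D, hD, hd⟩ := exists_lt_dist_of_disjoint hc (isClosed_singleton (x := B p)) (by
    rw [Set.disjoint_singleton_right]
    rintro ⟨r, hr, hrp⟩
    exact hr.2 (h r hr.1 hrp))
  refine ⟨D, hD, fun r hr hrD => ?_⟩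
  by_contra hrU
  exact absurd (hd _ (mem_image_of_mem B ⟨hr, hrU⟩) _ rfl) (not_lt.2 hrD)

lemma nearFiber_left {B : ℝ × ℝ → X} (hB : ContinuousOn B sq)
    (h : ∀ r ∈ sqBd, B r = B (0, 1 / 2) →
      r.1 = 0 ∧ (r.2 = 1 / 2 ∨ ∀ y ∈ Icc (0 : ℝ) 1, B (0, y) = B (0, 1 / 2))) :
    NearFiber B (0, 1 / 2) := by
  intro ε hε
  obtain ⟨d, hd, hu⟩ := exists_unif isCompact_sq hB hε
  have hp : ((0 : ℝ), (1 / 2 : ℝ)) ∈ sq := by norm_num [mem_sq]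
  by_cases hcol : ∀ y ∈ Icc (0 : ℝ) 1, B (0, y) = B (0, 1 / 2)
  · obtain ⟨η, hη, hηr⟩ := exists_mem_of_dist_le hB (0, 1 / 2)
      (U := {r | r.1 < min d 1}) (isOpen_lt continuous_fst continuous_const)
      (fun r hr hrp => by
        rw [mem_ofPred_eq, (h r hr hrp).1]
        positivity)
    refine ⟨η, hη, fun r hr hrη => ?_⟩
    have hrd := hηr r hr hrη
    rw [mem_ofPred_eq, lt_min_iff] at hrd
    have hrs := mem_sq.1 hr.1
    obtain ⟨⟨hr0, hr1⟩, hr2, hr3⟩ := hrs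
    set S₁ : Set (ℝ × ℝ) := {(0 : ℝ)} ×ˢ Icc (0 : ℝ) 1
    set S₂ : Set (ℝ × ℝ) := Icc (0 : ℝ) r.1 ×ˢ {(0 : ℝ)}
    set S₃ : Set (ℝ × ℝ) := Icc (0 : ℝ) r.1 ×ˢ {(1 : ℝ)}
    have hS₁ : IsPreconnected S₁ := isPreconnected_singleton.prod isPreconnected_Icc
    have hS₂ : IsPreconnected S₂ := isPreconnected_Icc.prod isPreconnected_singleton
    have hS₃ : IsPreconnected S₃ := isPreconnected_Icc.prod isPreconnected_singleton
    have hmem : ∀ c ∈ S₁ ∪ S₂ ∪ S₃, c ∈ sqBd ∧ c.1 ≤ r.1 := by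
      rintro ⟨x, y⟩ hc
      simp only [S₁, S₂, S₃, mem_union, mem_prod, mem_singleton_iff, mem_Icc] at hc
      simp only [sqBd, mem_inter_iff, mem_compl_iff, mem_sq, mem_sqInt]
      grind
    refine ⟨S₁ ∪ S₂ ∪ S₃, fun c hc => (hmem c hc).1, ?_, ?_, ?_, fun c hc => ?_⟩
    · refine IsPreconnected.union (0, 1) ?_ ?_ (IsPreconnected.union (0, 0) ?_ ?_ hS₁ hS₂) hS₃
      · exact Or.inl (by simp [S₁])
      · simp [S₃, hr0]
      · simp [S₁]
      · simp [S₂, hr0]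
    · exact Or.inl (Or.inl (by norm_num [S₁]))
    · have := hr.2
      obtain ⟨x, y⟩ := r
      simp only [S₁, S₂, S₃, mem_union, mem_prod, mem_singleton_iff, mem_Icc, mem_compl_iff,
        mem_sqInt] at *
      grind
    · obtain ⟨h1, h2⟩ := hmem c hc
      have h3 := mem_sq.1 h1.1
      rw [← hcol c.2 h3.2]
      refine (hu c h1.1 (0, c.2) ⟨by simp, h3.2⟩ ?_).le
      rw [Prod.dist_eq, dist_self, Real.dist_eq, sub_zero, abs_of_nonneg h3.1.1]
      simp only [max_lt_iff]
      exact ⟨by linarith, hd⟩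
  · obtain ⟨η, hη, hηr⟩ := exists_mem_of_dist_le hB (0, 1 / 2)
      (U := Metric.ball (0, 1 / 2) (min d (1 / 2))) Metric.isOpen_ball
      (fun r hr hrp => by
        obtain ⟨h1, h2 | h2⟩ := h r hr hrp
        · have : r = (0, 1 / 2) := Prod.ext h1 h2
          rw [this]
          exact Metric.mem_ball_self (by positivity)
        · exact absurd h2 hcol)
    refine ⟨η, hη, fun r hr hrη => ?_⟩
    have hrd := hηr r hr hrη
    rw [Metric.mem_ball, lt_min_iff, Prod.dist_eq, max_lt_iff, max_lt_iff, Real.dist_eq,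
      Real.dist_eq] at hrd
    obtain ⟨⟨h1, h2⟩, h3, h4⟩ := hrd
    have hr0 : r.1 = 0 := by
      have h5 := mem_sq.1 hr.1
      have h6 : ¬ _ := fun h => hr.2 (mem_sqInt.2 h)
      simp only [abs_lt] at h3 h4
      grind
    set b := |r.2 - 1 / 2|
    have hb : 0 ≤ b := abs_nonneg _
    have hCbd : ({(0 : ℝ)} ×ˢ Icc (1 / 2 - b) (1 / 2 + b) : Set (ℝ × ℝ)) ⊆ sqBd := by
      rintro ⟨x, y⟩ ⟨hx, hy⟩
      simp only [mem_singleton_iff, mem_Icc] at hx hy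
      simp only [sqBd, mem_inter_iff, mem_compl_iff, mem_sq, mem_sqInt]
      grind
    refine ⟨_, hCbd, isPreconnected_singleton.prod isPreconnected_Icc,
      ⟨rfl, by constructor <;> linarith⟩, ⟨hr0, ?_⟩, fun c hc => ?_⟩
    · have := abs_le.1 (le_refl b)
      constructor <;> linarith
    · refine (hu c (hCbd hc).1 _ hp ?_).le
      have hc1 : c.1 = 0 := hc.1
      have hc2 := hc.2
      rw [Prod.dist_eq, max_lt_iff, hc1, dist_self, Real.dist_eq]
      refine ⟨hd, lt_of_le_of_lt ?_ h2⟩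
      rw [abs_le]
      constructor <;> linarith [hc2.1, hc2.2]

lemma nearFiber_right {B : ℝ × ℝ → X} (hB : ContinuousOn B sq)
    (h : ∀ r ∈ sqBd, B r = B (1, 1 / 2) →
      r.1 = 1 ∧ (r.2 = 1 / 2 ∨ ∀ y ∈ Icc (0 : ℝ) 1, B (1, y) = B (1, 1 / 2))) :
    NearFiber B (1, 1 / 2) := by
  set fl : ℝ × ℝ → ℝ × ℝ := fun p => (1 - p.1, p.2) with hfl
  have hflc : Continuous fl := by fun_prop
  have hff : ∀ p, fl (fl p) = p := fun p => by simp [hfl]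
  have hsq : ∀ p, p ∈ sq → fl p ∈ sq := by
    intro p hp
    simp only [mem_sq, hfl, mem_Icc] at *
    grind
  have hbd : ∀ p, p ∈ sqBd → fl p ∈ sqBd := by
    rintro p ⟨hp, hp'⟩
    refine ⟨hsq p hp, fun h => hp' ?_⟩
    simp only [mem_sqInt, hfl, mem_Ioo] at *
    grind
  have key := nearFiber_left (B := fun p => B (fl p)) (hB.comp hflc.continuousOn hsq) (by
    intro r hr hrp
    simp only [hfl, sub_zero] at hrp ⊢
    obtain ⟨h1, h2⟩ := h (fl r) (hbd r hr) hrp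
    refine ⟨?_, h2⟩
    simp only [hfl] at h1
    linarith)
  intro ε hε
  obtain ⟨η, hη, hk⟩ := key ε hε
  refine ⟨η, hη, fun r hr hrη => ?_⟩
  have h0 : fl (0, 1 / 2) = (1, 1 / 2) := by simp [hfl]
  simp only [h0] at hk
  obtain ⟨C, hC, hCc, h1, h2, h3⟩ := hk (fl r) (hbd r hr) (by rw [hff]; exact hrη)
  refine ⟨fl '' C, ?_, hCc.image _ hflc.continuousOn, ⟨_, h1, h0⟩, ⟨_, h2, hff r⟩, ?_⟩
  · rintro _ ⟨c, hc, rfl⟩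
    exact hbd c (hC hc)
  · rintro _ ⟨c, hc, rfl⟩
    exact h3 c hc

/-- A monotone map that nearly fixes the frontier of a region and some point of a connected set
outside the region keeps the region off that connected set. -/
lemma exists_avoid (hX : ULC X) {R I C : Set X} (hR : IsClosed R) (hI : IsOpen I)
    (hIR : I ⊆ R) (hC : IsCompact C) (hCc : IsPreconnected C) (hdisj : Disjoint C (R ∩ Iᶜ)) {w : X} (hw : w ∈ C)
    (hwI : w ∉ I) :
    ∃ η : ℝ, 0 < η ∧ ∀ g : X → X, Mono g → dist (g w) w ≤ η →
      (∀ x ∈ R, x ∉ I → dist (g x) x ≤ η) → ∀ x ∈ R, ∀ c ∈ C, η < dist (g x) c := by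
  obtain ⟨D, hD, hdist⟩ := exists_lt_dist_of_disjoint hC (hR.inter hI.isClosed_compl) hdisj
  obtain ⟨η, hη, hu⟩ := hX (D / 2) (half_pos hD)
  refine ⟨min η (D / 2), by positivity, fun g hg hgw hgR x hx c hc => ?_⟩
  by_contra hcon
  push Not at hcon
  obtain ⟨C₁, hC₁, h1x, h1c, h1d⟩ := hu _ _ (hcon.trans (min_le_left _ _))
  obtain ⟨C₂, hC₂, h2w, h2w', h2d⟩ := hu _ _ (hgw.trans (min_le_left _ _))
  have hT : IsPreconnected (C ∪ C₁ ∪ C₂) :=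
    IsPreconnected.union w (Or.inl hw) h2w' (IsPreconnected.union c hc h1c hCc hC₁) hC₂
  have hTd : ∀ t ∈ C ∪ C₁ ∪ C₂, ∃ c' ∈ C, dist t c' ≤ D / 2 := by
    rintro t ((ht | ht) | ht)
    · exact ⟨t, ht, by rw [dist_self]; linarith⟩
    · exact ⟨c, hc, h1d t ht⟩
    · exact ⟨w, hw, h2d t ht⟩
  have hno : ∀ z, g z ∈ C ∪ C₁ ∪ C₂ → z ∈ R → z ∈ I := by
    intro z hz hzR
    by_contra hzI
    obtain ⟨c', hc', hd⟩ := hTd _ hz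
    have h1 := hdist c' hc' z ⟨hzR, hzI⟩
    have h2 := (hgR z hzR hzI).trans (min_le_right _ _)
    linarith [dist_triangle_left c' z (g z)]
  have hgx : g x ∈ C ∪ C₁ ∪ C₂ := Or.inl (Or.inr h1x)
  have hgw' : g w ∈ C ∪ C₁ ∪ C₂ := Or.inr h2w
  have hwR : w ∉ R := fun h => hwI (hno w hgw' h)
  obtain ⟨z, hz, hzI, hzR⟩ := hg.preimage hT I (Rᶜ) hI hR.isOpen_compl
    (fun z hz => by
      by_cases h : z ∈ R
      · exact Or.inl (hno z hz h)
      · exact Or.inr h)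
    ⟨x, hgx, hno x hgx hx⟩ ⟨w, hgw', hwR⟩
  exact hzR (hIR hzI)

/-- `g` is close to the identity near the frontier of the region `R` with interior `I`, and
nearly respects the region and its complement. -/
def NearOn (η : ℝ) (R I : Set X) (g : X → X) : Prop :=
  (∀ x ∈ R, x ∉ I → dist (g x) x ≤ η) ∧ (∀ x, x ∉ I → ∃ z, z ∉ I ∧ dist (g x) z ≤ η) ∧
    ∀ x ∈ R, ∃ z ∈ R, dist (g x) z ≤ η

lemma NearOn.mono {η η' : ℝ} {R I : Set X} {g : X → X} (h : NearOn η R I g) (hη : η ≤ η') :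
    NearOn η' R I g := by
  refine ⟨fun x hx hx' => (h.1 x hx hx').trans hη, fun x hx => ?_, fun x hx => ?_⟩
  · obtain ⟨z, hz, hd⟩ := h.2.1 x hx
    exact ⟨z, hz, hd.trans hη⟩
  · obtain ⟨z, hz, hd⟩ := h.2.2 x hx
    exact ⟨z, hz, hd.trans hη⟩

/-- Monotone maps behaving well at the frontier of the region `R` can be corrected inside it to be
`ε`-close to the identity. -/
def Fixable (ε : ℝ) (R I : Set X) : Prop :=
  ∃ η : ℝ, 0 < η ∧ ∀ g : X → X, Mono g → NearOn η R I g →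
    ∃ Ψ : X ≃ₜ X, (∀ x, x ∉ I → Ψ x = x) ∧ ∀ x ∈ R, dist (g (Ψ x)) x ≤ ε

lemma fixable_of_small {ε : ℝ} (hε : 0 < ε) {R I : Set X}
    (h : ∀ x ∈ R, ∀ y ∈ R, dist x y ≤ ε / 2) : Fixable ε R I := by
  refine ⟨ε / 2, half_pos hε, fun g _ hg => ⟨Homeomorph.refl X, fun _ _ => rfl, fun x hx => ?_⟩⟩
  obtain ⟨z, hz, hd⟩ := hg.2.2 x hx
  have := h z hz x hx
  rw [Homeomorph.refl_apply, id]
  linarith [dist_triangle (g x) z x]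

lemma exists_fix_family {ι : Type*} {ε : ℝ} {R I : ι → Set X} (hIR : ∀ i, I i ⊆ R i)
    (hdisj : ∀ i j, i ≠ j → Disjoint (I i) (R j)) (s : Finset ι)
    (h : ∀ i ∈ s, Fixable ε (R i) (I i)) :
    ∃ η : ℝ, 0 < η ∧ ∀ g : X → X, Mono g → (∀ i ∈ s, NearOn η (R i) (I i) g) →
      ∃ Ψ : X ≃ₜ X, (∀ x, (∀ i ∈ s, x ∉ I i) → Ψ x = x) ∧
        ∀ i ∈ s, ∀ x ∈ R i, dist (g (Ψ x)) x ≤ ε := by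
  classical
  induction s using Finset.induction_on with
  | empty => exact ⟨1, one_pos, fun g _ _ => ⟨Homeomorph.refl X, fun _ _ => rfl, by simp⟩⟩
  | insert a s has ih =>
    obtain ⟨η, hη, hs⟩ := ih fun i hi => h i (Finset.mem_insert_of_mem hi)
    obtain ⟨η', hη', ha⟩ := h a (Finset.mem_insert_self a s)
    refine ⟨min η η', lt_min hη hη', fun g hg hn => ?_⟩
    obtain ⟨Ψ, hΨ, hΨe⟩ := hs g hg fun i hi =>
      (hn i (Finset.mem_insert_of_mem hi)).mono (min_le_left _ _)
    have hna := (hn a (Finset.mem_insert_self a s)).mono (min_le_right _ _)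
    have hfix : ∀ x ∈ R a, Ψ x = x := fun x hx => hΨ x fun i hi hxi =>
      Set.disjoint_left.1 (hdisj i a (fun h => has (h ▸ hi))) hxi hx
    obtain ⟨Φ, hΦ, hΦe⟩ := ha _ (hg.comp_homeomorph Ψ) ⟨fun x hx hx' => by
        beta_reduce
        rw [hfix x hx]
        exact hna.1 x hx hx', fun x hx => hna.2.1 (Ψ x) fun hx' => hx (by
          have : Ψ (Ψ x) = Ψ x := hfix _ (hIR a hx')
          rwa [Ψ.injective this] at hx'), fun x hx => by
        beta_reduce
        rw [hfix x hx]
        exact hna.2.2 x hx⟩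
    refine ⟨Φ.trans Ψ, fun x hx => ?_, fun i hi x hx => ?_⟩
    · rw [Homeomorph.trans_apply, hΦ x (hx a (Finset.mem_insert_self a s)),
        hΨ x fun i hi => hx i (Finset.mem_insert_of_mem hi)]
    · rw [Homeomorph.trans_apply]
      rcases Finset.mem_insert.1 hi with rfl | hi
      · exact hΦe x hx
      · rw [hΦ x fun hx' => Set.disjoint_left.1 (hdisj a i fun h => has (h ▸ hi)) hx' hx]
        exact hΨe i hi x hx

/-- A region whose complement is the image of a convex set is nearly respected. -/
lemma exists_respect (hX : ULC X) {B : ℝ × ℝ → X} (hB : ContinuousOn B sq) {R I : Set X}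
    (hR : IsClosed R) (hI : IsOpen I) (hIR : I ⊆ R) (hconv : Convex ℝ (sq ∩ {q | B q ∉ R}))
    {w : ℝ × ℝ} (hw : w ∈ sq) (hwR : B w ∉ R) {η' : ℝ} (hη' : 0 < η') :
    ∃ η : ℝ, 0 < η ∧ ∀ g : X → X, Mono g → dist (g (B w)) (B w) ≤ η →
      (∀ x ∈ R, x ∉ I → dist (g x) x ≤ η) → (∀ x ∈ R, ∃ z ∈ B '' sq, dist (g x) z ≤ η) →
      ∀ x ∈ R, ∃ z ∈ R, dist (g x) z ≤ η' := by
  set K : Set (ℝ × ℝ) := sq ∩ B ⁻¹' {x | η' / 2 ≤ Metric.infDist x R} with hK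
  have hKc : IsCompact K := isCompact_sq.of_isClosed_subset
    (hB.preimage_isClosed_of_isClosed isCompact_sq.isClosed
      (isClosed_le continuous_const (Metric.continuous_infDist_pt R))) inter_subset_left
  set H : Set (ℝ × ℝ) :=
    (fun p : ℝ × (ℝ × ℝ) => w + p.1 • (p.2 - w)) '' (Icc (0 : ℝ) 1 ×ˢ insert w K) with hH
  have hHc : IsCompact H := (isCompact_Icc.prod (hKc.insert w)).image (by fun_prop)
  have hseg : ∀ k ∈ insert w K, segment ℝ w k ⊆ H := by
    intro k hk
    rw [segment_eq_image']
    rintro _ ⟨θ, hθ, rfl⟩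
    exact ⟨(θ, k), ⟨hθ, hk⟩, rfl⟩
  have hsub : insert w K ⊆ H := fun k hk => hseg k hk (right_mem_segment ℝ w k)
  have hHp : IsPreconnected H := by
    refine isPreconnected_of_forall w fun y hy => ?_
    obtain ⟨⟨θ, k⟩, ⟨hθ, hk⟩, rfl⟩ := hy
    refine ⟨segment ℝ w k, hseg k hk, left_mem_segment ℝ w k, ?_,
      (convex_segment w k).isPreconnected⟩
    rw [segment_eq_image']
    exact ⟨θ, hθ, rfl⟩
  have hHG : H ⊆ sq ∩ {q | B q ∉ R} := by
    have hins : insert w K ⊆ sq ∩ {q | B q ∉ R} := by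
      refine insert_subset ⟨hw, hwR⟩ fun q hq => ⟨hq.1, fun hqR => ?_⟩
      have h1 : η' / 2 ≤ Metric.infDist (B q) R := hq.2
      rw [Metric.infDist_zero_of_mem hqR] at h1
      linarith
    rintro _ ⟨⟨θ, k⟩, ⟨hθ, hk⟩, rfl⟩
    refine hconv.segment_subset ⟨hw, hwR⟩ (hins hk) ?_
    rw [segment_eq_image']
    exact ⟨θ, hθ, rfl⟩
  have hHs : H ⊆ sq := hHG.trans inter_subset_left
  obtain ⟨η, hη, hav⟩ := exists_avoid hX hR hI hIR (hHc.image_of_continuousOn (hB.mono hHs))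
    (hHp.image _ (hB.mono hHs))
    (by
      rw [Set.disjoint_left]
      rintro _ ⟨q, hq, rfl⟩ hqR
      exact (hHG hq).2 hqR.1)
    (w := B w) (mem_image_of_mem _ (hsub (mem_insert _ _)))
    fun h => hwR (hIR h)
  refine ⟨min η (η' / 2), by positivity, fun g hg hgw hgR hgB x hx => ?_⟩
  have hA := hav g hg (hgw.trans (min_le_left _ _))
    (fun x hx hx' => (hgR x hx hx').trans (min_le_left _ _)) x hx
  obtain ⟨_, ⟨q, hq, rfl⟩, hd⟩ := hgB x hx
  by_cases hqK : η' / 2 ≤ Metric.infDist (B q) R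
  · have := hA (B q) (mem_image_of_mem _ (hsub (mem_insert_of_mem _ ⟨hq, hqK⟩)))
    linarith [min_le_left η (η' / 2)]
  · rw [not_le, Metric.infDist_lt_iff ⟨x, hx⟩] at hqK
    obtain ⟨z, hz, hqz⟩ := hqK
    exact ⟨z, hz, by linarith [dist_triangle (g x) (B q) z, min_le_right η (η' / 2)]⟩

end

/-- The two closed halves of the unit interval. -/
def halfC (b : Bool) : Set ℝ := if b then Icc (1 / 2) 1 else Icc 0 (1 / 2)

/-- The two open halves of the unit interval. -/
def halfO (b : Bool) : Set ℝ := if b then Ioo (1 / 2) 1 else Ioo 0 (1 / 2)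

lemma halfO_subset (b : Bool) : halfO b ⊆ halfC b := by
  cases b <;> simp only [halfO, halfC] <;> simpa using Ioo_subset_Icc_self

lemma halfC_subset (b : Bool) : halfC b ⊆ Icc 0 1 := by
  cases b <;> simp only [halfC] <;> simp <;> refine Icc_subset_Icc ?_ ?_ <;> norm_num

lemma halfO_subset_Ioo (b : Bool) : halfO b ⊆ Ioo 0 1 := by
  cases b <;> simp only [halfO] <;> simp <;> refine Ioo_subset_Ioo ?_ ?_ <;> norm_num

lemma isOpen_halfO (b : Bool) : IsOpen (halfO b) := by
  cases b <;> simp only [halfO] <;> exact isOpen_Ioo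

lemma isCompact_halfC (b : Bool) : IsCompact (halfC b) := by
  cases b <;> simp only [halfC] <;> exact isCompact_Icc

lemma halfO_disjoint {b c : Bool} (h : b ≠ c) {y : ℝ} (hy : y ∈ halfO b) : y ∉ halfC c := by
  cases b <;> cases c <;> simp [halfO, halfC] at * <;> grind

lemma exists_mem_halfC {y : ℝ} (hy : y ∈ Icc (0 : ℝ) 1) : ∃ b, y ∈ halfC b := by
  rcases le_total y (1 / 2) with h | h
  · exact ⟨false, by simpa [halfC] using ⟨hy.1, by simpa using h⟩⟩
  · exact ⟨true, by simpa [halfC] using ⟨by simpa using h, hy.2⟩⟩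

lemma mem_halfO_or {b : Bool} {y : ℝ} (hy : y ∈ halfC b) (hy' : y ∈ Ioo (0 : ℝ) 1) :
    y ∈ halfO b ∨ y = 1 / 2 := by
  cases b <;> simp [halfO, halfC] at * <;> grind

lemma mem_halfO_or_not {b : Bool} {y : ℝ} (hy : y ∈ Ioo (0 : ℝ) 1) :
    y ∈ halfO b ∨ y ∈ halfC (!b) := by
  cases b <;> simp [halfO, halfC] at * <;> grind

lemma convex_compl_halfC (b : Bool) {x y s t : ℝ} (hx : x ∈ Icc (0 : ℝ) 1)
    (hy : y ∈ Icc (0 : ℝ) 1) (hx' : x ∉ halfC b) (hy' : y ∉ halfC b) (hs : 0 ≤ s) (ht : 0 ≤ t)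
    (hst : s + t = 1) : s * x + t * y ∉ halfC b := by
  obtain rfl : s = 1 - t := by linarith
  cases b <;> simp [halfC] at *
  · have h1 := hx' hx.1
    have h2 := hy' hy.1
    intro _
    rcases ht.lt_or_eq with h | h
    · nlinarith [mul_pos h (sub_pos.2 h2), mul_nonneg (sub_nonneg.2 hs) (sub_pos.2 h1).le]
    · rw [← h]; linarith
  · intro h
    exfalso
    have h1 : x < 1 / 2 := by
      by_contra h
      linarith [hx' (by linarith), hx.2]
    have h2 : y < 1 / 2 := by
      by_contra h
      linarith [hy' (by linarith), hy.2]
    rcases ht.lt_or_eq with h' | h'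
    · nlinarith [mul_pos h' (sub_pos.2 h2), mul_nonneg (sub_nonneg.2 hs) (sub_pos.2 h1).le]
    · rw [← h'] at h; linarith

section

variable {X : Type*} [MetricSpace X] [CompactSpace X]

/-- If both halves of a singular disc are fixable, so is the disc. -/
lemma ChordCell.fixable_of_halves (hX : ULC X) {B : ℝ × ℝ → X} (hB : ChordCell B) {ε : ℝ}
    (hconv : ∀ b, Convex ℝ (sq ∩ {q | B q ∉ B '' (Icc 0 1 ×ˢ halfC b)}))
    (hw : ∀ b, ∃ w ∈ sqBd, B w ∉ B '' (Icc 0 1 ×ˢ halfC b))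
    (h : ∀ b, Fixable ε (B '' (Icc 0 1 ×ˢ halfC b)) (B '' (Ioo 0 1 ×ˢ halfO b))) :
    Fixable ε (B '' sq) (B '' sqInt) := by
  set R : Bool → Set X := fun b => B '' (Icc 0 1 ×ˢ halfC b) with hR
  set I : Bool → Set X := fun b => B '' (Ioo 0 1 ×ˢ halfO b) with hI
  have hOi : ∀ b, (Ioo (0 : ℝ) 1 ×ˢ halfO b : Set (ℝ × ℝ)) ⊆ sqInt := fun b =>
    prod_mono le_rfl (halfO_subset_Ioo b)
  have hCs : ∀ b, (Icc (0 : ℝ) 1 ×ˢ halfC b : Set (ℝ × ℝ)) ⊆ sq := fun b =>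
    prod_mono le_rfl (halfC_subset b)
  have hIR : ∀ b, I b ⊆ R b := fun b => image_mono (prod_mono Ioo_subset_Icc_self (halfO_subset b))
  have hIo : ∀ b, IsOpen (I b) := fun b =>
    hB.isOpen_image_of_isOpen (hOi b) (isOpen_Ioo.prod (isOpen_halfO b))
  have hRc : ∀ b, IsClosed (R b) := fun b =>
    ((isCompact_Icc.prod (isCompact_halfC b)).image_of_continuousOn (hB.cont.mono (hCs b))).isClosed
  have hII : ∀ b, I b ⊆ B '' sqInt := fun b => image_mono (hOi b)
  have hRR : ∀ b, R b ⊆ B '' sq := fun b => image_mono (hCs b)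
  have hdisj : ∀ b c, b ≠ c → Disjoint (I b) (R c) := by
    intro b c hbc
    rw [Set.disjoint_left]
    rintro _ ⟨p, hp, rfl⟩ ⟨q, hq, hqp⟩
    obtain rfl := hB.eq_of_eq (hOi b hp) (hCs c hq) hqp.symm
    exact halfO_disjoint hbc hp.2 hq.2
  have hIsq : B '' sqInt ⊆ B '' sq := image_mono sqInt_subset_sq
  have hbdI : ∀ r ∈ sqBd, B r ∉ B '' sqInt := by
    rintro r hr ⟨p, hp, hpr⟩
    exact hB.sep p hp r hr.1 hr.2 hpr
  obtain ⟨η₀, hη₀, hfam⟩ := exists_fix_family hIR hdisj Finset.univ fun b _ => h b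
  have hres : ∀ b, ∃ η : ℝ, 0 < η ∧ ∀ g : X → X, Mono g →
      (∀ r ∈ sqBd, dist (g (B r)) (B r) ≤ η) →
      (∀ x ∈ R b, x ∉ I b → dist (g x) x ≤ η) → (∀ x ∈ R b, ∃ z ∈ B '' sq, dist (g x) z ≤ η) →
      ∀ x ∈ R b, ∃ z ∈ R b, dist (g x) z ≤ η₀ := by
    intro b
    obtain ⟨w, hw1, hw2⟩ := hw b
    obtain ⟨η, hη, hr⟩ := exists_respect hX hB.cont (hRc b) (hIo b) (hIR b) (hconv b) hw1.1 hw2 hη₀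
    exact ⟨η, hη, fun g hg h1 h2 h3 => hr g hg (h1 w hw1) h2 h3⟩
  choose ηr hηr hresp using hres
  set m := min η₀ (min (ηr false) (ηr true)) with hmdef
  have hm : 0 < m := lt_min hη₀ (lt_min (hηr _) (hηr _))
  have hm0 : m ≤ η₀ := min_le_left _ _
  have hmr : ∀ b, m ≤ ηr b := by
    intro b
    cases b
    · exact (min_le_right _ _).trans (min_le_left _ _)
    · exact (min_le_right _ _).trans (min_le_right _ _)
  obtain ⟨κ, hκ, ηY, hηY, hfix⟩ := hB.exists_fix hX hm
  obtain ⟨D, hD, hdist⟩ := exists_lt_dist_of_disjoint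
    (isCompact_Icc.image_of_continuousOn
      ((continuousOn_chord hB.cont).mono (Icc_subset_Icc hκ.le (by linarith : 1 - κ ≤ 1))))
    hB.isOpen_image.isClosed_compl (by
      rw [Set.disjoint_left]
      rintro _ ⟨s, hs, rfl⟩ h
      exact h (mem_image_of_mem _ ⟨⟨by linarith [hs.1], by linarith [hs.2]⟩, by norm_num,
        by norm_num⟩))
  refine ⟨min m (min ηY D), by positivity, fun g hg hn => ?_⟩
  set η := min m (min ηY D)
  have hηm : η ≤ m := min_le_left _ _
  have hηy : η ≤ ηY := (min_le_right _ _).trans (min_le_left _ _)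
  have hηD : η ≤ D := (min_le_right _ _).trans (min_le_right _ _)
  have hbd : ∀ r ∈ sqBd, dist (g (B r)) (B r) ≤ η := fun r hr =>
    hn.1 _ (mem_image_of_mem _ hr.1) (hbdI r hr)
  obtain ⟨Ψ, hΨ, hΨe⟩ := hfix g hg (fun r hr => (hbd r hr).trans hηy) (fun s hs x hx => by
    by_contra hxI
    obtain ⟨z, hz, hd⟩ := hn.2.1 x hxI
    have := hdist _ (mem_image_of_mem _ hs) z hz
    rw [hx] at hd
    linarith)
  have hΨR : ∀ x, x ∈ B '' sq → Ψ x ∈ B '' sq := fun x hx => (homeo_mem_iff hΨ hIsq x).2 hx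
  set g' : X → X := fun x => g (Ψ x) with hg'
  have hfront : ∀ b, ∀ x ∈ R b, x ∉ I b → dist (g' x) x ≤ m := by
    rintro b _ ⟨a, ha, rfl⟩ haI
    by_cases hai : a ∈ sqInt
    · have hai' := mem_sqInt.1 hai
      rcases mem_halfO_or ha.2 hai'.2 with h1 | h1
      · exact absurd ⟨a, ⟨hai'.1, h1⟩, rfl⟩ haI
      · have := hΨe a.1 ha.1
        rwa [← h1] at this
    · have hab : a ∈ sqBd := ⟨hCs b ha, hai⟩
      simp only [hg']
      rw [hΨ _ (hbdI a hab)]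
      exact (hbd a hab).trans hηm
  have hin : ∀ b, ∀ x ∈ R b, ∃ z ∈ R b, dist (g' x) z ≤ η₀ := by
    intro b
    refine hresp b g' (hg.comp_homeomorph Ψ) (fun r hr => ?_)
      (fun x hx hx' => (hfront b x hx hx').trans (hmr b)) fun x hx => ?_
    · simp only [hg']
      rw [hΨ _ (hbdI r hr)]
      exact (hbd r hr).trans (hηm.trans (hmr b))
    · obtain ⟨z, hz, hd⟩ := hn.2.2 (Ψ x) (hΨR x (hRR b hx))
      exact ⟨z, hz, hd.trans (hηm.trans (hmr b))⟩
  obtain ⟨Φ, hΦ, hΦe⟩ := hfam g' (hg.comp_homeomorph Ψ) (fun b _ =>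
    ⟨fun x hx hx' => (hfront b x hx hx').trans hm0, fun x hx => by
      by_cases hx2 : x ∈ R (!b)
      · obtain ⟨z, hz, hd⟩ := hin (!b) x hx2
        exact ⟨z, fun hz' => Set.disjoint_left.1 (hdisj b (!b) (by simp)) hz' hz, hd⟩
      · have hxI : x ∉ B '' sqInt := by
          rintro ⟨p, hp, rfl⟩
          rcases mem_halfO_or_not (b := b) hp.2 with h1 | h1
          · exact hx (mem_image_of_mem _ ⟨hp.1, h1⟩)
          · exact hx2 (mem_image_of_mem _ ⟨(mem_sq.1 (sqInt_subset_sq hp)).1, h1⟩)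
        obtain ⟨z, hz, hd⟩ := hn.2.1 x hxI
        refine ⟨z, fun h => hz (hII b h), ?_⟩
        simp only [hg']
        rw [hΨ x hxI]
        linarith, hin b⟩)
  refine ⟨Φ.trans Ψ, fun x hx => ?_, fun x hx => ?_⟩
  · rw [Homeomorph.trans_apply, hΦ x fun b _ h => hx (hII b h), hΨ x hx]
  · obtain ⟨a, ha, rfl⟩ := hx
    obtain ⟨b, hb⟩ := exists_mem_halfC (mem_sq.1 ha).2
    exact hΦe b (Finset.mem_univ b) _ (mem_image_of_mem _ ⟨(mem_sq.1 ha).1, hb⟩)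

end

section

variable {X : Type*} [MetricSpace X] [CompactSpace X]

/-- A disc in `X`, embedded except that the vertical sides may be collapsed to points. -/
structure Cell (A : ℝ × ℝ → X) : Prop where
  cont : ContinuousOn A sq
  isOpen_image : IsOpen (A '' sqInt)
  inj : ∀ a ∈ sq, ∀ b ∈ sq, A a = A b → a.1 = b.1 ∧
    (a.2 = b.2 ∨ ((a.1 = 0 ∨ a.1 = 1) ∧ ∀ y ∈ Icc (0 : ℝ) 1, A (a.1, y) = A a))

namespace Cell

variable {A : ℝ × ℝ → X}

lemma toPreCell (hA : Cell A) : PreCell A := by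
  have key : ∀ p ∈ sqInt, ∀ q ∈ sq, A p = A q → p = q := by
    intro p hp q hq h
    obtain ⟨h1, h2 | ⟨h2 | h2, -⟩⟩ := hA.inj p (sqInt_subset_sq hp) q hq h
    · exact Prod.ext h1 h2
    · exact absurd h2 hp.1.1.ne'
    · exact absurd h2 hp.1.2.ne
  exact ⟨hA.cont, fun p hp q hq h => key p hp q (sqInt_subset_sq hq) h,
    fun p hp q hq hq' h => hq' (key p hp q hq h ▸ hp), hA.isOpen_image⟩

lemma near_aux (hA : Cell A) {v : ℝ} (hv : v ∈ Icc (0 : ℝ) 1) (r : ℝ × ℝ) (hr : r ∈ sqBd)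
    (h : A r = A (v, 1 / 2)) :
    r.1 = v ∧ (r.2 = 1 / 2 ∨ ∀ y ∈ Icc (0 : ℝ) 1, A (v, y) = A (v, 1 / 2)) := by
  obtain ⟨h1, h2⟩ := hA.inj r hr.1 (v, 1 / 2) ⟨hv, by norm_num, by norm_num⟩ h
  refine ⟨h1, h2.imp_right fun h2 y hy => ?_⟩
  have := h2.2 y hy
  rw [h1] at this
  exact this.trans h

lemma toChordCell (hA : Cell A) : ChordCell A where
  toPreCell := hA.toPreCell
  chord_inj := fun s hs t ht h =>
    (hA.inj (s, 1 / 2) ⟨hs, by norm_num, by norm_num⟩ (t, 1 / 2) ⟨ht, by norm_num, by norm_num⟩ h).1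
  near_left := nearFiber_left hA.cont (hA.near_aux (by simp))
  near_right := nearFiber_right hA.cont (hA.near_aux (by simp))

lemma swap_image (S T : Set ℝ) : (fun p : ℝ × ℝ => A p.swap) '' (S ×ˢ T) = A '' (T ×ˢ S) := by
  have : (fun p : ℝ × ℝ => A p.swap) = A ∘ Prod.swap := rfl
  rw [this, image_comp, image_swap_prod]

lemma swap_toChordCell (hA : Cell A) : ChordCell fun p => A p.swap := by
  have hsw : ∀ p, p ∈ sq → p.swap ∈ sq := fun p hp => ⟨hp.2, hp.1⟩
  have hswi : ∀ p, p ∈ sqInt → p.swap ∈ sqInt := fun p hp => ⟨hp.2, hp.1⟩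
  have hc : ContinuousOn (fun p : ℝ × ℝ => A p.swap) sq :=
    hA.cont.comp continuous_swap.continuousOn hsw
  have hP := hA.toPreCell
  have haux : ∀ (v : ℝ), v ∈ Icc (0 : ℝ) 1 → ∀ r ∈ sqBd, A r.swap = A (v, (1 / 2 : ℝ)).swap →
      r.1 = v ∧ r.2 = 1 / 2 := by
    intro v hv r hr h
    obtain ⟨h1, h2 | ⟨h2, -⟩⟩ := hA.inj r.swap (hsw r hr.1) (v, (1 / 2 : ℝ)).swap
      ⟨⟨by norm_num, by norm_num⟩, hv⟩ h
    · exact ⟨h2, h1⟩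
    · rw [h1] at h2
      norm_num at h2
  refine ⟨⟨hc, fun p hp q hq h => ?_, fun p hp q hq hq' h => ?_, ?_⟩, fun s hs t ht h => ?_,
    nearFiber_left hc fun r hr h => ?_, nearFiber_right hc fun r hr h => ?_⟩
  · exact Prod.swap_injective (hP.inj (hswi p hp) (hswi q hq) h)
  · exact hP.sep p.swap (hswi p hp) q.swap (hsw q hq) (fun h => hq' (hswi _ h)) h
  · have : (fun p : ℝ × ℝ => A p.swap) '' sqInt = A '' sqInt := swap_image _ _
    rw [this]
    exact hA.isOpen_image
  · obtain ⟨-, h1 | ⟨h1, -⟩⟩ := hA.inj (1 / 2, s) ⟨⟨by norm_num, by norm_num⟩, hs⟩ (1 / 2, t)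
      ⟨⟨by norm_num, by norm_num⟩, ht⟩ h
    · exact h1
    · norm_num at h1
  · exact (haux 0 (by simp) r hr h).imp_right Or.inl
  · exact (haux 1 (by simp) r hr h).imp_right Or.inl

lemma convex_compl (hA : Cell A) (b : Bool) :
    Convex ℝ (sq ∩ {q | A q ∉ A '' (Icc 0 1 ×ˢ halfC b)}) := by
  rintro p ⟨hp, hp'⟩ q ⟨hq, hq'⟩ s t hs ht hst
  have hsqc : Convex ℝ sq := (convex_Icc 0 1).prod (convex_Icc 0 1)
  have hmem := hsqc hp hq hs ht hst
  refine ⟨hmem, ?_⟩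
  rintro ⟨c, hc, hcA⟩
  have hp2 : p.2 ∉ halfC b := fun h => hp' (mem_image_of_mem A ⟨hp.1, h⟩)
  have hq2 : q.2 ∉ halfC b := fun h => hq' (mem_image_of_mem A ⟨hq.1, h⟩)
  obtain ⟨h1, h2 | ⟨h2, h3⟩⟩ := hA.inj _ hmem c ⟨hc.1, halfC_subset b hc.2⟩ hcA.symm
  · refine convex_compl_halfC b hp.2 hq.2 hp2 hq2 hs ht hst ?_
    have : (s • p + t • q).2 = s * p.2 + t * q.2 := rfl
    rw [← this, h2]
    exact hc.2
  · have h4 : (s • p + t • q).1 = s * p.1 + t * q.1 := rfl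
    have hex : p.1 = (s • p + t • q).1 ∨ q.1 = (s • p + t • q).1 := by
      rw [h4] at h2 ⊢
      have hp1 := hp.1
      have hq1 := hq.1
      obtain rfl : s = 1 - t := by linarith
      rcases hs.lt_or_eq with hs' | hs'
      · left
        rcases h2 with h2 | h2
        · rw [h2]
          nlinarith [mul_nonneg ht hq1.1, hp1.1]
        · rw [h2]
          nlinarith [mul_nonneg ht (sub_nonneg.2 hq1.2), hp1.2]
      · right
        rw [← hs', show t = 1 by linarith]
        ring
    rcases hex with h | h
    · refine hp' ⟨c, hc, ?_⟩
      rw [hcA, ← h3 p.2 hp.2, ← h]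
    · refine hq' ⟨c, hc, ?_⟩
      rw [hcA, ← h3 q.2 hq.2, ← h]

lemma swap_convex_compl (hA : Cell A) (b : Bool) :
    Convex ℝ (sq ∩ {q : ℝ × ℝ | A q.swap ∉ (fun p : ℝ × ℝ => A p.swap) '' (Icc 0 1 ×ˢ halfC b)}) := by
  rintro p ⟨hp, hp'⟩ q ⟨hq, hq'⟩ s t hs ht hst
  have hsqc : Convex ℝ sq := (convex_Icc 0 1).prod (convex_Icc 0 1)
  have hmem := hsqc hp hq hs ht hst
  refine ⟨hmem, ?_⟩
  rintro ⟨c, hc, hcA⟩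
  have hp2 : p.2 ∉ halfC b := fun h =>
    hp' (mem_image_of_mem (fun p : ℝ × ℝ => A p.swap) ⟨hp.1, h⟩)
  have hq2 : q.2 ∉ halfC b := fun h =>
    hq' (mem_image_of_mem (fun p : ℝ × ℝ => A p.swap) ⟨hq.1, h⟩)
  have h1 := (hA.inj c.swap ⟨halfC_subset b hc.2, hc.1⟩ _ ⟨hmem.2, hmem.1⟩ hcA).1
  refine convex_compl_halfC b hp.2 hq.2 hp2 hq2 hs ht hst ?_
  have : (s • p + t • q).2 = s * p.2 + t * q.2 := rfl
  rw [← this]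
  have h2 : c.2 = (s • p + t • q).2 := h1
  rw [← h2]
  exact hc.2

lemma exists_not_mem (hA : Cell A) (b : Bool) :
    ∃ w ∈ sqBd, A w ∉ A '' (Icc 0 1 ×ˢ halfC b) := by
  have key : ∀ v ∈ Icc (0 : ℝ) 1, v ∉ halfC b → A (1 / 2, v) ∉ A '' (Icc 0 1 ×ˢ halfC b) := by
    rintro v hv hvb ⟨c, hc, hcv⟩
    obtain ⟨h1, h2 | ⟨h2, -⟩⟩ := hA.inj c ⟨hc.1, halfC_subset b hc.2⟩ (1 / 2, v)
      ⟨⟨by norm_num, by norm_num⟩, hv⟩ hcv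
    · have h3 : c.2 = v := h2
      exact hvb (h3 ▸ hc.2)
    · rw [h1] at h2
      norm_num at h2
  cases b
  · exact ⟨(1 / 2, 1), ⟨by norm_num [mem_sq], by norm_num [mem_sqInt]⟩,
      key 1 (by simp) (by norm_num [halfC])⟩
  · exact ⟨(1 / 2, 0), ⟨by norm_num [mem_sq], by norm_num [mem_sqInt]⟩,
      key 0 (by simp) (by norm_num [halfC])⟩

lemma swap_exists_not_mem (hA : Cell A) (b : Bool) :
    ∃ w ∈ sqBd, A w.swap ∉ (fun p : ℝ × ℝ => A p.swap) '' (Icc 0 1 ×ˢ halfC b) := by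
  have key : ∀ v ∈ Icc (0 : ℝ) 1, v ∉ halfC b →
      A (v, 1 / 2) ∉ (fun p : ℝ × ℝ => A p.swap) '' (Icc 0 1 ×ˢ halfC b) := by
    rintro v hv hvb ⟨c, hc, hcv⟩
    have h1 := (hA.inj c.swap ⟨halfC_subset b hc.2, hc.1⟩ (v, 1 / 2)
      ⟨hv, by norm_num, by norm_num⟩ hcv).1
    have h3 : c.2 = v := h1
    exact hvb (h3 ▸ hc.2)
  cases b
  · exact ⟨(1 / 2, 1), ⟨by norm_num [mem_sq], by norm_num [mem_sqInt]⟩,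
      key 1 (by simp) (by norm_num [halfC])⟩
  · exact ⟨(1 / 2, 0), ⟨by norm_num [mem_sq], by norm_num [mem_sqInt]⟩,
      key 0 (by simp) (by norm_num [halfC])⟩

end Cell

/-- The affine parametrisation of the rectangle `[a, b] × [c, d]`. -/
def rectMap (a b c d : ℝ) (p : ℝ × ℝ) : ℝ × ℝ := (a + (b - a) * p.1, c + (d - c) * p.2)

lemma continuous_rectMap (a b c d : ℝ) : Continuous (rectMap a b c d) := by
  unfold rectMap
  fun_prop

lemma rectMap_image_sq {a b c d : ℝ} (hab : a < b) (hcd : c < d) :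
    rectMap a b c d '' sq = Icc a b ×ˢ Icc c d := by
  have h1 : (fun t => a + (b - a) * t) '' Icc 0 1 = Icc a b := by
    have h := image_affine_Icc' (sub_pos.2 hab) a 0 1
    have h2 : (fun t => a + (b - a) * t) = fun x => (b - a) * x + a := by ext; ring
    rw [h2, h]
    congr 1 <;> ring
  have h1' : (fun t => c + (d - c) * t) '' Icc 0 1 = Icc c d := by
    have h := image_affine_Icc' (sub_pos.2 hcd) c 0 1
    have h2 : (fun t => c + (d - c) * t) = fun x => (d - c) * x + c := by ext; ring
    rw [h2, h]
    congr 1 <;> ring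
  rw [← h1, ← h1', ← Set.prodMap_image_prod]
  rfl

lemma rectMap_image_sqInt {a b c d : ℝ} (hab : a < b) (hcd : c < d) :
    rectMap a b c d '' sqInt = Ioo a b ×ˢ Ioo c d := by
  have h1 : (fun t => a + (b - a) * t) '' Ioo 0 1 = Ioo a b := by
    have h := image_affine_Ioo (sub_pos.2 hab) a 0 1
    have h2 : (fun t => a + (b - a) * t) = fun x => (b - a) * x + a := by ext; ring
    rw [h2, h]
    congr 1 <;> ring
  have h1' : (fun t => c + (d - c) * t) '' Ioo 0 1 = Ioo c d := by
    have h := image_affine_Ioo (sub_pos.2 hcd) c 0 1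
    have h2 : (fun t => c + (d - c) * t) = fun x => (d - c) * x + c := by ext; ring
    rw [h2, h]
    congr 1 <;> ring
  rw [← h1, ← h1', ← Set.prodMap_image_prod]
  rfl

lemma Cell.comp_rectMap {A : ℝ × ℝ → X} (hA : Cell A) {a b c d : ℝ} (ha : 0 ≤ a) (hab : a < b)
    (hb : b ≤ 1) (hc : 0 ≤ c) (hcd : c < d) (hd : d ≤ 1) : Cell fun p => A (rectMap a b c d p) := by
  have hsub : Icc a b ×ˢ Icc c d ⊆ sq := prod_mono (Icc_subset_Icc ha hb) (Icc_subset_Icc hc hd)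
  have hm : ∀ p ∈ sq, rectMap a b c d p ∈ sq := fun p hp =>
    hsub (rectMap_image_sq hab hcd ▸ mem_image_of_mem _ hp)
  refine ⟨hA.cont.comp (continuous_rectMap a b c d).continuousOn hm, ?_, fun p hp q hq h => ?_⟩
  · have : (fun p => A (rectMap a b c d p)) '' sqInt = A '' (Ioo a b ×ˢ Ioo c d) := by
      rw [← rectMap_image_sqInt hab hcd, image_image]
    rw [this]
    exact hA.toPreCell.isOpen_image_of_isOpen
      (prod_mono (Ioo_subset_Ioo ha hb) (Ioo_subset_Ioo hc hd)) (isOpen_Ioo.prod isOpen_Ioo)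
  · obtain ⟨h1, h2⟩ := hA.inj _ (hm p hp) _ (hm q hq) h
    simp only [rectMap] at h1 h2 ⊢
    have hp1 := hp.1
    have hab' := sub_pos.2 hab
    refine ⟨mul_left_cancel₀ hab'.ne' (add_left_cancel h1), h2.imp (fun h2 =>
      mul_left_cancel₀ (sub_pos.2 hcd).ne' (add_left_cancel h2)) fun h2 => ⟨?_, fun y hy => ?_⟩⟩
    · refine h2.1.imp (fun h => ?_) fun h => ?_
      · nlinarith [mul_nonneg hab'.le hp1.1, hp1.1]
      · nlinarith [mul_nonneg hab'.le (sub_nonneg.2 hp1.2), hp1.2]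
    · refine h2.2 _ ?_
      exact ⟨by nlinarith [hy.1], by nlinarith [hy.2]⟩

lemma Cell.fixable_aux (hX : ULC X) {ε : ℝ} (hε : 0 < ε) (k : ℕ) : ∀ A : ℝ × ℝ → X, Cell A →
    (∀ p ∈ sq, ∀ q ∈ sq, |p.1 - q.1| ≤ (1 / 2) ^ k → |p.2 - q.2| ≤ (1 / 2) ^ k →
      dist (A p) (A q) ≤ ε / 2) → Fixable ε (A '' sq) (A '' sqInt) := by
  induction k with
  | zero =>
    intro A _ h
    refine fixable_of_small hε ?_
    rintro _ ⟨p, hp, rfl⟩ _ ⟨q, hq, rfl⟩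
    have hp' := mem_sq.1 hp
    have hq' := mem_sq.1 hq
    refine h p hp q hq ?_ ?_ <;> rw [pow_zero, abs_le] <;> constructor <;> grind
  | succ k ih =>
    intro A hA h
    have hhalf : ∀ b : Bool, ∃ u v : ℝ, 0 ≤ u ∧ u < v ∧ v ≤ 1 ∧ v - u = 1 / 2 ∧
        halfC b = Icc u v ∧ halfO b = Ioo u v := by
      intro b
      cases b
      · exact ⟨0, 1 / 2, by norm_num, by norm_num, by norm_num, by norm_num, by simp [halfC],
          by simp [halfO]⟩
      · exact ⟨1 / 2, 1, by norm_num, by norm_num, by norm_num, by norm_num, by simp [halfC],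
          by simp [halfO]⟩
    refine hA.toChordCell.fixable_of_halves hX hA.convex_compl hA.exists_not_mem fun b => ?_
    obtain ⟨c, d, hc, hcd, hd, hdc, hbC, hbO⟩ := hhalf b
    have hA₁ := hA.comp_rectMap le_rfl one_pos le_rfl hc hcd hd
    rw [hbC, hbO, ← rectMap_image_sq one_pos hcd, ← rectMap_image_sqInt one_pos hcd, image_image,
      image_image]
    set A₁ : ℝ × ℝ → X := fun p => A (rectMap 0 1 c d p) with hA₁def
    have hsw := hA₁.swap_toChordCell.fixable_of_halves hX (ε := ε) hA₁.swap_convex_compl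
      hA₁.swap_exists_not_mem fun b' => by
        obtain ⟨u, v, hu, huv, hv, hvu, hbC', hbO'⟩ := hhalf b'
        rw [Cell.swap_image, Cell.swap_image, hbC', hbO', ← rectMap_image_sq huv one_pos,
          ← rectMap_image_sqInt huv one_pos, image_image, image_image]
        refine ih _ (hA₁.comp_rectMap hu huv hv le_rfl one_pos le_rfl) fun p hp q hq h1 h2 => ?_
        have hm : ∀ p ∈ sq, rectMap 0 1 c d (rectMap u v 0 1 p) ∈ sq := by
          intro p hp
          have hp' := mem_sq.1 hp
          simp only [rectMap, mem_sq]
          refine ⟨⟨?_, ?_⟩, ?_, ?_⟩ <;> nlinarith [hp'.1.1, hp'.1.2, hp'.2.1, hp'.2.2]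
        refine h _ (hm p hp) _ (hm q hq) ?_ ?_
        · simp only [rectMap, hvu, sub_zero, one_mul, zero_add]
          rw [show u + 1 / 2 * p.1 - (u + 1 / 2 * q.1) = 1 / 2 * (p.1 - q.1) by ring, abs_mul,
            abs_of_pos (by norm_num : (0 : ℝ) < 1 / 2), pow_succ]
          linarith
        · simp only [rectMap, hdc, sub_zero, one_mul, zero_add]
          rw [show c + 1 / 2 * p.2 - (c + 1 / 2 * q.2) = 1 / 2 * (p.2 - q.2) by ring, abs_mul,
            abs_of_pos (by norm_num : (0 : ℝ) < 1 / 2), pow_succ]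
          linarith
    have e1 : (fun p : ℝ × ℝ => A₁ p.swap) '' sq = A₁ '' sq := Cell.swap_image _ _
    have e2 : (fun p : ℝ × ℝ => A₁ p.swap) '' sqInt = A₁ '' sqInt := Cell.swap_image _ _
    rwa [e1, e2] at hsw

/-- Every cell is fixable. -/
theorem Cell.fixable (hX : ULC X) {A : ℝ × ℝ → X} (hA : Cell A) {ε : ℝ} (hε : 0 < ε) :
    Fixable ε (A '' sq) (A '' sqInt) := by
  obtain ⟨d, hd, hu⟩ := exists_unif isCompact_sq hA.cont (half_pos hε)
  obtain ⟨k, hk⟩ := exists_pow_lt_of_lt_one hd (by norm_num : (1 / 2 : ℝ) < 1)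
  refine Cell.fixable_aux hX hε k A hA fun p hp q hq h1 h2 => (hu p hp q hq ?_).le
  rw [Prod.dist_eq, Real.dist_eq, Real.dist_eq, max_lt_iff]
  exact ⟨by linarith, by linarith⟩

end

lemma exists_induced_seq {α : Type*} {R : α → α → Prop} {a b : α}
    (h : Relation.ReflTransGen R a b) :
    ∃ (M : ℕ) (f : ℕ → α), f 0 = a ∧ f M = b ∧ (∀ i < M, R (f i) (f (i + 1))) ∧
      ∀ i j, i + 2 ≤ j → j ≤ M → ¬ R (f i) (f j) := by
  classical
  have hex := exists_seq_of_reflTransGen h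
  obtain ⟨f, h0, hM, hf⟩ := Nat.find_spec hex
  refine ⟨Nat.find hex, f, h0, hM, hf, fun i j hij hj hR => ?_⟩
  refine Nat.find_min hex (m := Nat.find hex - (j - i - 1)) (by omega)
    ⟨fun m => if m ≤ i then f m else f (m + (j - i - 1)), by simpa using h0, ?_, fun m hm => ?_⟩
  · beta_reduce
    rw [if_neg (by omega)]
    refine Eq.trans (congrArg f ?_) hM
    omega
  · beta_reduce
    rcases lt_trichotomy m i with h1 | h1 | h1
    · rw [if_pos h1.le, if_pos (by omega)]
      exact hf m (by omega)
    · rw [if_pos h1.le, if_neg (by omega), h1, show i + 1 + (j - i - 1) = j by omega]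
      exact hR
    · rw [if_neg (by omega), if_neg (by omega), show m + 1 + (j - i - 1) = m + (j - i - 1) + 1 by omega]
      exact hf _ (by omega)

section

variable {E : Type*} [NormedAddCommGroup E] [NormedSpace ℝ E]

open AffineMap

lemma lipschitz_bump (c : E) {r : ℝ} (hr : 0 < r) (w : E) :
    LipschitzWith (‖w‖ / r).toNNReal fun p => max 0 (1 - dist p c / r) • w := by
  refine LipschitzWith.of_dist_le_mul fun p q => ?_
  rw [Real.coe_toNNReal _ (by positivity), dist_eq_norm, ← sub_smul, norm_smul, Real.norm_eq_abs]
  have h1 : |max 0 (1 - dist p c / r) - max 0 (1 - dist q c / r)| ≤ dist p q / r := by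
    refine (abs_max_sub_max_le_max _ _ _ _).trans ?_
    rw [sub_self, abs_zero, max_eq_right (abs_nonneg _),
      show 1 - dist p c / r - (1 - dist q c / r) = (dist q c - dist p c) / r by ring, abs_div,
      abs_of_pos hr]
    gcongr
    rw [dist_comm p q]
    exact abs_dist_sub_le q p c
  calc _ ≤ dist p q / r * ‖w‖ := by gcongr
    _ = _ := by ring

lemma dist_lineMap_le {b a c : E} {r s : ℝ} (hb : dist b c ≤ r) (ha : dist a c ≤ r)
    (hs : s ∈ Icc (0 : ℝ) 1) : dist (lineMap b a s : E) c ≤ r := by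
  have h := (convex_closedBall c r).lineMap_mem (Metric.mem_closedBall.2 hb)
    (Metric.mem_closedBall.2 ha) hs
  exact Metric.mem_closedBall.1 h

lemma exists_entry {b a c : E} {r : ℝ} (hb : r ≤ dist b c) (ha : dist a c < r) :
    ∃ s : ℝ, 0 ≤ s ∧ s < 1 ∧ dist (lineMap b a s : E) c = r ∧
      ∀ u ∈ Icc 0 s, r ≤ dist (lineMap b a u : E) c := by
  have hcont : Continuous fun s : ℝ => dist (lineMap b a s : E) c :=
    (lineMap_continuous (R := ℝ)).dist continuous_const
  obtain ⟨s, hs, hsr⟩ := intermediate_value_Icc' (zero_le_one' ℝ) hcont.continuousOn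
    (⟨by simpa using ha.le, by simpa using hb⟩ : r ∈ Icc _ _)
  beta_reduce at hsr
  have hs1 : s < 1 := by
    refine lt_of_le_of_ne hs.2 fun h => ?_
    rw [h, lineMap_apply_one] at hsr
    exact ha.ne hsr
  refine ⟨s, hs.1, hs1, hsr, fun u hu => ?_⟩
  by_contra! h
  rcases hu.2.eq_or_lt with rfl | hus
  · exact h.ne hsr
  have h1 := (convex_ball c r).lineMap_mem (Metric.mem_ball.2 h) (Metric.mem_ball.2 ha)
    (t := (s - u) / (1 - u))
    ⟨div_nonneg (by linarith) (by linarith), (div_le_one (by linarith)).2 (by linarith)⟩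
  have h2 : (lineMap (lineMap b a u : E) a ((s - u) / (1 - u)) : E) = lineMap b a s := by
    have : (1 - u) ≠ 0 := by linarith
    rw [lineMap_apply_module, lineMap_apply_module, lineMap_apply_module, smul_add, smul_smul,
      smul_smul, add_assoc, ← add_smul]
    congr 2 <;> field_simp <;> ring
  rw [h2, Metric.mem_ball, hsr] at h1
  exact lt_irrefl _ h1

variable [CompleteSpace E]

lemma exists_recenter {c b a : E} {r : ℝ} (hb : dist b c = r) (ha : dist a c < r) :
    ∃ S : E ≃ₜ E, (∀ p, p ∉ Metric.ball c r → S p = p) ∧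
      ∀ s ∈ Icc (0 : ℝ) 1, S (lineMap b c s) = lineMap b a s := by
  have hr : 0 < r := dist_nonneg.trans_lt ha
  obtain ⟨S, hS⟩ := exists_homeomorph_add (K := (‖a - c‖ / r).toNNReal) (by
    rw [← NNReal.coe_lt_coe, Real.coe_toNNReal _ (by positivity), NNReal.coe_one, div_lt_one hr,
      ← dist_eq_norm]
    exact ha) (lipschitz_bump c hr (a - c))
  refine ⟨S, fun p hp => ?_, fun s hs => ?_⟩
  · rw [Metric.mem_ball, not_lt] at hp
    rw [hS, max_eq_left (by rw [sub_nonpos, one_le_div hr]; exact hp), zero_smul, add_zero]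
  · have h1 : dist (lineMap b c s : E) c = (1 - s) * r := by
      rw [dist_lineMap_right, hb, Real.norm_eq_abs, abs_of_nonneg (by linarith [hs.2])]
    rw [hS, h1, mul_div_cancel_right₀ _ hr.ne', sub_sub_cancel, max_eq_right hs.1,
      lineMap_apply_module', lineMap_apply_module', add_right_comm, ← smul_add]
    congr 2
    abel

lemma exists_move_tip {c b a a' : E} {r : ℝ} (hb : dist b c = r) (ha : dist a c < r)
    (ha' : dist a' c < r) :
    ∃ S : E ≃ₜ E, (∀ p, p ∉ Metric.ball c r → S p = p) ∧
      ∀ s ∈ Icc (0 : ℝ) 1, S (lineMap b a s) = lineMap b a' s := by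
  obtain ⟨S, hS, hS'⟩ := exists_recenter hb ha
  obtain ⟨T, hT, hT'⟩ := exists_recenter hb ha'
  refine ⟨S.symm.trans T, fun p hp => ?_, fun s hs => ?_⟩
  · rw [Homeomorph.trans_apply, homeo_symm_support hS p hp, hT p hp]
  · rw [Homeomorph.trans_apply, ← hS' s hs, S.symm_apply_apply, hT' s hs]

/-- The state of the growing arc after it has been pushed through the first `j` balls. -/
structure ArcState (c : ℕ → E) (r : ℝ) (L : ℕ) (σ : ℝ → E) (j : ℕ) (ψ : E ≃ₜ E) (x : ℝ)
    (lam : ℝ → ℕ) (b a : E) : Prop where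
  nonneg : 0 ≤ x
  lt_one : x < 1
  base : dist b (c j) = r
  tip : dist a (c j) < r
  segment : ∀ t ∈ Icc x 1, ψ (σ t) = lineMap b a ((t - x) / (1 - x))
  mono : MonotoneOn lam (Icc 0 1)
  zero : lam 0 = 0
  late : ∀ t, x < t → lam t = j
  early : ∀ t ∈ Icc 0 x, lam t ≤ j ∧ dist (ψ (σ t)) (c (lam t)) ≤ r
  avoid : ∀ t ∈ Icc 0 x, ∀ i, j ≤ i → i ≤ L → r ≤ dist (ψ (σ t)) (c i)

lemma ArcState.step {c : ℕ → E} {r : ℝ} {L : ℕ} {σ : ℝ → E} {j : ℕ} {ψ : E ≃ₜ E} {x : ℝ}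
    {lam : ℝ → ℕ} {b a : E} (h : ArcState c r L σ j ψ x lam b a) (hjL : j < L)
    (hstep : dist (c j) (c (j + 1)) < 2 * r)
    (hfar : ∀ i, j + 2 ≤ i → i ≤ L → 2 * r ≤ dist (c j) (c i)) :
    ∃ ψ' x' lam' b' a', ArcState c r L σ (j + 1) ψ' x' lam' b' a' := by
  have hx1 : 0 < 1 - x := sub_pos.2 h.lt_one
  set m := midpoint ℝ (c j) (c (j + 1)) with hm
  have hm1 : dist m (c j) < r := by
    rw [hm, dist_midpoint_left, Real.norm_eq_abs, abs_of_pos (by norm_num : (0 : ℝ) < 2)]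
    linarith
  have hm2 : dist m (c (j + 1)) < r := by
    rw [hm, dist_midpoint_right, Real.norm_eq_abs, abs_of_pos (by norm_num : (0 : ℝ) < 2)]
    linarith
  obtain ⟨S, hS, hS'⟩ := exists_move_tip h.base h.tip hm1
  have hxb : ψ (σ x) = b := by
    rw [h.segment x ⟨le_rfl, h.lt_one.le⟩, sub_self, zero_div, lineMap_apply_zero]
  have hb1 : r ≤ dist b (c (j + 1)) := by
    rw [← hxb]
    exact h.avoid x ⟨h.nonneg, le_rfl⟩ _ (by omega) (by omega)
  obtain ⟨s, hs0, hs1, hsr, hsav⟩ := exists_entry hb1 hm2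
  have hold : ∀ t ∈ Icc 0 x, S (ψ (σ t)) = ψ (σ t) := fun t ht =>
    hS _ fun hb => (Metric.mem_ball.1 hb).not_ge (h.avoid t ht j le_rfl hjL.le)
  have hdiv : ∀ t ∈ Icc x 1, (t - x) / (1 - x) ∈ Icc (0 : ℝ) 1 := fun t ht =>
    ⟨div_nonneg (by linarith [ht.1]) hx1.le, (div_le_one hx1).2 (by linarith [ht.2])⟩
  have hnew : ∀ t ∈ Icc x 1, S (ψ (σ t)) = lineMap b m ((t - x) / (1 - x)) := fun t ht => by
    rw [h.segment t ht, hS' _ (hdiv t ht)]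
  have hxx : x ≤ x + s * (1 - x) := by nlinarith
  have hx'1 : x + s * (1 - x) < 1 := by nlinarith
  refine ⟨ψ.trans S, x + s * (1 - x), fun t => if t ≤ x + s * (1 - x) then lam t else j + 1,
    lineMap b m s, m, ⟨h.nonneg.trans hxx, hx'1, hsr, hm2, fun t ht => ?_, fun t ht u hu htu => ?_,
      ?_, fun t ht => if_neg ht.not_ge, fun t ht => ?_, fun t ht i hi hiL => ?_⟩⟩
  · rw [Homeomorph.trans_apply, hnew t ⟨hxx.trans ht.1, ht.2⟩]
    have h1 : (1 - s) ≠ 0 := by linarith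
    have h2 : 1 - (x + s * (1 - x)) = (1 - s) * (1 - x) := by ring
    rw [h2, lineMap_apply_module, lineMap_apply_module, lineMap_apply_module, smul_add, smul_smul,
      smul_smul, add_assoc, ← add_smul]
    congr 2 <;> field_simp <;> ring
  · have hle : ∀ t ∈ Icc (0 : ℝ) 1, lam t ≤ j := fun t ht => by
      rcases le_or_gt t x with h1 | h1
      · exact (h.early t ⟨ht.1, h1⟩).1
      · exact (h.late t h1).le
    split_ifs with h1 h2 h2
    · exact h.mono ht hu htu
    · exact (hle t ht).trans (Nat.le_succ j)
    · exact absurd (htu.trans h2) h1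
    · exact le_rfl
  · rw [if_pos (h.nonneg.trans hxx), h.zero]
  · rw [Homeomorph.trans_apply]
    rw [if_pos ht.2]
    rcases le_or_gt t x with h1 | h1
    · rw [hold t ⟨ht.1, h1⟩]
      exact ⟨(h.early t ⟨ht.1, h1⟩).1.trans (Nat.le_succ j), (h.early t ⟨ht.1, h1⟩).2⟩
    · have h1' : t ∈ Icc x 1 := ⟨h1.le, ht.2.trans hx'1.le⟩
      rw [h.late t h1, hnew t h1']
      exact ⟨Nat.le_succ j, dist_lineMap_le h.base.le hm1.le (hdiv t h1')⟩
  · rw [Homeomorph.trans_apply]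
    rcases le_or_gt t x with h1 | h1
    · rw [hold t ⟨ht.1, h1⟩]
      exact h.avoid t ⟨ht.1, h1⟩ i (by omega) hiL
    · have h1' : t ∈ Icc x 1 := ⟨h1.le, ht.2.trans hx'1.le⟩
      rw [hnew t h1']
      rcases hi.eq_or_lt with rfl | hi
      · exact hsav _ ⟨(hdiv t h1').1, (div_le_iff₀ hx1).2 (by linarith [ht.2])⟩
      · have h2 := dist_lineMap_le h.base.le hm1.le (hdiv t h1')
        have h3 := hfar i hi hiL
        have h4 := dist_triangle_left (c j) (c i) (lineMap b m ((t - x) / (1 - x)) : E)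
        linarith

/-- A straight segment can be moved by a homeomorphism so that it follows a given labelled chain. -/
theorem exists_free_arc {p q : E} (hpq : p ≠ q) {r : ℝ} (hr : 0 < r) {good : E → ℝ → Prop}
    {a b : E} (ha : good a 0)
    (hc : Relation.ReflTransGen (fun u v : E × ℝ => dist u.1 v.1 < 2 * r ∧ u.2 ≤ v.2 ∧
      good v.1 v.2) (a, 0) (b, 1)) :
    ∃ ψ : E ≃ₜ E, ∃ τ : ℝ → ℝ, MonotoneOn τ (Icc 0 1) ∧ τ 0 = 0 ∧ τ 1 = 1 ∧
      ∀ t ∈ Icc (0 : ℝ) 1, ∃ z, good z (τ t) ∧ dist (ψ (lineMap p q t)) z ≤ r := by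
  obtain ⟨L, f, hf0, hfL, hf, hind⟩ := exists_induced_seq hc
  set c : ℕ → E := fun i => (f i).1 with hcdef
  have hL : 0 < L := by
    rcases Nat.eq_zero_or_pos L with h | h
    · rw [h, hf0] at hfL
      exact absurd (congrArg Prod.snd hfL) (by norm_num)
    · exact h
  have hgood : ∀ i ≤ L, good (f i).1 (f i).2 := by
    intro i hi
    rcases i with _ | i
    · rw [hf0]; exact ha
    · exact (hf i hi).2.2
  have hmono : ∀ i j, i ≤ j → j ≤ L → (f i).2 ≤ (f j).2 := by
    intro i j hij
    induction hij with
    | refl => exact fun _ => le_rfl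
    | step _ ih => exact fun h => (ih (by omega)).trans (hf _ (by omega)).2.1
  have hfar : ∀ i j, i + 2 ≤ j → j ≤ L → 2 * r ≤ dist (c i) (c j) := by
    intro i j hij hj
    by_contra! h
    exact hind i j hij hj ⟨h, hmono i j (by omega) hj, hgood j hj⟩
  have hu : ∃ u : E, ‖u‖ = 1 ∧ r ≤ dist (c 0 - r • u) (c 1) := by
    by_cases h : c 1 = c 0
    · refine ⟨‖q - p‖⁻¹ • (q - p), norm_smul_inv_norm (𝕜 := ℝ) (sub_ne_zero.2 hpq.symm), ?_⟩
      have h1 : ‖‖q - p‖⁻¹ • (q - p)‖ = 1 := norm_smul_inv_norm (𝕜 := ℝ) (sub_ne_zero.2 hpq.symm)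
      rw [h, dist_eq_norm, sub_sub_cancel_left, norm_neg, norm_smul, h1, Real.norm_of_nonneg hr.le,
        mul_one]
    · have h0 : ‖c 1 - c 0‖ ≠ 0 := norm_ne_zero_iff.2 (sub_ne_zero.2 h)
      refine ⟨‖c 1 - c 0‖⁻¹ • (c 1 - c 0), norm_smul_inv_norm (𝕜 := ℝ) (sub_ne_zero.2 h), ?_⟩
      have h2 : c 0 - r • ‖c 1 - c 0‖⁻¹ • (c 1 - c 0) - c 1 =
          -((r * ‖c 1 - c 0‖⁻¹ + 1) • (c 1 - c 0)) := by
        rw [add_smul, one_smul, mul_smul]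
        abel
      rw [dist_eq_norm, h2, norm_neg, norm_smul, Real.norm_of_nonneg (by positivity), add_mul,
        mul_assoc, inv_mul_cancel₀ h0]
      linarith [norm_nonneg (c 1 - c 0)]
  obtain ⟨u, hu, huc⟩ := hu
  obtain ⟨A, hA⟩ := SeparatingDual.exists_continuousLinearEquiv_apply_eq (R := ℝ)
    (sub_ne_zero.2 hpq.symm) (smul_ne_zero hr.ne' (norm_ne_zero_iff.1 (hu ▸ one_ne_zero)) : r • u ≠ 0)
  have hbase : dist (c 0 - r • u) (c 0) = r := by
    rw [dist_eq_norm, sub_sub_cancel_left, norm_neg, norm_smul, hu, Real.norm_of_nonneg hr.le,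
      mul_one]
  have hstart : ∃ ψ : E ≃ₜ E, ArcState c r L (fun t => lineMap p q t) 0 ψ 0 (fun _ => 0)
      (c 0 - r • u) (c 0) := by
    have hval : ∀ t : ℝ, (((Homeomorph.addRight (-p)).trans A.toHomeomorph).trans
        (Homeomorph.addRight (c 0 - r • u))) (lineMap p q t) = lineMap (c 0 - r • u) (c 0) t := by
      intro t
      have h1 : (lineMap p q t : E) + -p = t • (q - p) := by
        rw [lineMap_apply_module']; abel
      have h2 : c 0 - (c 0 - r • u) = r • u := sub_sub_cancel _ _
      rw [Homeomorph.trans_apply, Homeomorph.trans_apply, Homeomorph.coe_addRight,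
        Homeomorph.coe_addRight]
      beta_reduce
      rw [h1, lineMap_apply_module', h2, ← hA]
      simp
    refine ⟨((Homeomorph.addRight (-p)).trans A.toHomeomorph).trans
      (Homeomorph.addRight (c 0 - r • u)), ⟨le_rfl, one_pos, hbase, by simpa using hr, fun t ht => ?_, fun _ _ _ _ _ => le_rfl,
      rfl, fun _ _ => rfl, fun t ht => ⟨le_rfl, ?_⟩, fun t ht i _ hiL => ?_⟩⟩
    · rw [hval, sub_zero, sub_zero, div_one]
    · have : t = 0 := le_antisymm ht.2 ht.1
      rw [hval, this, lineMap_apply_zero, hbase]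
    · have : t = 0 := le_antisymm ht.2 ht.1
      rw [hval, this, lineMap_apply_zero]
      rcases i with _ | _ | i
      · exact hbase.ge
      · exact huc
      · have h1 := hfar 0 (i + 2) (by omega) hiL
        have h2 := dist_triangle_left (c 0) (c (i + 2)) (c 0 - r • u)
        linarith
  have hall : ∀ j ≤ L, ∃ ψ x lam b a, ArcState c r L (fun t => lineMap p q t) j ψ x lam b a := by
    intro j
    induction j with
    | zero =>
      obtain ⟨ψ, h⟩ := hstart
      exact fun _ => ⟨ψ, _, _, _, _, h⟩
    | succ j ih =>
      intro hj
      obtain ⟨ψ, x, lam, b', a', h⟩ := ih (by omega)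
      exact h.step hj (hf j hj).1 fun i hi hiL => hfar j i hi hiL
  obtain ⟨ψ, x, lam, b', a', h⟩ := hall L le_rfl
  have hlam : ∀ t ∈ Icc (0 : ℝ) 1, lam t ≤ L ∧ dist (ψ (lineMap p q t)) (c (lam t)) ≤ r := by
    intro t ht
    rcases le_or_gt t x with h1 | h1
    · exact h.early t ⟨ht.1, h1⟩
    · have hx1 : 0 < 1 - x := sub_pos.2 h.lt_one
      rw [h.late t h1, h.segment t ⟨h1.le, ht.2⟩]
      exact ⟨le_rfl, dist_lineMap_le h.base.le h.tip.le
        ⟨div_nonneg (by linarith) hx1.le, (div_le_one hx1).2 (by linarith [ht.2])⟩⟩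
  refine ⟨ψ, fun t => (f (lam t)).2, fun s hs t ht hst =>
    hmono _ _ (h.mono hs ht hst) (hlam t ht).1, ?_, ?_, fun t ht =>
    ⟨_, hgood _ (hlam t ht).1, (hlam t ht).2⟩⟩
  · beta_reduce
    rw [h.zero, hf0]
  · beta_reduce
    rw [h.late 1 h.lt_one, hfL]

end

/-- The unit sphere in Euclidean three-space. -/
abbrev Sph : Type := Metric.sphere (0 : EuclideanSpace ℝ (Fin 3)) 1

lemma mem_sph_iff (z : EuclideanSpace ℝ (Fin 3)) :
    z ∈ Metric.sphere (0 : EuclideanSpace ℝ (Fin 3)) 1 ↔ z 0 ^ 2 + z 1 ^ 2 + z 2 ^ 2 = 1 := by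
  rw [mem_sphere_zero_iff_norm, EuclideanSpace.norm_eq, Real.sqrt_eq_one, Fin.sum_univ_three]
  simp [sq_abs]

open Real in
/-- Spherical coordinates, rescaled so that the period of the longitude is `1`. -/
noncomputable def polar (p : ℝ × ℝ) : Sph :=
  ⟨!₂[sin (π * p.1) * cos (2 * π * p.2), sin (π * p.1) * sin (2 * π * p.2), cos (π * p.1)], by
    rw [mem_sph_iff]
    simp only [PiLp.toLp_apply, Matrix.cons_val]
    nlinarith [sin_sq_add_cos_sq (π * p.1), sin_sq_add_cos_sq (2 * π * p.2)]⟩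

open Real in
lemma polar_eq_iff {p : ℝ × ℝ} {z : Sph} : polar p = z ↔
    sin (π * p.1) * cos (2 * π * p.2) = z.1 0 ∧ sin (π * p.1) * sin (2 * π * p.2) = z.1 1 ∧
      cos (π * p.1) = z.1 2 := by
  rw [Subtype.ext_iff]
  constructor
  · intro h
    rw [← h]
    simp [polar]
  · rintro ⟨h1, h2, h3⟩
    ext i
    fin_cases i
    · simpa [polar] using h1
    · simpa [polar] using h2
    · simpa [polar] using h3

lemma continuous_polar : Continuous polar := by
  refine Continuous.subtype_mk ?_ _
  fun_prop

lemma polar_add_int (x y : ℝ) (n : ℤ) : polar (x, y + n) = polar (x, y) := by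
  rw [polar_eq_iff]
  have h : 2 * Real.pi * (y + n) = 2 * Real.pi * y + n * (2 * Real.pi) := by ring
  simp only [h, Real.cos_add_int_mul_two_pi, Real.sin_add_int_mul_two_pi]
  simp [polar]

lemma polar_add_one (x y : ℝ) : polar (x, y + 1) = polar (x, y) := by
  simpa using polar_add_int x y 1

lemma polar_zero (y y' : ℝ) : polar (0, y) = polar (0, y') := by
  rw [polar_eq_iff]
  simp [polar]

lemma polar_one (y y' : ℝ) : polar (1, y) = polar (1, y') := by
  rw [polar_eq_iff]
  simp [polar]

lemma polar_side {x : ℝ} (hx : x = 0 ∨ x = 1) (y y' : ℝ) : polar (x, y) = polar (x, y') := by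
  rcases hx with rfl | rfl
  · exact polar_zero y y'
  · exact polar_one y y'

open Real in
lemma polar_inj {p q : ℝ × ℝ} (hp : p.1 ∈ Icc (0 : ℝ) 1) (hq : q.1 ∈ Icc (0 : ℝ) 1)
    (h : polar p = polar q) : p.1 = q.1 ∧ ((p.1 = 0 ∨ p.1 = 1) ∨ ∃ n : ℤ, p.2 = q.2 + n) := by
  obtain ⟨h1, h2, h3⟩ := polar_eq_iff.1 h
  simp only [polar, PiLp.toLp_apply, Matrix.cons_val] at h1 h2 h3
  have e : p.1 = q.1 := by
    have := injOn_cos (x₁ := π * p.1) (x₂ := π * q.1)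
      ⟨mul_nonneg pi_pos.le hp.1, by nlinarith [pi_pos, hp.2]⟩
      ⟨mul_nonneg pi_pos.le hq.1, by nlinarith [pi_pos, hq.2]⟩ h3
    exact mul_left_cancel₀ pi_ne_zero this
  refine ⟨e, or_iff_not_imp_left.2 fun hne => ?_⟩
  push Not at hne
  have hs : 0 < sin (π * p.1) := by
    have h0 : 0 < p.1 := lt_of_le_of_ne hp.1 hne.1.symm
    have h1 : p.1 < 1 := lt_of_le_of_ne hp.2 hne.2
    exact sin_pos_of_pos_of_lt_pi (mul_pos pi_pos h0) (by nlinarith [pi_pos])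
  rw [← e] at h1 h2
  have hc := mul_left_cancel₀ hs.ne' h1
  have hs' := mul_left_cancel₀ hs.ne' h2
  have ha : ((2 * π * p.2 : ℝ) : Angle) = (2 * π * q.2 : ℝ) := Angle.cos_sin_inj hc hs'
  obtain ⟨n, hn⟩ := Angle.angle_eq_iff_two_pi_dvd_sub.1 ha
  refine ⟨n, ?_⟩
  have : 2 * π * (p.2 - q.2 - n) = 0 := by linear_combination hn
  have h2 := (mul_eq_zero.1 this).resolve_left (by positivity)
  linarith

open Real in
lemma polar_surj (c : ℝ) (z : Sph) : ∃ p ∈ sq, polar (p.1, c + p.2) = z := by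
  obtain ⟨y, hy⟩ : ∃ y, polar (arccos (z.1 2) / π, y) = z := by
    have hz := (mem_sph_iff z.1).1 z.2
    have h1 : π * (arccos (z.1 2) / π) = arccos (z.1 2) := mul_div_cancel₀ _ pi_ne_zero
    set w : ℂ := ⟨z.1 0, z.1 1⟩ with hw
    have hn : sin (arccos (z.1 2)) = ‖w‖ := by
      rw [sin_arccos, Complex.norm_eq_sqrt_sq_add_sq]
      congr 1
      simp only [hw]
      linarith
    refine ⟨w.arg / (2 * π), polar_eq_iff.2 ?_⟩
    have h2 : 2 * π * (w.arg / (2 * π)) = w.arg := mul_div_cancel₀ _ (by positivity)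
    simp only [h1, h2, hn]
    refine ⟨Complex.norm_mul_cos_arg w, Complex.norm_mul_sin_arg w, cos_arccos ?_ ?_⟩ <;> nlinarith
  refine ⟨(arccos (z.1 2) / π, Int.fract (y - c)), ?_, ?_⟩
  · rw [mem_sq]
    exact ⟨⟨div_nonneg (arccos_nonneg _) pi_pos.le, (div_le_one pi_pos).2 (arccos_le_pi _)⟩,
      Int.fract_nonneg _, (Int.fract_lt_one _).le⟩
  · have : c + Int.fract (y - c) = y + ((-⌊y - c⌋ : ℤ) : ℝ) := by
      rw [Int.fract]; push_cast; ring
    beta_reduce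
    rw [this, polar_add_int, hy]

/-- The sector of the sphere between the longitudes `a` and `a + d`. -/
noncomputable def lune (a d : ℝ) (p : ℝ × ℝ) : Sph := polar (p.1, a + d * p.2)

lemma continuous_lune (a d : ℝ) : Continuous (lune a d) := by
  unfold lune
  exact continuous_polar.comp (by fun_prop)

lemma lune_sqBd_cases {a d : ℝ} {r : ℝ × ℝ} (hr : r ∈ sqBd) :
    ∃ t ∈ Icc (0 : ℝ) 1, lune a d r = polar (t, a) ∨ lune a d r = polar (t, a + d) := by
  have h1 := mem_sq.1 hr.1
  refine ⟨r.1, h1.1, ?_⟩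
  have h2 : r ∉ sqInt := hr.2
  by_cases hx : r.1 = 0 ∨ r.1 = 1
  · exact .inl (polar_side hx _ _)
  · push Not at hx
    have h3 : r.2 = 0 ∨ r.2 = 1 := by
      by_contra! h
      exact h2 (mem_sqInt.2 ⟨⟨lt_of_le_of_ne h1.1.1 hx.1.symm, lt_of_le_of_ne h1.1.2 hx.2⟩,
        lt_of_le_of_ne h1.2.1 h.1.symm, lt_of_le_of_ne h1.2.2 h.2⟩)
    rcases h3 with h | h
    · exact .inl (by rw [lune, h, mul_zero, add_zero])
    · exact .inr (by rw [lune, h, mul_one])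

lemma lune_one_sqBd {a : ℝ} {r : ℝ × ℝ} (hr : r ∈ sqBd) :
    ∃ t ∈ Icc (0 : ℝ) 1, lune a 1 r = polar (t, a) := by
  obtain ⟨t, ht, h | h⟩ := lune_sqBd_cases (a := a) (d := 1) hr
  · exact ⟨t, ht, h⟩
  · exact ⟨t, ht, by rw [h, polar_add_one]⟩

lemma lune_one_surj (a : ℝ) (z : Sph) : ∃ p ∈ sq, lune a 1 p = z := by
  obtain ⟨p, hp, h⟩ := polar_surj a z
  exact ⟨p, hp, by rw [lune, one_mul, h]⟩

lemma eq_zero_of_abs_lt {n : ℤ} {x : ℝ} (h : x = n) (h1 : -1 < x) (h2 : x < 1) : n = 0 := by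
  subst h
  have h1' : -1 < n := by exact_mod_cast h1
  have h2' : n < 1 := by exact_mod_cast h2
  omega

lemma lune_one_inj {a : ℝ} {p q : ℝ × ℝ} (hp : p ∈ sqInt) (hq : q ∈ sq)
    (h : lune a 1 p = lune a 1 q) : p = q := by
  have hp' := mem_sqInt.1 hp
  have hq1 := mem_sq.1 hq
  obtain ⟨h1, h2⟩ := polar_inj (p := (p.1, a + 1 * p.2)) (q := (q.1, a + 1 * q.2))
    ⟨hp'.1.1.le, hp'.1.2.le⟩ hq1.1 h
  simp only at h1 h2
  obtain ⟨n, hn⟩ := h2.resolve_left (by push Not; exact ⟨hp'.1.1.ne', hp'.1.2.ne⟩)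
  have hn0 := eq_zero_of_abs_lt (n := n) (x := p.2 - q.2) (by linarith)
    (by linarith [hp'.2.1, hq1.2.2]) (by linarith [hp'.2.2, hq1.2.1])
  rw [hn0, Int.cast_zero] at hn
  exact Prod.ext h1 (by linarith)

lemma preCell_lune_one (a : ℝ) : PreCell (lune a 1) := by
  refine ⟨(continuous_lune a 1).continuousOn, fun p hp q hq h =>
    lune_one_inj hp (sqInt_subset_sq hq) h, fun p hp q hq hq' h => ?_, ?_⟩
  · exact hq' (lune_one_inj hp hq h ▸ hp)
  · have h1 : lune a 1 '' sqInt = (lune a 1 '' sqBd)ᶜ := by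
      ext z
      constructor
      · rintro ⟨p, hp, rfl⟩ ⟨q, hq, h⟩
        exact hq.2 (lune_one_inj hp hq.1 h.symm ▸ hp)
      · intro hz
        obtain ⟨p, hp, rfl⟩ := lune_one_surj a z
        by_contra h
        exact hz ⟨p, ⟨hp, fun hp' => h ⟨p, hp', rfl⟩⟩, rfl⟩
    rw [h1]
    exact (isCompact_sqBd.image (continuous_lune a 1)).isClosed.isOpen_compl

lemma chordCell_lune_one (a : ℝ) : ChordCell (lune a 1) := by
  refine ⟨preCell_lune_one a, fun s hs t ht h => ?_, ?_, ?_⟩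
  · exact (polar_inj (p := (s, a + 1 * (1 / 2))) (q := (t, a + 1 * (1 / 2))) hs ht h).1
  · refine nearFiber_left (continuous_lune a 1).continuousOn fun r hr h => ⟨?_, .inr ?_⟩
    · exact (polar_inj (p := (r.1, a + 1 * r.2)) (q := (0, a + 1 * (1 / 2))) hr.1.1 (by simp) h).1
    · exact fun y _ => polar_zero _ _
  · refine nearFiber_right (continuous_lune a 1).continuousOn fun r hr h => ⟨?_, .inr ?_⟩
    · exact (polar_inj (p := (r.1, a + 1 * r.2)) (q := (1, a + 1 * (1 / 2))) hr.1.1 (by simp) h).1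
    · exact fun y _ => polar_one _ _

lemma cell_lune {a d : ℝ} (hd : 0 < d) (hd1 : d < 1) : Cell (lune a d) := by
  refine ⟨(continuous_lune a d).continuousOn, ?_, fun p hp q hq h => ?_⟩
  · have h1 : lune a d '' sqInt = lune a 1 '' (Ioo 0 1 ×ˢ Ioo 0 d) := by
      rw [← sub_zero d, ← rectMap_image_sqInt one_pos (by simpa using hd), image_image]
      refine image_congr fun p _ => ?_
      simp [lune, rectMap]
    rw [h1]
    exact (preCell_lune_one a).isOpen_image_of_isOpen
      (prod_mono le_rfl (Ioo_subset_Ioo le_rfl hd1.le)) (isOpen_Ioo.prod isOpen_Ioo)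
  · have hp' := mem_sq.1 hp
    have hq' := mem_sq.1 hq
    obtain ⟨h1, h2⟩ := polar_inj (p := (p.1, a + d * p.2)) (q := (q.1, a + d * q.2)) hp.1 hq.1 h
    simp only at h1 h2
    refine ⟨h1, ?_⟩
    rcases h2 with h2 | ⟨n, hn⟩
    · exact .inr ⟨h2, fun y _ => polar_side h2 _ _⟩
    · have hn0 := eq_zero_of_abs_lt (n := n) (x := d * p.2 - d * q.2) (by linarith)
        (by nlinarith [hp'.2.1, hq'.2.2]) (by nlinarith [hp'.2.2, hq'.2.1])
      rw [hn0, Int.cast_zero, add_zero] at hn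
      exact .inl (mul_left_cancel₀ hd.ne' (add_left_cancel hn))

lemma lune_mem_iff {a d : ℝ} (hd : 0 < d) (hd1 : d < 1) {q : ℝ × ℝ} (hq : q ∈ sq) :
    lune a 1 q ∉ lune a d '' sq ↔ q ∈ Ioo (0 : ℝ) 1 ×ˢ Ioo d 1 := by
  have hq' := mem_sq.1 hq
  constructor
  · intro h
    have hx : q.1 ≠ 0 ∧ q.1 ≠ 1 := by
      by_contra hx
      exact h ⟨q, hq, polar_side (by grind) _ _⟩
    have hy : d < q.2 := by
      by_contra! hy
      refine h ⟨(q.1, q.2 / d), ⟨hq.1, div_nonneg hq'.2.1 hd.le, (div_le_one hd).2 hy⟩, ?_⟩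
      simp only [lune]
      rw [mul_div_cancel₀ _ hd.ne', one_mul]
    have hy1 : q.2 ≠ 1 := by
      intro hy1
      refine h ⟨(q.1, 0), ⟨hq.1, le_rfl, zero_le_one⟩, ?_⟩
      simp only [lune]
      rw [hy1, mul_zero, add_zero, mul_one, polar_add_one]
    exact ⟨⟨lt_of_le_of_ne hq'.1.1 hx.1.symm, lt_of_le_of_ne hq'.1.2 hx.2⟩, hy,
      lt_of_le_of_ne hq'.2.2 hy1⟩
  · rintro ⟨hx, hy⟩ ⟨p, hp, h⟩
    have hp' := mem_sq.1 hp
    have h1 : lune a 1 q = lune a 1 (p.1, d * p.2) := by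
      rw [← h]; simp [lune]
    have h2 := lune_one_inj (p := q) ⟨hx, hd.trans hy.1, hy.2⟩
      (⟨hp.1, mul_nonneg hd.le hp'.2.1, by nlinarith⟩ : (p.1, d * p.2) ∈ sq) h1
    have h3 := congrArg Prod.snd h2
    simp only at h3
    nlinarith [hy.1]

lemma ulc_sph : ULC Sph := by
  have : Fact (Module.finrank ℝ (EuclideanSpace ℝ (Fin 3)) = 2 + 1) := ⟨by simp⟩
  have : LocallyConnectedSpace Sph :=
    ChartedSpace.locallyConnectedSpace (EuclideanSpace ℝ (Fin 2)) _
  exact ulc_of_locallyConnected Sph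

/-- The map `g` moves the points of the meridian of longitude `c` by at most `η`. -/
def NearArc (η : ℝ) (g : Sph → Sph) (c : ℝ) : Prop :=
  ∀ t ∈ Icc (0 : ℝ) 1, dist (g (polar (t, c))) (polar (t, c)) ≤ η

lemma NearArc.mono {η η' : ℝ} {g : Sph → Sph} {c : ℝ} (h : NearArc η g c) (hη : η ≤ η') :
    NearArc η' g c := fun t ht => (h t ht).trans hη

lemma NearArc.add_one {η : ℝ} {g : Sph → Sph} {c : ℝ} (h : NearArc η g c) :
    NearArc η g (c + 1) := fun t ht => by
  rw [polar_add_one]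
  exact h t ht

lemma NearArc.near_boundary {η : ℝ} {g : Sph → Sph} {a d : ℝ} (h : NearArc η g a)
    (h' : NearArc η g (a + d)) : ∀ r ∈ sqBd, dist (g (lune a d r)) (lune a d r) ≤ η := by
  intro r hr
  obtain ⟨t, ht, e | e⟩ := lune_sqBd_cases (a := a) (d := d) hr <;> rw [e]
  · exact h t ht
  · exact h' t ht

lemma NearArc.near_of_mem {η : ℝ} {g : Sph → Sph} {a d : ℝ} (h : NearArc η g a)
    (h' : NearArc η g (a + d)) :
    ∀ x ∈ lune a d '' sq, x ∉ lune a d '' sqInt → dist (g x) x ≤ η := by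
  rintro _ ⟨r, hr, rfl⟩ hx
  exact h.near_boundary h' r ⟨hr, fun h => hx ⟨r, h, rfl⟩⟩

lemma disjoint_lune {a d b e : ℝ} (hd : 0 < d) (he : 0 < e) (ha : 0 ≤ a) (had : a + d ≤ 1)
    (hb : 0 ≤ b) (hbe : b + e ≤ 1) (h : a + d ≤ b ∨ b + e ≤ a) :
    Disjoint (lune a d '' sqInt) (lune b e '' sq) := by
  rw [Set.disjoint_left]
  rintro _ ⟨p, hp, rfl⟩ ⟨q, hq, hpq⟩
  have hp' := mem_sqInt.1 hp
  have hq' := mem_sq.1 hq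
  have m1 := mul_pos hd hp'.2.1
  have m2 := mul_pos hd (sub_pos.2 hp'.2.2)
  have m3 := mul_nonneg he.le hq'.2.1
  have m4 := mul_nonneg he.le (sub_nonneg.2 hq'.2.2)
  have h1 : lune 0 1 (p.1, a + d * p.2) = lune 0 1 (q.1, b + e * q.2) := by
    simpa [lune] using hpq.symm
  have e1 : (p.1, a + d * p.2) ∈ sqInt := by
    rw [mem_sqInt]
    exact ⟨hp'.1, by linarith, by linarith⟩
  have e2 : (q.1, b + e * q.2) ∈ sq := by
    rw [mem_sq]
    exact ⟨hq'.1, by linarith, by linarith⟩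
  have h2 := lune_one_inj e1 e2 h1
  have h3 := congrArg Prod.snd h2
  simp only at h3
  rcases h with h | h <;> linarith

lemma lune_respect {a d y : ℝ} (hd : 0 < d) (hd1 : d < 1) (hy : y ∈ Ioo d 1) {η' : ℝ}
    (hη' : 0 < η') : ∃ η, 0 < η ∧ ∀ g : Sph → Sph, Mono g → NearArc η g (a + y) → NearArc η g a →
      NearArc η g (a + d) → ∀ x ∈ lune a d '' sq, ∃ z ∈ lune a d '' sq, dist (g x) z ≤ η' := by
  have hcell := cell_lune (a := a) hd hd1
  have hset : sq ∩ {q | lune a 1 q ∉ lune a d '' sq} = Ioo (0 : ℝ) 1 ×ˢ Ioo d 1 := by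
    ext q
    constructor
    · rintro ⟨h1, h2⟩
      exact (lune_mem_iff hd hd1 h1).1 h2
    · intro h
      have hq : q ∈ sq := ⟨Ioo_subset_Icc_self h.1, (hd.trans h.2.1).le, h.2.2.le⟩
      exact ⟨hq, (lune_mem_iff hd hd1 hq).2 h⟩
  have hw : ((1 / 2 : ℝ), y) ∈ sq := by
    rw [mem_sq]; exact ⟨by norm_num, (hd.trans hy.1).le, hy.2.le⟩
  obtain ⟨η, hη, H⟩ := exists_respect ulc_sph (B := lune a 1) (R := lune a d '' sq)
    (I := lune a d '' sqInt) (continuous_lune a 1).continuousOn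
    (isCompact_sq.image (continuous_lune a d)).isClosed hcell.isOpen_image
    (image_mono sqInt_subset_sq) (by rw [hset]; exact (convex_Ioo _ _).prod (convex_Ioo _ _)) hw
    ((lune_mem_iff hd hd1 hw).2 ⟨by norm_num, hy⟩) hη'
  refine ⟨η, hη, fun g hg h1 h2 h3 => H g hg ?_ (h2.near_of_mem h3) fun x _ => ?_⟩
  · simpa [lune] using h1 (1 / 2) (by norm_num)
  · obtain ⟨p, hp, h⟩ := lune_one_surj a (g x)
    exact ⟨g x, ⟨p, hp, h⟩, by simpa using hη.le⟩

/-- If a monotone map is close to the identity on three meridians, then it is close to the identity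
after a change of variables. -/
theorem exists_fix_of_three_arcs {ε : ℝ} (hε : 0 < ε) : ∃ η, 0 < η ∧ ∀ g : Sph → Sph, Mono g →
    NearArc η g 0 → NearArc η g (1 / 2) → NearArc η g (3 / 4) →
    ∃ Ψ : Sph ≃ₜ Sph, ∀ x, dist (g (Ψ x)) x ≤ ε := by
  let α : Fin 3 → ℝ := ![0, 1 / 2, 3 / 4]
  let w : Fin 3 → ℝ := ![1 / 2, 1 / 4, 1 / 4]
  have hα : ∀ i, 0 ≤ α i := by intro i; fin_cases i <;> norm_num [α]
  have hw : ∀ i, 0 < w i := by intro i; fin_cases i <;> norm_num [w]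
  have hw1 : ∀ i, w i < 1 := by intro i; fin_cases i <;> norm_num [w]
  have hαw : ∀ i, α i + w i ≤ 1 := by intro i; fin_cases i <;> norm_num [α, w]
  have hdisj : ∀ i j, i ≠ j →
      Disjoint (lune (α i) (w i) '' sqInt) (lune (α j) (w j) '' sq) := by
    intro i j hij
    refine disjoint_lune (hw i) (hw j) (hα i) (hαw i) (hα j) (hαw j) ?_
    fin_cases i <;> fin_cases j <;> first | exact absurd rfl hij | norm_num [α, w]
  have hcover : ∀ x : Sph, ∃ i, x ∈ lune (α i) (w i) '' sq := by
    intro x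
    obtain ⟨p, hp, rfl⟩ := polar_surj 0 x
    have hp' := mem_sq.1 hp
    have key : ∀ i, α i ≤ p.2 → p.2 ≤ α i + w i →
        polar (p.1, 0 + p.2) ∈ lune (α i) (w i) '' sq := by
      intro i h1 h2
      refine ⟨(p.1, (p.2 - α i) / w i), ⟨hp.1, div_nonneg (by linarith) (hw i).le,
        (div_le_one (hw i)).2 (by linarith)⟩, ?_⟩
      simp only [lune]
      rw [mul_div_cancel₀ _ (hw i).ne']
      congr 2
      ring
    rcases le_total p.2 (1 / 2) with h1 | h1
    · exact ⟨0, key 0 hp'.2.1 (by simpa [α, w] using h1)⟩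
    · rcases le_total p.2 (3 / 4) with h2 | h2
      · exact ⟨1, key 1 (by simpa [α, w] using h1) (by norm_num [α, w]; linarith)⟩
      · exact ⟨2, key 2 (by simpa [α, w] using h2) (show p.2 ≤ 3 / 4 + 1 / 4 by linarith [hp'.2.2])⟩
  obtain ⟨η₁, hη₁, H⟩ := exists_fix_family (ε := ε) (R := fun i => lune (α i) (w i) '' sq)
    (I := fun i => lune (α i) (w i) '' sqInt) (fun i => image_mono sqInt_subset_sq) hdisj
    Finset.univ fun i _ => (cell_lune (hw i) (hw1 i)).fixable ulc_sph hε
  let y : Fin 3 → ℝ := ![3 / 4, 1 / 2, 3 / 4]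
  have hy : ∀ i, y i ∈ Ioo (w i) 1 := by
    intro i; fin_cases i <;> norm_num [y, w]
  choose η hη hres using fun i => lune_respect (a := α i) (hw i) (hw1 i) (hy i) hη₁
  let η₀ := min η₁ (min (η 0) (min (η 1) (η 2)))
  have hη₀ : ∀ i, η₀ ≤ η i := by
    intro i
    fin_cases i
    · exact (min_le_right _ _).trans (min_le_left _ _)
    · exact (min_le_right _ _).trans ((min_le_right _ _).trans (min_le_left _ _))
    · exact (min_le_right _ _).trans ((min_le_right _ _).trans (min_le_right _ _))
  refine ⟨η₀, lt_min hη₁ (lt_min (hη 0) (lt_min (hη 1) (hη 2))), fun g hg h0 h1 h2 => ?_⟩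
  have h3 : NearArc η₀ g 1 := by simpa using h0.add_one
  have h4 : NearArc η₀ g (3 / 2) := by
    have := h1.add_one
    norm_num at this
    exact this
  have ha : ∀ i, NearArc η₀ g (α i) := by intro i; fin_cases i <;> assumption
  have haw : ∀ i, NearArc η₀ g (α i + w i) := by
    intro i
    fin_cases i
    · exact (show (1 / 2 : ℝ) = 0 + 1 / 2 by norm_num) ▸ h1
    · exact (show (3 / 4 : ℝ) = 1 / 2 + 1 / 4 by norm_num) ▸ h2
    · exact (show (1 : ℝ) = 3 / 4 + 1 / 4 by norm_num) ▸ h3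
  have hay : ∀ i, NearArc η₀ g (α i + y i) := by
    intro i
    fin_cases i
    · exact (show (3 / 4 : ℝ) = 0 + 3 / 4 by norm_num) ▸ h2
    · exact (show (1 : ℝ) = 1 / 2 + 1 / 2 by norm_num) ▸ h3
    · exact (show (3 / 2 : ℝ) = 3 / 4 + 3 / 4 by norm_num) ▸ h4
  have hR := fun i => hres i g hg ((hay i).mono (hη₀ i)) ((ha i).mono (hη₀ i))
    ((haw i).mono (hη₀ i))
  have hbd := fun i => ((ha i).mono (min_le_left _ _ : η₀ ≤ η₁)).near_of_mem
    ((haw i).mono (min_le_left _ _))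
  have hout : ∀ i x, x ∉ lune (α i) (w i) '' sqInt →
      ∃ z, z ∉ lune (α i) (w i) '' sqInt ∧ dist (g x) z ≤ η₁ := by
    intro i x hx
    obtain ⟨j, hj⟩ := hcover x
    rcases eq_or_ne i j with rfl | hij
    · exact ⟨x, hx, hbd i x hj hx⟩
    · obtain ⟨z, hz, hd⟩ := hR j x hj
      exact ⟨z, fun h => Set.disjoint_left.1 (hdisj i j hij) h hz, hd⟩
  obtain ⟨Ψ, -, hΨ⟩ := H g hg fun i _ => ⟨hbd i, hout i, hR i⟩
  refine ⟨Ψ, fun x => ?_⟩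
  obtain ⟨i, hi⟩ := hcover x
  exact hΨ i (Finset.mem_univ i) x hi

lemma exists_lt_dist_meridian {κ c c' : ℝ} (hκ : 0 < κ) (h : c' < c) (h' : c < c' + 1) :
    ∃ D > 0, ∀ s ∈ Icc κ (1 - κ), ∀ t ∈ Icc (0 : ℝ) 1,
      D < dist (polar (s, c)) (polar (t, c')) := by
  have hc : ∀ c, Continuous fun t : ℝ => polar (t, c) := fun c =>
    continuous_polar.comp (by fun_prop)
  obtain ⟨D, hD, H⟩ := exists_lt_dist_of_disjoint
    (s := (fun t : ℝ => polar (t, c)) '' Icc κ (1 - κ))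
    (t := (fun t : ℝ => polar (t, c')) '' Icc (0 : ℝ) 1) (isCompact_Icc.image (hc c))
    (isCompact_Icc.image (hc c')).isClosed (by
      rw [Set.disjoint_left]
      rintro _ ⟨s, hs, rfl⟩ ⟨t, ht, e⟩
      obtain ⟨h1, h2⟩ := polar_inj (p := (s, c)) (q := (t, c'))
        ⟨hκ.le.trans hs.1, hs.2.trans (by linarith)⟩ ht e.symm
      simp only at h1 h2
      obtain ⟨n, hn⟩ := h2.resolve_left (by
        rintro (h | h)
        · linarith [hs.1]
        · linarith [hs.2])
      have := eq_zero_of_abs_lt (n := n) (x := c - c') (by linarith) (by linarith) (by linarith)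
      rw [this, Int.cast_zero] at hn
      linarith)
  exact ⟨D, hD, fun s hs t ht => H _ ⟨s, hs, rfl⟩ _ ⟨t, ht, rfl⟩⟩

theorem exists_fix_second_arc {η' : ℝ} (hη' : 0 < η') : ∃ η, 0 < η ∧ ∀ g : Sph → Sph, Mono g →
    NearArc η g 0 → ∃ Ψ : Sph ≃ₜ Sph, NearArc η' (fun x => g (Ψ x)) 0 ∧
      NearArc η' (fun x => g (Ψ x)) (1 / 2) := by
  obtain ⟨κ, hκ, η, hη, H⟩ := (chordCell_lune_one 0).exists_fix ulc_sph hη'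
  obtain ⟨D, hD, hDd⟩ := exists_lt_dist_meridian (c := 1 / 2) (c' := 0) hκ (by norm_num)
    (by norm_num)
  have hchord : ∀ s, lune 0 1 (s, 1 / 2) = polar (s, 1 / 2) := fun s => by simp [lune]
  refine ⟨min η (min η' D), lt_min hη (lt_min hη' hD), fun g hg hA => ?_⟩
  have hbd : ∀ r ∈ sqBd, dist (g (lune 0 1 r)) (lune 0 1 r) ≤ min η (min η' D) :=
    hA.near_boundary (by simpa using hA.add_one)
  obtain ⟨Ψ, hΨ, hΨ'⟩ := H g hg (fun r hr => (hbd r hr).trans (min_le_left _ _))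
    fun s hs x hx => by
      by_contra hxI
      obtain ⟨r, hr, rfl⟩ := lune_one_surj 0 x
      have hr' : r ∈ sqBd := ⟨hr, fun h => hxI ⟨r, h, rfl⟩⟩
      obtain ⟨t, ht, e⟩ := lune_one_sqBd (a := 0) hr'
      have h1 := hbd r hr'
      rw [hx, hchord, e] at h1
      exact (hDd s hs t ht).not_ge (h1.trans ((min_le_right _ _).trans (min_le_right _ _)))
  refine ⟨Ψ, fun t ht => ?_, fun t ht => ?_⟩
  · have h1 : polar (t, 0) ∉ lune 0 1 '' sqInt := by
      rintro ⟨p, hp, e⟩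
      have e' : lune 0 1 p = lune 0 1 (t, 0) := by rw [e]; simp [lune]
      have := lune_one_inj hp (⟨ht, le_rfl, zero_le_one⟩ : (t, (0 : ℝ)) ∈ sq) e'
      rw [this] at hp
      exact lt_irrefl _ hp.2.1
    beta_reduce
    rw [hΨ _ h1]
    exact (hA t ht).trans ((min_le_right _ _).trans (min_le_left _ _))
  · simpa only [hchord] using hΨ' t ht

/-- The reflection exchanging the two hemispheres bounded by the meridians `0` and `1 / 2`. -/
noncomputable def flip : Sph ≃ₜ Sph where
  toFun z := ⟨!₂[z.1 0, -z.1 1, z.1 2], by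
    rw [mem_sph_iff]
    simpa using (mem_sph_iff z.1).1 z.2⟩
  invFun z := ⟨!₂[z.1 0, -z.1 1, z.1 2], by
    rw [mem_sph_iff]
    simpa using (mem_sph_iff z.1).1 z.2⟩
  left_inv z := by
    ext i
    fin_cases i <;> simp
  right_inv z := by
    ext i
    fin_cases i <;> simp
  continuous_toFun := by
    refine Continuous.subtype_mk ?_ _
    fun_prop
  continuous_invFun := by
    refine Continuous.subtype_mk ?_ _
    fun_prop

lemma flip_polar (x y : ℝ) : flip (polar (x, y)) = polar (x, -y) := by
  symm
  rw [polar_eq_iff]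
  simp [polar, flip]

lemma flip_lune (p : ℝ × ℝ) : flip (lune 0 (1 / 2) p) = lune (1 / 2) (1 / 2) (p.1, 1 - p.2) := by
  rw [lune, flip_polar, ← polar_add_one, lune]
  congr 2
  ring

lemma flip_flip (z : Sph) : flip (flip z) = z := flip.left_inv z

lemma NearArc.comp_flip {η : ℝ} {g : Sph → Sph} {c : ℝ} (h : NearArc η g c) {n : ℤ}
    (hc : -c = c + n) : NearArc η (fun x => g (flip x)) c := fun t ht => by
  beta_reduce
  rw [flip_polar, hc, polar_add_int]
  exact h t ht

theorem exists_fix_third_arc {η' : ℝ} (hη' : 0 < η') : ∃ η, 0 < η ∧ ∀ g : Sph → Sph, Mono g →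
    NearArc η g 0 → NearArc η g (1 / 2) → ∃ Ψ : Sph ≃ₜ Sph, NearArc η' (fun x => g (Ψ x)) 0 ∧
      NearArc η' (fun x => g (Ψ x)) (1 / 2) ∧ NearArc η' (fun x => g (Ψ x)) (3 / 4) := by
  have hU := cell_lune (a := 1 / 2) (d := 1 / 2) (by norm_num) (by norm_num)
  have hV := cell_lune (a := 0) (d := 1 / 2) (by norm_num) (by norm_num)
  obtain ⟨κ, hκ, η, hη, H⟩ := hU.toChordCell.exists_fix ulc_sph hη'
  obtain ⟨D, hD, hDd⟩ := exists_lt_dist_meridian (c := 3 / 4) (c' := 0) hκ (by norm_num)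
    (by norm_num)
  obtain ⟨D', hD', hDd'⟩ := exists_lt_dist_meridian (c := 3 / 4) (c' := 1 / 2) hκ (by norm_num)
    (by norm_num)
  have hchord : ∀ s, lune (1 / 2) (1 / 2) (s, 1 / 2) = polar (s, 3 / 4) := fun s => by
    norm_num [lune]
  have hdisj : Disjoint (lune (1 / 2) (1 / 2) '' sqInt) (lune 0 (1 / 2) '' sq) :=
    disjoint_lune (by norm_num) (by norm_num) (by norm_num) (by norm_num) (by norm_num)
      (by norm_num) (.inr (by norm_num))
  have hfix0 : ∀ t ∈ Icc (0 : ℝ) 1, polar (t, 0) ∉ lune (1 / 2) (1 / 2) '' sqInt := fun t ht h =>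
    Set.disjoint_left.1 hdisj h ⟨(t, 0), ⟨ht, le_rfl, zero_le_one⟩, by simp [lune]⟩
  have hfix1 : ∀ t ∈ Icc (0 : ℝ) 1, polar (t, 1 / 2) ∉ lune (1 / 2) (1 / 2) '' sqInt :=
    fun t ht h => Set.disjoint_left.1 hdisj h ⟨(t, 1), ⟨ht, zero_le_one, le_rfl⟩, by simp [lune]⟩
  set η₀ := min (min η η') (min D D') with hη₀
  have l1 : η₀ ≤ η := (min_le_left _ _).trans (min_le_left _ _)
  have l2 : η₀ ≤ η' := (min_le_left _ _).trans (min_le_right _ _)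
  have l3 : η₀ ≤ D := (min_le_right _ _).trans (min_le_left _ _)
  have l4 : η₀ ≤ D' := (min_le_right _ _).trans (min_le_right _ _)
  set K := (fun s : ℝ => polar (s, 3 / 4)) '' Icc κ (1 - κ) with hK
  have main : ∀ g : Sph → Sph, Mono g → NearArc η₀ g 0 → NearArc η₀ g (1 / 2) →
      g ⁻¹' K ⊆ lune (1 / 2) (1 / 2) '' sqInt → ∃ Ψ : Sph ≃ₜ Sph,
      NearArc η' (fun x => g (Ψ x)) 0 ∧ NearArc η' (fun x => g (Ψ x)) (1 / 2) ∧
      NearArc η' (fun x => g (Ψ x)) (3 / 4) := by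
    intro g hg h0 h1 hsub
    have h1' : NearArc η₀ g (1 / 2 + 1 / 2) := by
      have := h0.add_one
      norm_num at this ⊢
      exact this
    obtain ⟨Ψ, hΨ, hΨ'⟩ := H g hg (fun r hr => (h1.near_boundary h1' r hr).trans l1)
      fun s hs x hx => hsub ⟨s, hs, (hchord s).symm.trans hx.symm⟩
    refine ⟨Ψ, fun t ht => ?_, fun t ht => ?_, fun t ht => ?_⟩
    · beta_reduce
      rw [hΨ _ (hfix0 t ht)]
      exact (h0 t ht).trans l2
    · beta_reduce
      rw [hΨ _ (hfix1 t ht)]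
      exact (h1 t ht).trans l2
    · simpa only [hchord] using hΨ' t ht
  refine ⟨η₀, lt_min (lt_min hη hη') (lt_min hD hD'), fun g hg h0 h1 => ?_⟩
  have hpre : IsPreconnected (g ⁻¹' K) := hg.preimage
    (isPreconnected_Icc.image _ (continuous_polar.comp (by fun_prop)).continuousOn)
  have hav : g ⁻¹' K ⊆ lune (1 / 2) (1 / 2) '' sqInt ∪ lune 0 (1 / 2) '' sqInt := by
    rintro x ⟨s, hs, e⟩
    beta_reduce at e
    have n0 : ∀ t ∈ Icc (0 : ℝ) 1, x ≠ polar (t, 0) := by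
      rintro t ht rfl
      have := h0 t ht
      rw [← e] at this
      exact (hDd s hs t ht).not_ge (this.trans l3)
    have n1 : ∀ t ∈ Icc (0 : ℝ) 1, x ≠ polar (t, 1 / 2) := by
      rintro t ht rfl
      have := h1 t ht
      rw [← e] at this
      exact (hDd' s hs t ht).not_ge (this.trans l4)
    obtain ⟨p, hp, hpx⟩ := polar_surj 0 x
    have hp' := mem_sq.1 hp
    rw [zero_add] at hpx
    have y0 : p.2 ≠ 0 := fun h => n0 p.1 hp.1 (by rw [← hpx, h])
    have y1 : p.2 ≠ 1 := fun h => n0 p.1 hp.1 (by rw [← hpx, h, ← polar_add_one p.1 0, zero_add])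
    have y2 : p.2 ≠ 1 / 2 := fun h => n1 p.1 hp.1 (by rw [← hpx, h])
    have x01 : ¬ (p.1 = 0 ∨ p.1 = 1) := fun h => n0 p.1 hp.1 (by rw [← hpx, polar_side h])
    push Not at x01
    have hx : 0 < p.1 ∧ p.1 < 1 :=
      ⟨lt_of_le_of_ne hp'.1.1 x01.1.symm, lt_of_le_of_ne hp'.1.2 x01.2⟩
    have hy0 := lt_of_le_of_ne hp'.2.1 y0.symm
    have hy1 := lt_of_le_of_ne hp'.2.2 y1
    rcases lt_or_gt_of_ne y2 with h | h
    · refine .inr ⟨(p.1, 2 * p.2), mem_sqInt.2 ⟨hx, ?_, ?_⟩, ?_⟩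
      · exact mul_pos two_pos hy0
      · change 2 * p.2 < 1
        linarith
      · rw [← hpx, lune]
        congr 2
        ring
    · refine .inl ⟨(p.1, 2 * p.2 - 1), mem_sqInt.2 ⟨hx, ?_, ?_⟩, ?_⟩
      · change 0 < 2 * p.2 - 1
        linarith
      · change 2 * p.2 - 1 < 1
        linarith
      · rw [← hpx, lune]
        congr 2
        ring
  rcases hpre.subset_or_subset hU.isOpen_image hV.isOpen_image
    (hdisj.mono_right (image_mono sqInt_subset_sq)) hav with h | h
  · exact main g hg h0 h1 h
  · obtain ⟨Ψ, hΨ⟩ := main (fun x => g (flip x)) (hg.comp_homeomorph flip)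
      (h0.comp_flip (n := 0) (by simp)) (h1.comp_flip (n := -1) (by norm_num)) fun x hx => by
        obtain ⟨p, hp, e⟩ := h (show flip x ∈ g ⁻¹' K from hx)
        have hp' := mem_sqInt.1 hp
        refine ⟨(p.1, 1 - p.2), mem_sqInt.2 ⟨hp'.1, sub_pos.2 hp'.2.2, sub_lt_self _ hp'.2.1⟩, ?_⟩
        rw [← flip_lune, e, flip_flip]
    exact ⟨Ψ.trans flip, hΨ⟩

/-- If a monotone map is close to the identity on one meridian, then it is close to the identity
after a change of variables. -/
theorem exists_fix_of_arc {ε : ℝ} (hε : 0 < ε) : ∃ η, 0 < η ∧ ∀ g : Sph → Sph, Mono g →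
    NearArc η g 0 → ∃ Ψ : Sph ≃ₜ Sph, ∀ x, dist (g (Ψ x)) x ≤ ε := by
  obtain ⟨η₃, hη₃, H₃⟩ := exists_fix_of_three_arcs hε
  obtain ⟨η₂, hη₂, H₂⟩ := exists_fix_third_arc hη₃
  obtain ⟨η₁, hη₁, H₁⟩ := exists_fix_second_arc hη₂
  refine ⟨η₁, hη₁, fun g hg h => ?_⟩
  obtain ⟨Ψ₁, h1, h1'⟩ := H₁ g hg h
  obtain ⟨Ψ₂, h2, h2', h2''⟩ := H₂ _ (hg.comp_homeomorph Ψ₁) h1 h1'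
  obtain ⟨Ψ₃, h3⟩ := H₃ _ ((hg.comp_homeomorph Ψ₁).comp_homeomorph Ψ₂) h2 h2' h2''
  exact ⟨(Ψ₃.trans Ψ₂).trans Ψ₁, h3⟩

/-- In a one-point compactification, an arc that is straight in the affine chart can be moved by a
homeomorphism so that a monotone map fixing the point at infinity sends it close to itself, up to
a monotone change of parameter. -/
theorem exists_follow_homeomorph {E X : Type*} [NormedAddCommGroup E] [NormedSpace ℝ E]
    [ProperSpace E] [CompleteSpace E] [MetricSpace X] [CompactSpace X] (hX : ULC X) {v : X}
    {s : E → X} {f : X → E} (hs : IsEmbedding s) (hsr : range s = {v}ᶜ)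
    (hf : ContinuousOn f {v}ᶜ) (hsf : ∀ x, x ≠ v → s (f x) = x) {γ : ℝ → X}
    (hγ : ContinuousOn γ (Icc 0 1)) (hγv : ∀ t ∈ Icc (0 : ℝ) 1, γ t ≠ v) {p q : E} (hpq : p ≠ q)
    {k : ℝ → ℝ} (hk : MonotoneOn k (Icc 0 1)) (hk0 : k 0 = 0) (hk1 : k 1 = 1)
    (hγk : ∀ t ∈ Icc (0 : ℝ) 1, s (AffineMap.lineMap p q (k t)) = γ t) {η : ℝ} (hη : 0 < η)
    {g : X → X} (hg : Mono g) (hgv : g v = v) :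
    ∃ Ψ : X ≃ₜ X, ∃ τ : ℝ → ℝ, MonotoneOn τ (Icc 0 1) ∧ τ 0 = 0 ∧ τ 1 = 1 ∧
      ∀ t ∈ Icc (0 : ℝ) 1, dist (g (Ψ (γ t))) (γ (τ t)) ≤ η := by
  have h0 : (0 : ℝ) ∈ Icc (0 : ℝ) 1 := ⟨le_rfl, zero_le_one⟩
  have h1 : (1 : ℝ) ∈ Icc (0 : ℝ) 1 := ⟨zero_le_one, le_rfl⟩
  obtain ⟨D, hD, hDd⟩ := exists_lt_dist_of_disjoint (s := γ '' Icc (0 : ℝ) 1) (t := {v})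
    (isCompact_Icc.image_of_continuousOn hγ) isClosed_singleton (by
      rw [Set.disjoint_singleton_right]
      rintro ⟨t, ht, e⟩
      exact hγv t ht e)
  set η' := min (η / 2) (D / 2) with hη'def
  have hη' : 0 < η' := lt_min (by linarith) (by linarith)
  obtain ⟨η₀, hη₀, hfol⟩ := exists_follow hX hγ hη' one_pos
  obtain ⟨ρ, hρ, hρg⟩ := Metric.continuous_iff.1 hg.cont v (D / 2) (by linarith)
  rw [hgv] at hρg
  set K : Set X := {x | ρ ≤ dist x v} with hKdef
  have hK : IsCompact K :=
    (isClosed_le continuous_const (continuous_id.dist continuous_const)).isCompact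
  have hKv : ∀ x ∈ K, x ≠ v := by
    rintro x hx rfl
    rw [hKdef, mem_ofPred_eq, dist_self] at hx
    linarith
  have hfK : ContinuousOn f K := hf.mono hKv
  have hnear : ∀ x, ∀ t ∈ Icc (0 : ℝ) 1, dist (g x) (γ t) ≤ η' → x ∈ K := by
    intro x t ht hx
    by_contra hxK
    have h2 := hρg x (not_le.1 hxK)
    have h3 := hDd _ ⟨t, ht, rfl⟩ v rfl
    have h4 := dist_triangle_left (γ t) v (g x)
    linarith [min_le_right (η / 2) (D / 2)]
  set C := Metric.cthickening 1 (f '' K) with hCdef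
  have hC : IsCompact C := (hK.image_of_continuousOn hfK).cthickening
  obtain ⟨d, hd, hdg⟩ := exists_unif hC (γ := fun z => g (s z))
    (hg.cont.comp hs.continuous).continuousOn (half_pos hη)
  set r := min 1 (d / 2) with hrdef
  have hr : 0 < r := lt_min one_pos (by linarith)
  have hrg : ∀ x ∈ K, ∀ z, dist z (f x) ≤ r → dist (g (s z)) (g x) ≤ η / 2 := by
    intro x hx z hz
    have e1 : f x ∈ f '' K := ⟨x, hx, rfl⟩
    have h2 := hdg z (Metric.mem_cthickening_of_dist_le z (f x) 1 _ e1
      (hz.trans (min_le_left _ _))) (f x) (Metric.self_subset_cthickening _ e1)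
      (by linarith [min_le_right 1 (d / 2)])
    beta_reduce at h2
    rw [hsf x (hKv x hx)] at h2
    exact h2.le
  obtain ⟨δ, hδ, hδf⟩ := exists_unif hK hfK (ε := 2 * r) (by linarith)
  obtain ⟨a, ha⟩ := hg.surj (γ 0)
  obtain ⟨b, hb⟩ := hg.surj (γ 1)
  have hchain := hfol g hg a b (by rw [ha, dist_self]; exact hη₀.le)
    (by rw [hb, dist_self]; exact hη₀.le) (δ / 2) (by linarith)
  have haK : a ∈ K := hnear a 0 h0 (by rw [ha, dist_self]; exact hη'.le)
  set good : E → ℝ → Prop := fun z t =>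
    ∃ x ∈ K, f x = z ∧ t ∈ Icc (0 : ℝ) 1 ∧ dist (g x) (γ t) ≤ η' with hgood
  have hchain' : ∀ w : X × ℝ, Relation.ReflTransGen (Follow g γ η' 1 (δ / 2)) (a, 0) w →
      w.1 ∈ K ∧ Relation.ReflTransGen (fun u v : E × ℝ => dist u.1 v.1 < 2 * r ∧ u.2 ≤ v.2 ∧
        good v.1 v.2) (f a, 0) (f w.1, w.2) := by
    intro w hw
    induction hw with
    | refl => exact ⟨haK, .refl⟩
    | tail _ hst ih =>
      obtain ⟨s1, s2, s3, s4, -⟩ := hst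
      have hK' := hnear _ _ s3 s4
      exact ⟨hK', ih.2.tail ⟨hδf _ ih.1 _ hK' (by linarith), s2, _, hK', rfl, s3, s4⟩⟩
  obtain ⟨ψ, τ, hτ, hτ0, hτ1, hψ⟩ := exists_free_arc (good := good) hpq hr
    ⟨a, haK, rfl, h0, by rw [ha, dist_self]; exact hη'.le⟩ (hchain' _ hchain).2
  set e := OnePoint.equivOfIsEmbeddingOfRangeEq v s hs hsr with he
  have hk01 : ∀ t ∈ Icc (0 : ℝ) 1, k t ∈ Icc (0 : ℝ) 1 := fun t ht =>
    ⟨hk0 ▸ hk h0 ht ht.1, hk1 ▸ hk ht h1 ht.2⟩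
  refine ⟨e.symm.trans (ψ.onePointCongr.trans e), fun t => τ (k t), fun x hx y hy hxy =>
    hτ (hk01 x hx) (hk01 y hy) (hk hx hy hxy), (congrArg τ hk0).trans hτ0, (congrArg τ hk1).trans hτ1, ?_⟩
  intro t ht
  obtain ⟨z, ⟨x, hx, rfl, -, hxd⟩, hz⟩ := hψ (k t) (hk01 t ht)
  have e1 : (e.symm.trans (ψ.onePointCongr.trans e)) (γ t)
      = s (ψ (AffineMap.lineMap p q (k t))) := by
    have e2 : e (AffineMap.lineMap p q (k t) : E) = γ t := hγk t ht
    have e3 : e.symm (γ t) = (AffineMap.lineMap p q (k t) : E) := by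
      rw [← e2, Homeomorph.symm_apply_apply]
    rw [Homeomorph.trans_apply, e3]
    rfl
  rw [e1]
  have h5 := hrg x hx _ hz
  have h6 := dist_triangle (g (s (ψ (AffineMap.lineMap p q (k t))))) (g x) (γ (τ (k t)))
  linarith [min_le_left (η / 2) (D / 2)]

/-- The parameter of a meridian in a stereographic chart. -/
noncomputable def merid (x : ℝ) : ℝ :=
  (1 - Real.cos (Real.pi * x) / (1 + Real.sin (Real.pi * x))) / 2

lemma sin_pi_mul_nonneg {x : ℝ} (hx : x ∈ Icc (0 : ℝ) 1) : 0 ≤ Real.sin (Real.pi * x) :=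
  Real.sin_nonneg_of_nonneg_of_le_pi (mul_nonneg Real.pi_pos.le hx.1)
    (mul_le_of_le_one_right Real.pi_pos.le hx.2)

lemma monotoneOn_merid : MonotoneOn merid (Icc 0 1) := by
  intro x hx y hy hxy
  have h1 := sin_pi_mul_nonneg hx
  have h2 := sin_pi_mul_nonneg hy
  have h3 : Real.cos (Real.pi * y) ≤ Real.cos (Real.pi * x) :=
    Real.cos_le_cos_of_nonneg_of_le_pi (mul_nonneg Real.pi_pos.le hx.1)
      (mul_le_of_le_one_right Real.pi_pos.le hy.2)
      (mul_le_mul_of_nonneg_left hxy Real.pi_pos.le)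
  have h4 := sin_pi_mul_nonneg (x := y - x) ⟨by linarith, by linarith [hx.1, hy.2]⟩
  rw [mul_sub, Real.sin_sub] at h4
  have h5 : Real.cos (Real.pi * y) / (1 + Real.sin (Real.pi * y)) ≤
      Real.cos (Real.pi * x) / (1 + Real.sin (Real.pi * x)) := by
    rw [div_le_div_iff₀ (by linarith) (by linarith)]
    linarith
  unfold merid
  linarith

lemma polar_ne_antipode {t : ℝ} (ht : t ∈ Icc (0 : ℝ) 1) :
    polar (t, 0) ≠ polar (1 / 2, 1 / 2) := by
  intro h
  obtain ⟨h1, h2⟩ := polar_inj (p := (t, 0)) (q := (1 / 2, 1 / 2)) ht (by norm_num) h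
  simp only at h1 h2
  subst h1
  obtain ⟨n, hn⟩ := h2.resolve_left (by norm_num)
  have h3 : (2 * n + 1 : ℝ) = 0 := by linarith
  have h4 : 2 * n + 1 = 0 := by exact_mod_cast h3
  lia

lemma coe_polar_zero (t : ℝ) : ((polar (t, 0) : Sph) : EuclideanSpace ℝ (Fin 3)) =
    !₂[Real.sin (Real.pi * t), 0, Real.cos (Real.pi * t)] := by
  obtain ⟨h1, h2, h3⟩ := polar_eq_iff.1 (rfl : polar (t, 0) = polar (t, 0))
  ext i
  fin_cases i
  · simpa using h1.symm
  · simpa using h2.symm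
  · simpa using h3.symm

lemma coe_polar_half : ((polar (1 / 2, 1 / 2) : Sph) : EuclideanSpace ℝ (Fin 3)) =
    !₂[-1, 0, 0] := by
  obtain ⟨h1, h2, h3⟩ :=
    polar_eq_iff.1 (rfl : polar (1 / 2, 1 / 2) = polar (1 / 2, 1 / 2))
  have e1 : Real.pi * (1 / 2) = Real.pi / 2 := by ring
  have e2 : 2 * Real.pi * (1 / 2) = Real.pi := by ring
  simp only [e1, e2, Real.sin_pi_div_two, Real.cos_pi_div_two, Real.sin_pi, Real.cos_pi,
    one_mul] at h1 h2 h3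
  ext i
  fin_cases i
  · exact h1.symm
  · exact h2.symm
  · exact h3.symm

/-- A monotone map fixing the point opposite to the middle of a meridian can be normalised along
this meridian. -/
theorem exists_nearArc {ε : ℝ} (hε : 0 < ε) {g : Sph → Sph} (hg : Mono g)
    (hgv : g (polar (1 / 2, 1 / 2)) = polar (1 / 2, 1 / 2)) :
    ∃ Ψ : Sph ≃ₜ Sph, NearArc ε (fun x => g (Ψ x)) 0 := by
  set v : Sph := polar (1 / 2, 1 / 2) with hvdef
  have h0 : (0 : ℝ) ∈ Icc (0 : ℝ) 1 := ⟨le_rfl, zero_le_one⟩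
  have h1 : (1 : ℝ) ∈ Icc (0 : ℝ) 1 := ⟨zero_le_one, le_rfl⟩
  have hvn : ‖(v : EuclideanSpace ℝ (Fin 3))‖ = 1 := mem_sphere_zero_iff_norm.1 v.2
  set f := stereographic hvn with hfdef
  have hsrc : f.source = {v}ᶜ := stereographic_source hvn
  have hγc : Continuous fun t : ℝ => polar (t, 0) := continuous_polar.comp (by fun_prop)
  set P := (Submodule.span ℝ {(v : EuclideanSpace ℝ (Fin 3))})ᗮ.orthogonalProjectionOnto with hP
  set w := P !₂[0, 0, 1] with hw
  have hPv : P (v : EuclideanSpace ℝ (Fin 3)) = 0 :=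
    Submodule.orthogonalProjectionOnto_orthogonalComplement_singleton_eq_zero _
  have hw0 : w ≠ 0 := by
    intro h
    have e1 := Submodule.orthogonalProjectionOnto_eq_zero_iff.1 h
    have e2 : !₂[0, 0, 1] ∈ (Submodule.span ℝ {(v : EuclideanSpace ℝ (Fin 3))})ᗮ := by
      rw [Submodule.mem_orthogonal_singleton_iff_inner_right, hvdef, coe_polar_half,
        PiLp.inner_apply, Fin.sum_univ_three]
      simp
    have e3 := inner_self_eq_zero.1 (e1 _ e2)
    have e4 := congrArg (fun z : EuclideanSpace ℝ (Fin 3) => z 2) e3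
    simp at e4
  have hfγ : ∀ t ∈ Icc (0 : ℝ) 1, f (polar (t, 0)) =
      AffineMap.lineMap ((2 : ℝ) • w) (-((2 : ℝ) • w)) (merid t) := by
    intro t ht
    have hs := sin_pi_mul_nonneg ht
    have e1 : inner ℝ (v : EuclideanSpace ℝ (Fin 3)) (polar (t, 0) : Sph)
        = - Real.sin (Real.pi * t) := by
      rw [coe_polar_zero, hvdef, coe_polar_half, PiLp.inner_apply, Fin.sum_univ_three]
      simp
    have e2 : ((polar (t, 0) : Sph) : EuclideanSpace ℝ (Fin 3)) =
        -(Real.sin (Real.pi * t)) • (v : EuclideanSpace ℝ (Fin 3)) +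
          Real.cos (Real.pi * t) • !₂[0, 0, 1] := by
      rw [coe_polar_zero, hvdef, coe_polar_half]
      ext i
      fin_cases i <;> simp
    have e3 : P ((polar (t, 0) : Sph) : EuclideanSpace ℝ (Fin 3)) =
        Real.cos (Real.pi * t) • w := by
      rw [e2, map_add, map_smul, map_smul, hPv, smul_zero, zero_add]
    rw [hfdef, stereographic_apply, e1, e3, AffineMap.lineMap_apply_module, smul_neg, smul_smul,
      smul_smul, smul_smul, ← sub_eq_add_neg, ← sub_smul]
    congr 1
    unfold merid
    have hs' : 1 + Real.sin (Real.pi * t) ≠ 0 := by linarith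
    rw [sub_neg_eq_add]
    field_simp
    ring
  have hpq : (2 : ℝ) • w ≠ -((2 : ℝ) • w) := by
    rw [Ne, ← sub_eq_zero, sub_neg_eq_add, ← add_smul, smul_eq_zero]
    rintro (h | h)
    · norm_num at h
    · exact hw0 h
  obtain ⟨η, hη, hrep⟩ := exists_reparam (γ := fun t : ℝ => polar (t, 0)) hγc.continuousOn (by
    intro s hs t ht e
    exact (polar_inj (p := (s, 0)) (q := (t, 0)) hs ht e).1) hε
  obtain ⟨Ψ₁, τ, hτ, hτ0, hτ1, hΨ₁⟩ := exists_follow_homeomorph ulc_sph (v := v) (s := f.symm)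
    (f := f) (isOpenEmbedding_stereographic_symm hvn).isEmbedding
    (range_stereographic_symm hvn) (hsrc ▸ f.continuousOn)
    (fun x hx => f.left_inv (hsrc ▸ hx)) hγc.continuousOn
    (fun t ht => polar_ne_antipode ht) (p := (2 : ℝ) • w) (q := -((2 : ℝ) • w))
    hpq monotoneOn_merid
    (by simp [merid]) (by simp [merid])
    (fun t ht => by
      rw [← hfγ t ht]
      exact f.left_inv (hsrc ▸ polar_ne_antipode ht)) hη hg hgv
  have hτm : MapsTo τ (Icc 0 1) (Icc 0 1) := fun t ht =>
    ⟨hτ0 ▸ hτ h0 ht ht.1, hτ1 ▸ hτ ht h1 ht.2⟩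
  obtain ⟨ρ, σ, hρ, hσ⟩ := hrep (fun t => g (Ψ₁ (polar (t, 0)))) τ
    (hg.cont.comp (Ψ₁.continuous.comp hγc)).continuousOn hτ hτm hΨ₁
    (by simpa [hτ0] using hΨ₁ 0 h0) (by simpa [hτ1] using hΨ₁ 1 h1)
  obtain ⟨Ψ₂, hΨ₂, -⟩ := (preCell_lune_one (-1 / 2)).exists_descend ρ hρ
  refine ⟨Ψ₂.trans Ψ₁, fun t ht => ?_⟩
  obtain ⟨hσ1, hσ2, hσ3⟩ := hσ t ht
  have hl : ∀ x, lune (-1 / 2) 1 (x, 1 / 2) = polar (x, 0) := fun x => by norm_num [lune]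
  have hm : ((t, 1 / 2) : ℝ × ℝ) ∈ sq := by
    rw [mem_sq]
    exact ⟨ht, by norm_num⟩
  have e := hΨ₂ (t, 1 / 2) hm
  rw [hσ2, hl, hl] at e
  beta_reduce
  rw [Homeomorph.trans_apply, e]
  exact hσ3

lemma exists_homeomorph_apply_eq (x y : Sph) : ∃ R : Sph ≃ₜ Sph, R x = y := by
  set L := ((Submodule.span ℝ {(x : EuclideanSpace ℝ (Fin 3)) - y})ᗮ).reflection with hL
  have hm : ∀ z : Sph, L z ∈ Metric.sphere (0 : EuclideanSpace ℝ (Fin 3)) 1 := fun z => by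
    rw [mem_sphere_zero_iff_norm, LinearIsometryEquiv.norm_map]
    exact mem_sphere_zero_iff_norm.1 z.2
  have hc : Continuous fun z : Sph => (⟨L z, hm z⟩ : Sph) :=
    (L.continuous.comp continuous_subtype_val).subtype_mk _
  have hi : Function.Involutive fun z : Sph => (⟨L z, hm z⟩ : Sph) := fun z =>
    Subtype.ext (Submodule.reflection_reflection _ _)
  refine ⟨⟨hi.toPerm _, hc, hc⟩, Subtype.ext ?_⟩
  exact Submodule.reflection_sub (by
    rw [mem_sphere_zero_iff_norm.1 x.2, mem_sphere_zero_iff_norm.1 y.2])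

/-- Monotone self-maps of the sphere are approximated by homeomorphisms. -/
theorem Mono.exists_homeomorph_dist_le {g : Sph → Sph} (hg : Mono g) {ε : ℝ} (hε : 0 < ε) :
    ∃ H : Sph ≃ₜ Sph, ∀ x, dist (g x) (H x) ≤ ε := by
  obtain ⟨η, hη, hfix⟩ := exists_fix_of_arc hε
  obtain ⟨x, hx⟩ := hg.surj (polar (1 / 2, 1 / 2))
  obtain ⟨R, hR⟩ := exists_homeomorph_apply_eq (polar (1 / 2, 1 / 2)) x
  have hgR := hg.comp_homeomorph R
  obtain ⟨Ψ, hΨ⟩ := exists_nearArc hη hgR (by rw [hR, hx])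
  obtain ⟨Φ, hΦ⟩ := hfix _ (hgR.comp_homeomorph Ψ) hΨ
  refine ⟨((Φ.trans Ψ).trans R).symm, fun y => ?_⟩
  have h := hΦ (((Φ.trans Ψ).trans R).symm y)
  have e : R (Ψ (Φ (((Φ.trans Ψ).trans R).symm y))) = y :=
    ((Φ.trans Ψ).trans R).apply_symm_apply y
  rwa [e] at h

lemma surjective_of_tendstoUniformly {X Y : Type*} [TopologicalSpace X] [CompactSpace X]
    [MetricSpace Y] {h : X → Y} (hh : Continuous h) {H : ℕ → X → Y}
    (hs : ∀ j, Function.Surjective (H j)) (hH : TendstoUniformly H h atTop) :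
    Function.Surjective h := by
  intro y
  have hc : IsClosed (range h) := (isCompact_range hh).isClosed
  rw [← mem_range, ← hc.closure_eq, Metric.mem_closure_range_iff]
  intro ε hε
  obtain ⟨j, hj⟩ := (Metric.tendstoUniformly_iff.1 hH ε hε).exists
  obtain ⟨x, hx⟩ := hs j y
  exact ⟨x, by rw [dist_comm, ← hx]; exact hj x⟩

lemma isPreconnected_fiber_of_tendstoUniformly {X Y : Type*} [TopologicalSpace X] [CompactSpace X]
    [T2Space X] [MetricSpace Y] [LocallyConnectedSpace Y] {h : X → Y} (hh : Continuous h) {H : ℕ → X ≃ₜ Y}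
    (hH : TendstoUniformly (fun j x => H j x) h atTop) (b : Y) :
    IsPreconnected (h ⁻¹' {b}) := by
  have hcl : IsClosed (h ⁻¹' {b}) := isClosed_singleton.preimage hh
  rw [isPreconnected_iff_subset_of_fully_disjoint_closed hcl]
  intro u v hu hv hs huv
  by_contra hcon
  rw [not_or, Set.not_subset, Set.not_subset] at hcon
  obtain ⟨⟨y, hy, hyu⟩, x, hx, hxv⟩ := hcon
  have hxu := (hs hx).resolve_right hxv
  have hyv := (hs hy).resolve_left hyu
  obtain ⟨U, V, hU, hV, huU, hvV, hUV⟩ := normal_separation hu hv huv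
  have hb : (h '' (U ∪ V)ᶜ)ᶜ ∈ 𝓝 b := by
    refine (((hU.union hV).isClosed_compl.isCompact.image hh).isClosed.isOpen_compl).mem_nhds ?_
    rintro ⟨z, hz, e⟩
    exact hz ((hs e).imp (fun h => huU h) fun h => hvV h)
  obtain ⟨ε, hε, hball⟩ := Metric.mem_nhds_iff.1 hb
  obtain ⟨W, ⟨hWo, hbW, hWc⟩, hWb⟩ :=
    (LocallyConnectedSpace.open_connected_basis b).mem_iff.1 (Metric.ball_mem_nhds b (half_pos hε))
  obtain ⟨r, hr, hrW⟩ := Metric.isOpen_iff.1 hWo b hbW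
  obtain ⟨j, hj⟩ := (Metric.tendstoUniformly_iff.1 hH _ (lt_min hr (half_pos hε))).exists
  have hfib : ∀ z ∈ h ⁻¹' {b}, z ∈ H j ⁻¹' W := by
    intro z hz
    refine hrW ?_
    have h1 := (hj z).trans_le (min_le_left _ _)
    rwa [mem_singleton_iff.1 hz, dist_comm] at h1
  have hsub : H j ⁻¹' W ⊆ U ∪ V := by
    intro z hz
    have h1 := (hj z).trans_le (min_le_right _ _)
    have h2 : dist (H j z) b < ε / 2 := hWb hz
    have h3 : h z ∈ (h '' (U ∪ V)ᶜ)ᶜ :=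
      hball (Metric.mem_ball.2 (by linarith [dist_triangle (h z) (H j z) b]))
    by_contra h4
    exact h3 ⟨z, h4, rfl⟩
  have hpre : IsPreconnected (H j ⁻¹' W) := by
    rw [← Homeomorph.image_symm]
    exact hWc.isPreconnected.image _ (H j).symm.continuous.continuousOn
  obtain ⟨z, -, hzU, hzV⟩ := hpre U V hU hV hsub ⟨x, hfib x hx, huU hxu⟩ ⟨y, hfib y hy, hvV hyv⟩
  exact Set.disjoint_left.1 hUV hzU hzV

end Youngs

/-- Youngs' approximation theorem on the 2-sphere: a continuous self-map of `S²` is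
monotone (surjective with connected fibers) iff it is a uniform limit of
self-homeomorphisms of `S²`. -/
theorem monotone_iff_uniform_limit_of_homeomorphs_sphere
    (h : (Metric.sphere (0 : EuclideanSpace ℝ (Fin 3)) 1) →
         (Metric.sphere (0 : EuclideanSpace ℝ (Fin 3)) 1))
    (hcont : Continuous h) :
    (Function.Surjective h ∧ ∀ b, IsConnected (h ⁻¹' {b})) ↔
    ∃ H : ℕ → ((Metric.sphere (0 : EuclideanSpace ℝ (Fin 3)) 1) ≃ₜ
               (Metric.sphere (0 : EuclideanSpace ℝ (Fin 3)) 1)),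
      TendstoUniformly (fun j x => (H j) x) h atTop := by
  have : Fact (Module.finrank ℝ (EuclideanSpace ℝ (Fin 3)) = 2 + 1) := ⟨by simp⟩
  have : LocallyConnectedSpace (Metric.sphere (0 : EuclideanSpace ℝ (Fin 3)) 1) :=
    ChartedSpace.locallyConnectedSpace (EuclideanSpace ℝ (Fin 2)) _
  constructor
  · rintro ⟨hsurj, hfib⟩
    have hg : Youngs.Mono h := ⟨hcont, hsurj, fun b => (hfib b).isPreconnected⟩
    choose H hH using fun j : ℕ =>
      hg.exists_homeomorph_dist_le (Nat.one_div_pos_of_nat (α := ℝ) (n := j))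
    refine ⟨H, Metric.tendstoUniformly_iff.2 fun ε hε => ?_⟩
    filter_upwards [tendsto_one_div_add_atTop_nhds_zero_nat.eventually_lt_const hε] with j hj x
    exact (hH j x).trans_lt hj
  · rintro ⟨H, hH⟩
    have hs := Youngs.surjective_of_tendstoUniformly hcont (fun j => (H j).surjective) hH
    exact ⟨hs, fun b => ⟨hs b, Youngs.isPreconnected_fiber_of_tendstoUniformly hcont hH b⟩⟩
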